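/- arXiv:2508.12348 — 2 statements merged into one kernel-verified Lean document; each statement's English description precedes it below -/
import Mathlib

section
/- Let X be an S-concave (S ≥ 1), (C,D)-locally semi-convex, Busemann concave complete geodesic space whose Hausdorff dimension equals n ∈ ℕ. Then for μH[n]-almost every x ∈ X there exists a norm ‖·‖_x on ℝⁿ such that the blow-ups of X at x converge in the pointed Gromov–Hausdorff sense to (ℝⁿ, ‖·‖_x, 0); explicitly: for every ε > 0 there exists r₀ > 0 such that for every r ∈ (0, r₀) there is an ε-isometry from the pointed metric space (X, d/r, x) to (ℝⁿ, ‖·‖_x, 0). -/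
open Set Metric MeasureTheory Filter Topology

noncomputable section

variable {X : Type*} [MetricSpace X]

/-- A constant-speed geodesic parametrized on `[0,1]`. -/
def IsConstSpeedGeodesic (γ : ℝ → X) : Prop :=
  ∀ s ∈ Set.Icc (0:ℝ) 1, ∀ t ∈ Set.Icc (0:ℝ) 1,
    dist (γ s) (γ t) = |s - t| * dist (γ 0) (γ 1)

/-- A unit-speed geodesic parametrized on `[a,b]`. -/
def IsUnitSpeedGeodesicOn (ξ : ℝ → X) (a b : ℝ) : Prop :=
  ∀ s ∈ Set.Icc a b, ∀ t ∈ Set.Icc a b, dist (ξ s) (ξ t) = |s - t|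

/-- A geodesic space: any two points are joined by a constant-speed geodesic. -/
def IsGeodesicSpace (X : Type*) [MetricSpace X] : Prop :=
  ∀ x y : X, ∃ γ : ℝ → X, IsConstSpeedGeodesic γ ∧ γ 0 = x ∧ γ 1 = y

/-- `S`-concavity of the squared distance functions. -/
def SConcave (X : Type*) [MetricSpace X] (S : ℝ) : Prop :=
  ∀ (p : X) (γ : ℝ → X), IsConstSpeedGeodesic γ → ∀ t ∈ Set.Icc (0:ℝ) 1,
    (1 - t) * dist p (γ 0) ^ 2 + t * dist p (γ 1) ^ 2
      - S * t * (1 - t) * dist (γ 0) (γ 1) ^ 2 ≤ dist p (γ t) ^ 2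

/-- `(C,D)`-local semi-convexity of the squared distance functions. -/
def LocSemiConvex (X : Type*) [MetricSpace X] (C D : ℝ) : Prop :=
  ∀ (p : X) (γ : ℝ → X), IsConstSpeedGeodesic γ →
    (∀ t ∈ Set.Icc (0:ℝ) 1, dist p (γ t) < D) →
    ∀ t ∈ Set.Icc (0:ℝ) 1,
      dist p (γ t) ^ 2 ≤ (1 - t) * dist p (γ 0) ^ 2 + t * dist p (γ 1) ^ 2
        + C * t * (1 - t) * dist (γ 0) (γ 1) ^ 2

/-- Busemann concavity: `t ↦ dist (γ t) (η t) / t` is non-increasing for geodesics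
with a common starting point. -/
def BusemannConcave (X : Type*) [MetricSpace X] : Prop :=
  ∀ γ η : ℝ → X, IsConstSpeedGeodesic γ → IsConstSpeedGeodesic η → γ 0 = η 0 →
    ∀ s t : ℝ, 0 < s → s ≤ t → t ≤ 1 →
      dist (γ t) (η t) / t ≤ dist (γ s) (η s) / s

/-- The Euclidean comparison angle `∠̃(p, x, q)` at the vertex `x`. -/
def compAngle (p x q : X) : ℝ :=
  Real.arccos ((dist x p ^ 2 + dist x q ^ 2 - dist p q ^ 2) / (2 * dist x p * dist x q))

/-- `p` is a `(1,δ)`-strainer at `x` with opposite strainer `q`. -/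
def IsOneStrainer (S δ : ℝ) (x p q : X) : Prop :=
  p ≠ x ∧ q ≠ x ∧ Real.pi - δ < compAngle p x q ∧
    Real.arccos (1 - S * dist q x / (2 * dist p x)) < δ

/-- The tuple `p` is a `(k,δ)`-strainer at `x` with opposite strainer `q`. -/
def IsStrainer (S C D δ : ℝ) (x : X) {k : ℕ} (p q : Fin k → X) : Prop :=
  (∀ j, IsOneStrainer S δ x (p j) (q j)) ∧
  (∀ j : Fin k, (j : ℕ) = 0 → dist (p j) x < D) ∧
  ∀ i j : Fin k, i < j →
    Real.arccos (1 - (S + C) * dist (p j) x / (2 * dist (p i) x)) < δ ∧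
    |compAngle (p i) x (p j) - Real.pi / 2| < δ ∧
    |compAngle (p i) x (q j) - Real.pi / 2| < δ

/-- The set `A(k,δ)` of `(k,δ)`-strained points. -/
def strainedPoints (X : Type*) [MetricSpace X] (S C D δ : ℝ) (k : ℕ) : Set X :=
  {x : X | ∃ p q : Fin k → X, IsStrainer S C D δ x p q}

/-- The constant `δ_k = k⁻¹ 2^{-2k-1}`. -/
def strainerDelta (k : ℕ) : ℝ := ((k : ℝ) * 2 ^ (2 * k + 1))⁻¹

/-- The `ℓ¹` distance on `Fin k → ℝ`. -/
def l1dist {k : ℕ} (u v : Fin k → ℝ) : ℝ := ∑ i, |u i - v i|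

/-- `F` is an `ε`-open map on `U`, where the target carries the distance `dY`. -/
def IsEpsOpenOn {Y : Type*} (F : X → Y) (dY : Y → Y → ℝ) (U : Set X) (ε : ℝ) : Prop :=
  ∀ x ∈ U, ∃ r > 0, Metric.closedBall x (ε⁻¹ * r) ⊆ U ∧
    IsComplete (Metric.closedBall x (ε⁻¹ * r)) ∧
    ∀ v : Y, dY (F x) v < r → ∃ y ∈ U, F y = v ∧ ε * dist x y ≤ dY (F x) v

/-- `N` is a norm on a real vector space. -/
def IsNormFn {E : Type*} [AddCommGroup E] [Module ℝ E] (N : E → ℝ) : Prop :=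
  (∀ u, 0 ≤ N u) ∧ (∀ u, N u = 0 ↔ u = 0) ∧
  (∀ (a : ℝ) (u : E), N (a • u) = |a| * N u) ∧ ∀ u v, N (u + v) ≤ N u + N v

/-- `F` is an `ε`-isometry between pointed metric spaces, the metrics being
given by the explicit distance functions `dX` and `dY`. -/
def IsEpsIsometry {Y : Type*} (dX : X → X → ℝ) (x : X) (dY : Y → Y → ℝ) (y : Y)
    (ε : ℝ) (F : X → Y) : Prop :=
  F x = y ∧
  (∀ z z' : X, dX x z < 1 / ε → dX x z' < 1 / ε →
    |dX z z' - dY (F z) (F z')| < ε) ∧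
  ∀ r : ℝ, r < 1 / ε → ∀ w : Y, dY y w < r - ε →
    ∃ z : X, dX x z < r ∧ dY w (F z) ≤ ε

/-- The metric space `X` is doubling with constant `N`. -/
def MetricDoubling (X : Type*) [MetricSpace X] (N : ℕ) : Prop :=
  ∀ (x : X) (r : ℝ), 0 < r → ∃ t : Finset X,
    (Metric.ball x r ⊆ ⋃ y ∈ t, Metric.ball y (r / 2)) ∧ t.card ≤ N

section Helpers

/-- Homotheties towards a point: they do not contract more than linearly. -/
lemma exists_homothety (hgeo : IsGeodesicSpace X) (hbus : BusemannConcave X) (p : X) :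
    ∃ σ : X → ℝ → X, (∀ z, IsConstSpeedGeodesic (σ z) ∧ σ z 0 = p ∧ σ z 1 = z) ∧
      ∀ l : ℝ, 0 < l → l ≤ 1 → (∀ z, dist p (σ z l) = l * dist p z) ∧
        ∀ z z', l * dist z z' ≤ dist (σ z l) (σ z' l) := by
  choose σ h1 h2 h3 using hgeo p
  refine ⟨σ, fun z => ⟨h1 z, h2 z, h3 z⟩, fun l hl hl1 => ⟨fun z => ?_, fun z z' => ?_⟩⟩
  · have := h1 z 0 (by simp) l ⟨hl.le, hl1⟩
    rw [h2, h3] at this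
    rw [this]; simp [abs_of_pos hl]
  · have := hbus (σ z) (σ z') (h1 z) (h1 z') (by rw [h2, h2]) l 1 hl hl1 le_rfl
    rw [h3, h3, div_one, le_div_iff₀ hl] at this
    linarith

open scoped ENNReal NNReal in
/-- The packing bound. -/
lemma packing_bound [CompleteSpace X] (hgeo : IsGeodesicSpace X) (hbus : BusemannConcave X)
    (n : ℕ) (hdim : dimH (Set.univ : Set X) = n) (p : X) (R ε : ℝ) (hε : 0 < ε)
    (hεR : ε ≤ 16 * R) (t : Finset X) (ht : ∀ q ∈ t, dist p q < R)
    (hsep : ∀ a ∈ t, ∀ b ∈ t, a ≠ b → ε ≤ dist a b) :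
    (t.card : ℝ) ≤ (16 * R / ε) ^ n := by
  by_contra! hcon
  have hR : 0 < R := by linarith
  have h1 : 1 ≤ 16 * R / ε := by rw [le_div_iff₀ hε]; linarith
  have hcard : 1 < t.card := by
    have : (1 : ℝ) < t.card := lt_of_le_of_lt (one_le_pow₀ h1) hcon
    exact_mod_cast this
  set κ := ε / (16 * R) with hκdef
  have hκ0 : 0 < κ := by positivity
  have hκε : ε = 16 * R * κ := by rw [hκdef]; field_simp
  have hκ1 : κ < 1 / 8 := by
    obtain ⟨a, ha, b, hb, hab⟩ := Finset.one_lt_card.1 hcard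
    have := hsep a ha b hb hab
    have h2 := dist_triangle_left a b p
    have := ht a ha
    have := ht b hb
    rw [hκdef, div_lt_iff₀ (by positivity)]
    linarith
  have hcard2 : 1 < t.card * κ ^ (n : ℝ) := by
    rw [Real.rpow_natCast]
    have : (16 * R / ε) = κ⁻¹ := by rw [hκdef, inv_div]
    rw [this, inv_pow] at hcon
    have h3 : 0 < κ ^ n := by positivity
    rwa [inv_lt_iff_one_lt_mul₀ h3] at hcon
  obtain ⟨d, hdn, hd⟩ : ∃ d : ℝ, (n : ℝ) < d ∧ 1 ≤ t.card * κ ^ d := by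
    have hc : ContinuousAt (fun d : ℝ => (t.card : ℝ) * κ ^ d) n :=
      continuousAt_const.mul (Real.continuousAt_const_rpow hκ0.ne')
    have h4 : ∀ᶠ d in 𝓝 (n : ℝ), 1 < (t.card : ℝ) * κ ^ d := hc.eventually (lt_mem_nhds hcard2)
    have h5 := h4.filter_mono (nhdsWithin_le_nhds (s := Ioi (n : ℝ)))
    obtain ⟨d, hd, hd2⟩ := (h5.and self_mem_nhdsWithin).exists
    exact ⟨d, hd2, hd.le⟩
  have hd0 : 0 < d := lt_of_le_of_lt (Nat.cast_nonneg n) hdn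
  -- the threshold
  let T : ℝ → ℝ≥0∞ := fun s => ENNReal.ofReal ((2 * κ * s) ^ d)
  have hTpos : ∀ s, 0 < s → 0 < T s := fun s hs => by
    simp only [T, ENNReal.ofReal_pos]; positivity
  obtain ⟨U, w, hUcov, hw0, hwd, hwsum⟩ : ∃ (U : ℕ → Set X) (w : ℕ → ℝ≥0∞), (∀ z, ∃ i, z ∈ U i) ∧
      (∀ i, 0 < w i) ∧ (∀ i, (U i).Nonempty → ediam (U i) ^ d ≤ w i) ∧ ∑' i, w i < T R := by
    borelize X
    have hz : μH[d] (univ : Set X) = 0 := by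
      have := hausdorffMeasure_of_dimH_lt (s := (univ : Set X)) (d := d.toNNReal) (by
        rw [hdim]
        have : ((n : ℝ≥0) : ℝ≥0∞) < ((d.toNNReal : ℝ≥0) : ℝ≥0∞) := by
          rw [ENNReal.coe_lt_coe, ← NNReal.coe_lt_coe, Real.coe_toNNReal d hd0.le]; simpa using hdn
        simpa using this)
      rwa [Real.coe_toNNReal d hd0.le] at this
    rw [Measure.hausdorffMeasure_apply] at hz
    have hz1 : (⨅ (t : ℕ → Set X) (_ : univ ⊆ ⋃ n, t n) (_ : ∀ n, ediam (t n) ≤ 1),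
          ∑' n, ⨆ _ : (t n).Nonempty, ediam (t n) ^ d) = 0 := by
      refine le_antisymm ?_ (zero_le)
      rw [← hz]
      exact le_iSup₂_of_le (1 : ℝ≥0∞) one_pos le_rfl
    have hT2 : 0 < T R / 2 := ENNReal.div_pos (hTpos R hR).ne' (by simp)
    have hT2' := hT2
    rw [← hz1] at hT2'
    simp only [iInf_lt_iff] at hT2'
    obtain ⟨U, hU, -, hUs⟩ := hT2'
    obtain ⟨δ, hδ0, hδs⟩ := ENNReal.exists_pos_sum_of_countable hT2.ne' ℕ
    refine ⟨U, fun i => (⨆ _ : (U i).Nonempty, ediam (U i) ^ d) + δ i, fun z => ?_, fun i => ?_,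
      fun i hi => ?_, ?_⟩
    · simpa using hU (mem_univ z)
    · exact lt_of_lt_of_le (by exact_mod_cast hδ0 i) le_add_self
    · exact le_add_right (le_iSup_of_le hi le_rfl)
    · rw [ENNReal.tsum_add]
      calc _ < T R / 2 + T R / 2 := ENNReal.add_lt_add hUs hδs
        _ = T R := ENNReal.add_halves _
  classical
  let W : X → ℝ → ℝ≥0∞ := fun q s => ∑' i, if (U i ∩ closedBall q s).Nonempty then w i else 0
  have hWle : ∀ q s i, (U i ∩ closedBall q s).Nonempty → w i ≤ W q s := fun q s i hi => by
    have := ENNReal.le_tsum (f := fun i => if (U i ∩ closedBall q s).Nonempty then w i else 0) i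
    rw [if_pos hi] at this
    exact this
  have step : ∀ q s, dist p q + s ≤ R → 0 < s → W q s < T s →
      ∃ q', dist q q' ≤ s / 2 ∧ W q' (κ * s) < T (κ * s) := by
    intro q s hq hs hW
    obtain ⟨σ, -, hσ⟩ := exists_homothety hgeo hbus q
    have hl0 : 0 < s / (4 * R) := by positivity
    have hl1 : s / (4 * R) ≤ 1 := by
      rw [div_le_one (by positivity)]; linarith [dist_nonneg (x := p) (y := q)]
    obtain ⟨hσ1, hσ2⟩ := hσ _ hl0 hl1
    set Φ : X → X := fun z => σ z (s / (4 * R)) with hΦ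
    have hΦ1 : ∀ a ∈ t, dist q (Φ a) ≤ s / 2 := by
      intro a ha
      have e1 := hσ1 a
      have e2 : dist q a ≤ 2 * R := by
        have := dist_triangle_left q a p
        linarith [ht a ha, dist_nonneg (x := p) (y := q)]
      calc dist q (Φ a) = s / (4 * R) * dist q a := e1
        _ ≤ s / (4 * R) * (2 * R) := by gcongr
        _ = s / 2 := by field_simp; norm_num
    have hΦ2 : ∀ a ∈ t, ∀ b ∈ t, a ≠ b → 4 * κ * s ≤ dist (Φ a) (Φ b) := by
      intro a ha b hb hab
      calc 4 * κ * s = s / (4 * R) * ε := by rw [hκε]; field_simp; norm_num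
        _ ≤ s / (4 * R) * dist a b := by gcongr; exact hsep a ha b hb hab
        _ ≤ _ := hσ2 a b
    have hsum : ∑ a ∈ t, W (Φ a) (κ * s) ≤ W q s := by
      simp only [W]
      rw [← Summable.tsum_finsetSum (fun _ _ => ENNReal.summable)]
      refine ENNReal.tsum_le_tsum fun i => ?_
      by_cases hex : ∃ a ∈ t, (U i ∩ closedBall (Φ a) (κ * s)).Nonempty
      · obtain ⟨a, ha, y, hyU, hy⟩ := hex
        have hyq : (U i ∩ closedBall q s).Nonempty := by
          refine ⟨y, hyU, ?_⟩
          rw [mem_closedBall] at hy ⊢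
          have := dist_triangle y (Φ a) q
          have := hΦ1 a ha
          rw [dist_comm] at this
          nlinarith
        rw [if_pos hyq, Finset.sum_eq_single a]
        · split_ifs <;> simp
        · intro b hb hba
          rw [if_neg]
          rintro ⟨y', hy'U, hy'⟩
          have hd1 : 2 * κ * s ≤ dist y y' := by
            rw [mem_closedBall] at hy hy'
            have := hΦ2 b hb a ha hba
            have := dist_triangle4 (Φ b) y' y (Φ a)
            rw [dist_comm (Φ b) y', dist_comm y' y] at this
            linarith
          have hd2 : T s ≤ w i := by
            refine le_trans ?_ (hwd i ⟨y, hyU⟩)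
            simp only [T]
            rw [← ENNReal.ofReal_rpow_of_pos (by positivity)]
            refine ENNReal.rpow_le_rpow ?_ hd0.le
            refine le_trans ?_ (edist_le_ediam_of_mem hyU hy'U)
            rw [edist_dist]
            exact ENNReal.ofReal_le_ofReal hd1
          exact absurd hW (not_lt.2 (hd2.trans (hWle q s i hyq)))
        · intro h; exact absurd ha h
      · push Not at hex
        rw [Finset.sum_eq_zero]
        · exact zero_le
        · intro a ha
          rw [if_neg]
          rw [hex a ha]
          exact Set.not_nonempty_empty
    have hTT : T s ≤ ∑ a ∈ t, T (κ * s) := by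
      rw [Finset.sum_const, nsmul_eq_mul]
      simp only [T]
      rw [← ENNReal.ofReal_natCast, ← ENNReal.ofReal_mul (Nat.cast_nonneg _)]
      apply ENNReal.ofReal_le_ofReal
      have : 2 * κ * (κ * s) = κ * (2 * κ * s) := by ring
      rw [this, Real.mul_rpow hκ0.le (by positivity), ← mul_assoc]
      have h0 : 0 ≤ (2 * κ * s) ^ d := by positivity
      nlinarith
    obtain ⟨a, ha, hlt⟩ := Finset.exists_lt_of_sum_lt (lt_of_le_of_lt hsum (lt_of_lt_of_le hW hTT))
    exact ⟨Φ a, hΦ1 a ha, hlt⟩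
  have step' : ∀ (k : ℕ) q, (dist p q + κ ^ k * R ≤ R ∧ W q (κ ^ k * R) < T (κ ^ k * R)) →
      ∃ q', dist q q' ≤ (R / 2) * κ ^ k ∧
        (dist p q' + κ ^ (k + 1) * R ≤ R ∧ W q' (κ ^ (k + 1) * R) < T (κ ^ (k + 1) * R)) := by
    rintro k q ⟨h1, h2⟩
    have hp : 0 < κ ^ k * R := by positivity
    obtain ⟨q', h3, h4⟩ := step q (κ ^ k * R) h1 hp h2
    have e : κ ^ (k + 1) * R = κ * (κ ^ k * R) := by ring
    refine ⟨q', by linarith, ?_, by rw [e]; exact h4⟩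
    have := dist_triangle p q q'
    rw [e]; nlinarith
  choose! f hf1 hf2 using step'
  let q : ℕ → X := fun k => Nat.rec p (fun k a => f k a) k
  have hq : ∀ k, dist p (q k) + κ ^ k * R ≤ R ∧ W (q k) (κ ^ k * R) < T (κ ^ k * R) := by
    intro k
    induction k with
    | zero =>
      have e0 : q 0 = p := rfl
      simp only [e0, pow_zero, one_mul, dist_self, zero_add, le_refl, true_and]
      refine lt_of_le_of_lt ?_ hwsum
      refine ENNReal.tsum_le_tsum fun i => ?_
      split_ifs <;> simp
    | succ k ih => exact hf2 k (q k) ih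
  have hq2 : ∀ k, dist (q k) (q (k + 1)) ≤ (R / 2) * κ ^ k := fun k => hf1 k (q k) (hq k)
  obtain ⟨z, hz⟩ := cauchySeq_tendsto_of_complete
    (cauchySeq_of_le_geometric κ (R / 2) (by linarith) hq2)
  have hqz : ∀ k, dist (q k) z ≤ κ ^ k * R := by
    intro k
    have := dist_le_of_le_geometric_of_tendsto κ (R / 2) (by linarith) hq2 hz k
    refine this.trans ?_
    rw [div_le_iff₀ (by linarith)]
    have : 0 < κ ^ k * R := by positivity
    nlinarith
  obtain ⟨i, hi⟩ := hUcov z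
  have hlt : ∀ k, w i ≤ T (κ ^ k * R) := fun k =>
    (hWle (q k) (κ ^ k * R) i ⟨z, hi, by rw [mem_closedBall, dist_comm]; exact hqz k⟩).trans (hq k).2.le
  have hlim : Tendsto (fun k : ℕ => T (κ ^ k * R)) atTop (𝓝 0) := by
    have h6 : Tendsto (fun k : ℕ => (2 * κ * (κ ^ k * R)) ^ d) atTop (𝓝 0) := by
      have h7 : Tendsto (fun k : ℕ => (2 * κ * (κ ^ k * R))) atTop (𝓝 0) := by
        have := ((tendsto_pow_atTop_nhds_zero_of_lt_one hκ0.le (by linarith : κ < 1)).mul_const R).const_mul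
          (2 * κ)
        simpa using this
      have := h7.rpow_const (Or.inr hd0.le : (0 : ℝ) ≠ 0 ∨ 0 ≤ d)
      rwa [Real.zero_rpow hd0.ne'] at this
    have := ENNReal.tendsto_ofReal h6
    simpa [T] using this
  have := ge_of_tendsto' hlim hlt
  exact absurd (hw0 i) (by simpa using this)

lemma exists_net [CompleteSpace X] (hgeo : IsGeodesicSpace X) (hbus : BusemannConcave X)
    (n : ℕ) (hdim : dimH (Set.univ : Set X) = n) (p : X) (R ε : ℝ) (hε : 0 < ε)
    (hεR : ε ≤ 16 * R) : ∃ t : Finset X, (t.card : ℝ) ≤ (16 * R / ε) ^ n ∧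
      ∀ z, dist p z < R → ∃ q ∈ t, dist z q < ε := by
  classical
  let P : Finset X → Prop := fun t => (∀ q ∈ t, dist p q < R) ∧
    ∀ a ∈ t, ∀ b ∈ t, a ≠ b → ε ≤ dist a b
  have hP : ∀ t, P t → (t.card : ℝ) ≤ (16 * R / ε) ^ n := fun t ht =>
    packing_bound hgeo hbus n hdim p R ε hε hεR t ht.1 ht.2
  let A : Set ℕ := {k | ∃ t, P t ∧ t.card = k}
  have hA1 : A.Nonempty := ⟨0, ∅, by simp [P], rfl⟩
  have hA2 : BddAbove A := by
    refine ⟨⌈(16 * R / ε) ^ n⌉₊, ?_⟩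
    rintro k ⟨t, ht, rfl⟩
    exact_mod_cast (hP t ht).trans (Nat.le_ceil _)
  obtain ⟨t, ht, htc⟩ := Nat.sSup_mem hA1 hA2
  refine ⟨t, hP t ht, fun z hz => ?_⟩
  by_contra! hcon
  have hzt : z ∉ t := fun h => by
    have := hcon z h
    rw [dist_self] at this; linarith
  have : P (insert z t) := by
    refine ⟨?_, ?_⟩
    · intro q hq
      rcases Finset.mem_insert.1 hq with rfl | hq
      · exact hz
      · exact ht.1 q hq
    · intro a ha b hb hab
      rcases Finset.mem_insert.1 ha with ha | ha <;> rcases Finset.mem_insert.1 hb with hb | hb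
      · exact absurd (ha.trans hb.symm) hab
      · rw [ha]; exact hcon b hb
      · rw [hb, dist_comm]; exact hcon a ha
      · exact ht.2 a ha b hb hab
  have h2 : (insert z t).card ∈ A := ⟨_, this, rfl⟩
  have h3 := le_csSup hA2 h2
  rw [Finset.card_insert_of_notMem hzt, ← htc] at h3
  omega

open scoped ENNReal NNReal

lemma ediam_ball_le' {x : X} {r : ℝ} : ediam (ball x r) ≤ 2 * ENNReal.ofReal r := by
  rw [← Metric.eball_ofReal]
  exact Metric.ediam_eball_le

lemma measure_ball_le [CompleteSpace X] [MeasurableSpace X] [BorelSpace X]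
    (hgeo : IsGeodesicSpace X) (hbus : BusemannConcave X)
    (n : ℕ) (hdim : dimH (Set.univ : Set X) = n) (p : X) (R : ℝ) (hR : 0 < R) :
    (μH[(n : ℝ)] : Measure X) (ball p R) ≤ ENNReal.ofReal ((32 * R) ^ n) := by
  have hk : ∀ k : ℕ, ∃ t : Finset X, (t.card : ℝ) ≤ (16 * R / (R / (k + 1))) ^ n ∧
      ∀ z, dist p z < R → ∃ q ∈ t, dist z q < R / (k + 1) := fun k => by
    refine exists_net hgeo hbus n hdim p R _ (by positivity) ?_
    rw [div_le_iff₀ (by positivity)]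
    have : (0 : ℝ) ≤ k := k.cast_nonneg
    nlinarith
  choose t ht1 ht2 using hk
  have hε : ∀ k : ℕ, 0 < R / ((k : ℝ) + 1) := fun k => by positivity
  refine (Measure.hausdorffMeasure_le_liminf_sum (β := ℕ) (ι := fun k => t k) (n : ℝ) (ball p R)
    (l := atTop)
    (fun k => ENNReal.ofReal (2 * (R / ((k : ℝ) + 1)))) ?_ (fun k q => ball (q : X) (R / ((k : ℝ) + 1)))
    (Eventually.of_forall ?_) (Eventually.of_forall ?_)).trans ?_
  · have : Tendsto (fun k : ℕ => 2 * (R / ((k : ℝ) + 1))) atTop (𝓝 0) := by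
      have := (tendsto_one_div_add_atTop_nhds_zero_nat (𝕜 := ℝ)).const_mul (2 * R)
      rw [mul_zero] at this
      refine this.congr fun k => ?_
      ring
    simpa using ENNReal.tendsto_ofReal this
  · intro k q
    refine ediam_ball_le'.trans ?_
    rw [ENNReal.ofReal_mul (by norm_num)]
    simp
  · intro k z hz
    obtain ⟨q, hq, hzq⟩ := ht2 k z (by rw [dist_comm]; exact hz)
    exact mem_iUnion.2 ⟨⟨q, hq⟩, hzq⟩
  · refine (liminf_le_liminf (v := fun _ => ENNReal.ofReal ((32 * R) ^ n))
      (Eventually.of_forall fun k => ?_)).trans (by simp)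
    calc ∑ i : t k, ediam (ball (i : X) (R / ((k : ℝ) + 1))) ^ (n : ℝ)
        ≤ ∑ i : t k, ENNReal.ofReal (2 * (R / ((k : ℝ) + 1))) ^ (n : ℝ) := by
          refine Finset.sum_le_sum fun i _ => ENNReal.rpow_le_rpow ?_ (by positivity)
          refine ediam_ball_le'.trans ?_
          rw [ENNReal.ofReal_mul (by norm_num)]
          simp
      _ = ENNReal.ofReal ((t k).card * (2 * (R / ((k : ℝ) + 1))) ^ n) := by
          rw [Finset.sum_const, nsmul_eq_mul, ENNReal.rpow_natCast,
            ENNReal.ofReal_mul (Nat.cast_nonneg _), ENNReal.ofReal_pow (by have := hε k; linarith)]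
          simp
      _ ≤ _ := by
          apply ENNReal.ofReal_le_ofReal
          calc ((t k).card : ℝ) * (2 * (R / ((k : ℝ) + 1))) ^ n
              ≤ (16 * R / (R / (k + 1))) ^ n * (2 * (R / ((k : ℝ) + 1))) ^ n := by
                gcongr
                exact ht1 k
            _ = (32 * R) ^ n := by
                rw [← mul_pow]
                congr 1
                field_simp
                norm_num

lemma homothety_measure [MeasurableSpace X] [BorelSpace X] (n : ℕ) (f : X → X) (l : ℝ)
    (hl : 0 < l) (hf : ∀ z z', l * dist z z' ≤ dist (f z) (f z')) (A : Set X) :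
    ENNReal.ofReal (l ^ n) * (μH[(n : ℝ)] : Measure X) A ≤ (μH[(n : ℝ)] : Measure X) (f '' A) := by
  have ha : AntilipschitzWith (l⁻¹).toNNReal f := by
    refine AntilipschitzWith.of_le_mul_dist fun z z' => ?_
    rw [Real.coe_toNNReal _ (by positivity), ← div_eq_inv_mul, le_div_iff₀ hl]
    linarith [hf z z']
  have h1 := ha.le_hausdorffMeasure_image (d := (n : ℝ)) (by positivity) A
  have h2 : (((l⁻¹).toNNReal : ℝ≥0) : ℝ≥0∞) ^ (n : ℝ) = ENNReal.ofReal ((l⁻¹) ^ n) := by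
    rw [ENNReal.rpow_natCast, ENNReal.ofReal_pow (by positivity)]; rfl
  rw [h2] at h1
  calc _ ≤ ENNReal.ofReal (l ^ n) * (ENNReal.ofReal ((l⁻¹) ^ n) * (μH[(n : ℝ)] : Measure X) (f '' A)) := by
        gcongr
    _ = _ := by
        rw [← mul_assoc, ← ENNReal.ofReal_mul (by positivity), ← mul_pow, mul_inv_cancel₀ hl.ne']
        simp

/-- The basic facts about the measure, packaged over the reals. -/
structure MeasFacts (X : Type*) [MetricSpace X] [MeasurableSpace X] [BorelSpace X] (n : ℕ) : Prop where
  fin : ∀ (p : X) (R : ℝ), (μH[(n : ℝ)] : Measure X) (ball p R) ≠ ∞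
  upper : ∀ (p : X) (R : ℝ), 0 < R → (μH[(n : ℝ)] : Measure X).real (ball p R) ≤ (32 * R) ^ n
  pos : ∀ (p : X) (R : ℝ), 0 < R → 0 < (μH[(n : ℝ)] : Measure X).real (ball p R)
  homo : ∀ (f : X → X) (l : ℝ), 0 < l → (∀ z z', l * dist z z' ≤ dist (f z) (f z')) →
    ∀ (A : Set X) (p q : X) (R r : ℝ), A ⊆ ball p R → f '' A ⊆ ball q r →
    l ^ n * (μH[(n : ℝ)] : Measure X).real A ≤ (μH[(n : ℝ)] : Measure X).real (f '' A)
  bg : ∀ (p : X) (r R : ℝ), 0 < r → r ≤ R →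
    (r / R) ^ n * (μH[(n : ℝ)] : Measure X).real (ball p R) ≤ (μH[(n : ℝ)] : Measure X).real (ball p r)

lemma measFacts [CompleteSpace X] [MeasurableSpace X] [BorelSpace X]
    (hgeo : IsGeodesicSpace X) (hbus : BusemannConcave X)
    (n : ℕ) (hdim : dimH (Set.univ : Set X) = n)
    (hne : (μH[(n : ℝ)] : Measure X) univ ≠ 0) : MeasFacts X n := by
  set μ := (μH[(n : ℝ)] : Measure X) with hμ
  have hup := measure_ball_le hgeo hbus n hdim
  have hfin : ∀ (p : X) (R : ℝ), μ (ball p R) ≠ ∞ := by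
    intro p R
    rcases le_or_gt R 0 with h | h
    · rw [ball_eq_empty.2 h]; simp
    · exact ne_top_of_le_ne_top ENNReal.ofReal_ne_top (hup p R h)
  have hhomo : ∀ (f : X → X) (l : ℝ), 0 < l → (∀ z z', l * dist z z' ≤ dist (f z) (f z')) →
    ∀ (A : Set X) (p q : X) (R r : ℝ), A ⊆ ball p R → f '' A ⊆ ball q r →
    l ^ n * μ.real A ≤ μ.real (f '' A) := by
    intro f l hl hf A p q R r hA hfA
    have h1 := homothety_measure n f l hl hf A
    have h2 : μ (f '' A) ≠ ∞ := ne_top_of_le_ne_top (hfin q r) (measure_mono hfA)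
    have h3 := ENNReal.toReal_mono h2 h1
    rwa [ENNReal.toReal_mul, ENNReal.toReal_ofReal (by positivity)] at h3
  have hbg : ∀ (p : X) (r R : ℝ), 0 < r → r ≤ R →
      (r / R) ^ n * μ.real (ball p R) ≤ μ.real (ball p r) := by
    intro p r R hr hrR
    have hR : 0 < R := by linarith
    obtain ⟨σ, -, hσ⟩ := exists_homothety hgeo hbus p
    obtain ⟨h1, h2⟩ := hσ (r / R) (by positivity) (by rw [div_le_one hR]; exact hrR)
    have h3 : (fun z => σ z (r / R)) '' ball p R ⊆ ball p r := by
      rintro _ ⟨z, hz, rfl⟩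
      rw [mem_ball'] at hz ⊢
      rw [h1 z]
      calc r / R * dist p z < r / R * R := by gcongr
        _ = r := by field_simp
    refine (hhomo _ (r / R) (by positivity) h2 (ball p R) p p R r subset_rfl h3).trans ?_
    exact measureReal_mono h3 (hfin p r)
  refine ⟨hfin, ?_, ?_, hhomo, hbg⟩
  · intro p R hR
    have := ENNReal.toReal_mono ENNReal.ofReal_ne_top (hup p R hR)
    rwa [ENNReal.toReal_ofReal (by positivity)] at this
  · intro p R hR
    have h1 : ∃ m : ℕ, μ (ball p m) ≠ 0 := by
      by_contra! h
      apply hne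
      rw [← iUnion_ball_nat p]
      exact measure_iUnion_null h
    obtain ⟨m, hm⟩ := h1
    have h2 : 0 < μ.real (ball p (max m R)) := by
      rw [measureReal_def, ENNReal.toReal_pos_iff]
      refine ⟨?_, (hfin _ _).lt_top⟩
      exact lt_of_lt_of_le (pos_iff_ne_zero.2 hm) (measure_mono (ball_subset_ball (le_max_left _ _)))
    have h3 := hbg p R (max m R) hR (le_max_right _ _)
    refine lt_of_lt_of_le ?_ h3
    have : 0 < max (m : ℝ) R := lt_of_lt_of_le hR (le_max_right _ _)
    positivity

lemma properSpace_of [CompleteSpace X] (hgeo : IsGeodesicSpace X) (hbus : BusemannConcave X)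
    (n : ℕ) (hdim : dimH (Set.univ : Set X) = n) : ProperSpace X := by
  refine ⟨fun p R => ?_⟩
  refine TotallyBounded.isCompact_of_isClosed ?_ isClosed_closedBall
  rw [Metric.totallyBounded_iff]
  intro ε hε
  have hR : 0 < |R| + 1 := by positivity
  obtain ⟨t, -, ht⟩ := exists_net hgeo hbus n hdim p (|R| + 1) (min ε (|R| + 1)) (by positivity)
    (by have := min_le_right ε (|R| + 1); linarith)
  refine ⟨t, t.finite_toSet, fun z hz => ?_⟩
  obtain ⟨q, hq, hzq⟩ := ht z (by
    rw [mem_closedBall'] at hz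
    have := le_abs_self R
    linarith)
  simp only [mem_iUnion]
  exact ⟨q, hq, lt_of_lt_of_le hzq (min_le_left _ _)⟩

lemma doubling_of [MeasurableSpace X] [BorelSpace X] (n : ℕ) (hF : MeasFacts X n) :
    IsUnifLocDoublingMeasure (μH[(n : ℝ)] : Measure X) := by
  refine ⟨⟨(3 : ℝ≥0) ^ n, ?_⟩⟩
  filter_upwards [self_mem_nhdsWithin] with ε hε x
  have hε : 0 < ε := hε
  have h1 := hF.bg x ε (3 * ε) hε (by linarith)
  have h2 : closedBall x (2 * ε) ⊆ ball x (3 * ε) := closedBall_subset_ball (by linarith)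
  have h3 : ε / (3 * ε) = 3⁻¹ := by field_simp
  rw [h3, inv_pow, ← div_eq_inv_mul, div_le_iff₀ (by positivity)] at h1
  calc _ ≤ (μH[(n : ℝ)] : Measure X) (ball x (3 * ε)) := measure_mono h2
    _ ≤ ((3 : ℝ≥0) ^ n : ℝ≥0) * (μH[(n : ℝ)] : Measure X) (ball x ε) := by
      rw [← ENNReal.toReal_le_toReal (hF.fin _ _) (ENNReal.mul_ne_top (by simp) (hF.fin _ _))]
      rw [ENNReal.toReal_mul]
      simp only [measureReal_def] at h1
      simp
      linarith
    _ ≤ _ := by gcongr; exact ball_subset_closedBall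

lemma locFin_of [MeasurableSpace X] [BorelSpace X] (n : ℕ) (hF : MeasFacts X n) :
    IsLocallyFiniteMeasure (μH[(n : ℝ)] : Measure X) :=
  ⟨fun x => ⟨ball x 1, ball_mem_nhds x one_pos, (hF.fin x 1).lt_top⟩⟩

/-- Density points of arbitrary sets. -/
lemma ae_dense_near [ProperSpace X] [MeasurableSpace X] [BorelSpace X] (n : ℕ)
    (hF : MeasFacts X n) (A : Set X) :
    ∀ᵐ x ∂(μH[(n : ℝ)] : Measure X), x ∈ A → ∀ ε : ℝ, 0 < ε → ∃ r₀ > 0, ∀ r, 0 < r → r < r₀ →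
      ∀ z, dist x z < r → ∃ a ∈ A, dist a z < ε * r := by
  have := doubling_of n hF
  have := locFin_of n hF
  have h := ae_imp_of_ae_restrict
    (IsUnifLocDoublingMeasure.ae_tendsto_measure_inter_div (μH[(n : ℝ)] : Measure X) A 1)
  set μ := (μH[(n : ℝ)] : Measure X) with hμ
  filter_upwards [h] with x hx hxA ε0 hε0
  wlog hε1 : ε0 ≤ 1 generalizing ε0
  · obtain ⟨r₀, h1, h2⟩ := this 1 one_pos le_rfl
    refine ⟨r₀, h1, fun r hr hr0 z hz => ?_⟩
    obtain ⟨a, ha, haz⟩ := h2 r hr hr0 z hz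
    exact ⟨a, ha, by nlinarith⟩
  have hlim := hx hxA (ι := ℝ) (l := 𝓝[>] 0) (fun _ => x) (fun r => 2 * r) (by
      rw [tendsto_nhdsWithin_iff]
      refine ⟨?_, ?_⟩
      · have : Tendsto (fun r : ℝ => 2 * r) (𝓝 0) (𝓝 (2 * 0)) := (continuous_const_mul 2).tendsto 0
        rw [mul_zero] at this
        exact this.mono_left nhdsWithin_le_nhds
      · filter_upwards [self_mem_nhdsWithin] with r hr
        have : (0 : ℝ) < r := hr
        simpa using this) (by
      filter_upwards [self_mem_nhdsWithin] with r hr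
      have : (0 : ℝ) < r := hr
      simp [this.le])
  have hc : 0 < (ε0 / 4) ^ n := by positivity
  have hev : ∀ᶠ r in 𝓝[>] (0 : ℝ), ENNReal.ofReal (1 - (ε0 / 4) ^ n) <
      μ (A ∩ closedBall x (2 * r)) / μ (closedBall x (2 * r)) := by
    refine hlim.eventually (lt_mem_nhds ?_)
    rw [ENNReal.ofReal_lt_one]; linarith
  rw [eventually_nhdsWithin_iff, Metric.eventually_nhds_iff] at hev
  obtain ⟨r₀, hr₀, hr₀'⟩ := hev
  refine ⟨r₀, hr₀, fun r hr hrr z hz => ?_⟩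
  have h1 := hr₀' (y := r) (by simpa [abs_of_pos hr] using hrr) hr
  by_contra! hcon
  have hcbfin : μ (closedBall x (2 * r)) ≠ ∞ :=
    ne_top_of_le_ne_top (hF.fin x (3 * r)) (measure_mono (closedBall_subset_ball (by linarith)))
  have hsub : ball z (ε0 * r) ⊆ closedBall x (2 * r) := fun y hy => by
    rw [mem_ball] at hy
    rw [mem_closedBall]
    have := dist_triangle y z x
    rw [dist_comm z x] at this
    nlinarith
  have hdis : Disjoint (A ∩ closedBall x (2 * r)) (ball z (ε0 * r)) := by
    rw [Set.disjoint_left]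
    rintro y ⟨hyA, -⟩ hy
    exact absurd hy (not_lt.2 (hcon y hyA))
  have hadd : μ.real (A ∩ closedBall x (2 * r)) + μ.real (ball z (ε0 * r)) ≤
      μ.real (closedBall x (2 * r)) := by
    have := measure_union hdis (measurableSet_ball (x := z) (ε := ε0 * r)) (μ := μ)
    have h5 : μ (A ∩ closedBall x (2 * r) ∪ ball z (ε0 * r)) ≤ μ (closedBall x (2 * r)) :=
      measure_mono (union_subset inter_subset_right hsub)
    rw [this] at h5
    have h6 := ENNReal.toReal_mono hcbfin h5
    rwa [ENNReal.toReal_add (ne_top_of_le_ne_top hcbfin (measure_mono inter_subset_right))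
      (hF.fin _ _)] at h6
  have hbig : μ.real (closedBall x (2 * r)) ≤ μ.real (ball z (4 * r)) := by
    refine measureReal_mono (fun y hy => ?_) (hF.fin _ _)
    rw [mem_closedBall] at hy
    rw [mem_ball]
    have := dist_triangle y x z
    linarith
  have hbg := hF.bg z (ε0 * r) (4 * r) (by positivity) (by nlinarith)
  have he : ε0 * r / (4 * r) = ε0 / 4 := by field_simp
  rw [he] at hbg
  have hposz : 0 < μ.real (closedBall x (2 * r)) := by
    refine lt_of_lt_of_le (hF.pos x r hr) (measureReal_mono ?_ hcbfin)
    exact ball_subset_closedBall.trans (closedBall_subset_closedBall (by linarith))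
  have h7 : (1 - (ε0 / 4) ^ n) * μ.real (closedBall x (2 * r)) < μ.real (A ∩ closedBall x (2 * r)) := by
    have h8 := (ENNReal.toReal_lt_toReal (by simp) ?_).2 h1
    · rw [ENNReal.toReal_div, ENNReal.toReal_ofReal, ← measureReal_def, ← measureReal_def,
        lt_div_iff₀ hposz] at h8
      · exact h8
      · have : (ε0 / 4) ^ n ≤ 1 := pow_le_one₀ (by positivity) (by linarith)
        linarith
    · refine ENNReal.div_ne_top (ne_top_of_le_ne_top hcbfin (measure_mono inter_subset_right)) ?_
      intro h9
      rw [measureReal_def, h9] at hposz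
      simp at hposz
  nlinarith

/-- Points near which geodesics can be almost extended up to a definite length. -/
def GoodPt (D' : ℝ) (x : X) : Prop :=
  ∀ ε : ℝ, 0 < ε → ∃ R > 0, ∃ r₀ > 0, ∀ r, 0 < r → r < r₀ → ∀ z b : X, dist x z < r → dist x b < r →
    2 * ε * r < dist z b → ∃ (σ : ℝ → X) (l : ℝ), IsConstSpeedGeodesic σ ∧ 0 < l ∧ l ≤ 1 / 2 ∧
      dist (σ 0) z ≤ ε * r ∧ dist (σ l) b ≤ ε * r ∧ R ≤ dist (σ 0) (σ 1) ∧ dist (σ 0) (σ 1) ≤ D'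

/-- Almost extension of geodesics from a point with almost constant density ratio. -/
lemma extension [MeasurableSpace X] [BorelSpace X] (hgeo : IsGeodesicSpace X)
    (hbus : BusemannConcave X) (n : ℕ) (hF : MeasFacts X n) (a b : X) (R η ε : ℝ) (hR : 0 < R)
    (hη : 0 < η) (hε : 0 < ε) (hε1 : ε ≤ 1 / 2) (hηε : η * (4 / ε) ^ n < 1)
    (ha : ∀ r, 0 < r → r ≤ R → (μH[(n : ℝ)] : Measure X).real (ball a r) ≤
      (1 + η) * ((r / R) ^ n * (μH[(n : ℝ)] : Measure X).real (ball a R)))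
    (hab : 0 < dist a b) (hab' : dist a b ≤ R / 8) :
    ∃ (σ : ℝ → X) (l : ℝ), IsConstSpeedGeodesic σ ∧ 0 < l ∧ l ≤ 1 / 2 ∧ σ 0 = a ∧
      dist (σ l) b ≤ ε * dist a b ∧ R / 4 ≤ dist (σ 0) (σ 1) ∧ dist (σ 0) (σ 1) ≤ R := by
  set μ := (μH[(n : ℝ)] : Measure X) with hμ
  set s := dist a b with hs
  obtain ⟨σ, hσ, hσl⟩ := exists_homothety hgeo hbus a
  have hl0 : 0 < 2 * s / R := by positivity
  have hl1 : 2 * s / R ≤ 1 / 2 := by rw [div_le_iff₀ hR]; linarith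
  obtain ⟨h1, h2⟩ := hσl _ hl0 (by linarith)
  set l := 2 * s / R with hl
  set Φ := fun z => σ z l with hΦ
  have hlR : l * R = 2 * s := by rw [hl]; field_simp
  have himg : Φ '' ball a R ⊆ ball a (2 * s) := by
    rintro _ ⟨z, hz, rfl⟩
    rw [mem_ball'] at hz ⊢
    have := h1 z
    simp only [hΦ]
    rw [this, ← hlR]
    gcongr
  have key : ∃ z ∈ ball a R, dist (Φ z) b < ε * s := by
    by_contra! hcon
    have hdis : Disjoint (Φ '' ball a R) (ball b (ε * s)) := by
      rw [Set.disjoint_left]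
      rintro _ ⟨z, hz, rfl⟩ hy
      exact absurd hy (not_lt.2 (hcon z hz))
    have hsub : ball b (ε * s) ⊆ ball a (2 * s) := fun y hy => by
      rw [mem_ball] at hy ⊢
      have := dist_triangle y b a
      rw [dist_comm b a, ← hs] at this
      nlinarith
    have hadd : μ.real (Φ '' ball a R) + μ.real (ball b (ε * s)) ≤ μ.real (ball a (2 * s)) := by
      have h3 := measure_union hdis (measurableSet_ball (x := b) (ε := ε * s)) (μ := μ)
      have h5 : μ (Φ '' ball a R ∪ ball b (ε * s)) ≤ μ (ball a (2 * s)) :=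
        measure_mono (union_subset himg hsub)
      rw [h3] at h5
      have h6 := ENNReal.toReal_mono (hF.fin _ _) h5
      rwa [ENNReal.toReal_add (ne_top_of_le_ne_top (hF.fin _ _) (measure_mono himg))
        (hF.fin _ _)] at h6
    have h4 := hF.homo Φ l hl0 h2 (ball a R) a a R (2 * s) subset_rfl himg
    have h5 := ha (2 * s) (by positivity) (by linarith)
    have h6 : μ.real (Φ '' ball a R) ≤ μ.real (ball a (2 * s)) := measureReal_mono himg (hF.fin _ _)
    have h7 : μ.real (ball a (2 * s)) ≤ μ.real (ball b (4 * s)) := by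
      refine measureReal_mono (fun y hy => ?_) (hF.fin _ _)
      rw [mem_ball] at hy ⊢
      have := dist_triangle y a b
      rw [← hs] at this
      linarith
    have h8 := hF.bg b (ε * s) (4 * s) (by positivity) (by nlinarith)
    have h9 : ε * s / (4 * s) = (4 / ε)⁻¹ := by field_simp
    rw [h9, inv_pow, ← div_eq_inv_mul, div_le_iff₀ (by positivity)] at h8
    have h10 := hF.pos b (ε * s) (by positivity)
    have h11 : μ.real (ball a (2 * s)) ≤ (1 + η) * μ.real (Φ '' ball a R) := by
      refine h5.trans ?_
      gcongr
    have h12 : μ.real (ball b (ε * s)) ≤ η * μ.real (ball b (4 * s)) := by nlinarith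
    have h13 : μ.real (ball b (ε * s)) ≤ (η * (4 / ε) ^ n) * μ.real (ball b (ε * s)) := by
      refine h12.trans ?_
      rw [mul_assoc]
      gcongr
      linarith
    nlinarith
  obtain ⟨z, hz, hzb⟩ := key
  obtain ⟨g1, g2, g3⟩ := hσ z
  refine ⟨σ z, l, g1, hl0, hl1, g2, hzb.le, ?_, ?_⟩
  · rw [g2, g3]
    have e1 := h1 z
    have e2 : (1 - ε) * s ≤ dist a (Φ z) := by
      have := dist_triangle a (Φ z) b
      rw [← hs] at this
      linarith
    have e3 : (1 - ε) * s ≤ l * dist a z := by rw [← e1]; exact e2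
    have e4 : l * (R / 4) ≤ l * dist a z := by nlinarith
    exact le_of_mul_le_mul_left e4 hl0
  · rw [g2, g3]
    rw [mem_ball'] at hz
    exact hz.le

lemma ae_good [ProperSpace X] [MeasurableSpace X] [BorelSpace X] (hgeo : IsGeodesicSpace X)
    (hbus : BusemannConcave X) (n : ℕ) (hF : MeasFacts X n) (D' : ℝ) (hD' : 0 < D') :
    ∀ᵐ x ∂(μH[(n : ℝ)] : Measure X), GoodPt D' x := by
  set μ := (μH[(n : ℝ)] : Measure X) with hμ
  have hη : ∀ j : ℕ, ∃ η : ℝ, 0 < η ∧ η * (4 / (1 / ((j : ℝ) + 2))) ^ n < 1 := by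
    intro j
    have hp : 0 < (4 / (1 / ((j : ℝ) + 2))) ^ n := by positivity
    refine ⟨1 / 2 / (4 / (1 / ((j : ℝ) + 2))) ^ n, by positivity, ?_⟩
    rw [div_mul_cancel₀ _ hp.ne']
    norm_num
  choose η hη0 hη1 using hη
  let A : ℕ → ℕ → Set X := fun j k => {a | ∀ r, 0 < r → r ≤ D' / (k + 1) → μ.real (ball a r) ≤
      (1 + η j) * ((r / (D' / (k + 1))) ^ n * μ.real (ball a (D' / (k + 1))))}
  have hA : ∀ j x, ∃ k, x ∈ A j k := by
    intro j x
    let Θ : Set ℝ := {c | ∃ r, 0 < r ∧ c = μ.real (ball x r) / r ^ n}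
    have hΘ1 : Θ.Nonempty := ⟨_, 1, one_pos, rfl⟩
    have hΘ2 : BddAbove Θ := by
      refine ⟨32 ^ n, ?_⟩
      rintro _ ⟨r, hr, rfl⟩
      rw [div_le_iff₀ (by positivity), ← mul_pow]
      exact hF.upper x r hr
    have hsup : 0 < sSup Θ := by
      refine lt_of_lt_of_le ?_ (le_csSup hΘ2 ⟨1, one_pos, rfl⟩)
      have := hF.pos x 1 one_pos
      simpa using this
    obtain ⟨c, ⟨ρ, hρ, rfl⟩, hc⟩ := exists_lt_of_lt_csSup hΘ1
      (show sSup Θ / (1 + η j) < sSup Θ by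
        have := hη0 j
        rw [div_lt_iff₀ (by positivity)]; nlinarith)
    obtain ⟨k, hk⟩ := exists_nat_gt (D' / ρ)
    refine ⟨k, fun r hr hrk => ?_⟩
    set R := D' / ((k : ℝ) + 1) with hR
    have hR0 : 0 < R := by positivity
    have hRρ : R ≤ ρ := by
      rw [hR, div_le_iff₀ (by positivity)]
      rw [div_lt_iff₀ hρ] at hk
      nlinarith
    have h1 := hF.bg x R ρ hR0 hRρ
    have h2 : μ.real (ball x r) / r ^ n ≤ sSup Θ := le_csSup hΘ2 ⟨r, hr, rfl⟩
    have h3 : μ.real (ball x ρ) / ρ ^ n ≤ μ.real (ball x R) / R ^ n := by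
      rw [le_div_iff₀ (by positivity)]
      rw [div_pow] at h1
      calc _ = R ^ n / ρ ^ n * μ.real (ball x ρ) := by ring
        _ ≤ _ := h1
    have hηj := hη0 j
    rw [div_lt_iff₀ (by positivity)] at hc
    have h4 : μ.real (ball x r) / r ^ n ≤ (1 + η j) * (μ.real (ball x R) / R ^ n) := by nlinarith
    rw [div_le_iff₀ (by positivity)] at h4
    rw [div_pow]
    calc _ ≤ _ := h4
      _ = _ := by ring
  have hae : ∀ᵐ x ∂μ, ∀ j k, x ∈ A j k → ∀ ε : ℝ, 0 < ε → ∃ r₀ > 0, ∀ r, 0 < r → r < r₀ →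
      ∀ z, dist x z < r → ∃ a ∈ A j k, dist a z < ε * r := by
    rw [ae_all_iff]; intro j
    rw [ae_all_iff]; intro k
    exact ae_dense_near n hF (A j k)
  filter_upwards [hae] with x hx ε hε
  obtain ⟨j, hj⟩ := exists_nat_gt (3 / ε)
  obtain ⟨k, hk⟩ := hA j x
  set e := 1 / ((j : ℝ) + 2) with he
  have he0 : 0 < e := by positivity
  have he2 : e ≤ 1 / 2 := by
    rw [he]; apply one_div_le_one_div_of_le (by norm_num); linarith [j.cast_nonneg (α := ℝ)]
  have he3 : 3 * e ≤ ε := by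
    rw [div_lt_iff₀ hε] at hj
    rw [he, mul_one_div, div_le_iff₀ (by positivity)]
    nlinarith
  obtain ⟨r₀, hr₀, hr⟩ := hx j k hk e he0
  set R := D' / ((k : ℝ) + 1) with hR
  have hR0 : 0 < R := by positivity
  have hRD : R ≤ D' := by
    rw [hR, div_le_iff₀ (by positivity)]; nlinarith [k.cast_nonneg (α := ℝ)]
  refine ⟨R / 4, by positivity, min r₀ (R / 24), by positivity, fun r hr0 hrr z b hz hb hzb => ?_⟩
  obtain ⟨a, ha, haz⟩ := hr r hr0 (lt_of_lt_of_le hrr (min_le_left _ _)) z hz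
  have hr24 : r < R / 24 := lt_of_lt_of_le hrr (min_le_right _ _)
  have hab1 : 0 < dist a b := by
    have := dist_triangle_left z b a
    nlinarith
  have hab2 : dist a b ≤ 3 * r := by
    have := dist_triangle4 a z x b
    rw [dist_comm z x] at this
    nlinarith
  obtain ⟨σ, l, g1, g2, g3, g4, g5, g6, g7⟩ := extension hgeo hbus n hF a b R (η j) e hR0 (hη0 j) he0
    he2 (hη1 j) ha hab1 (by linarith)
  refine ⟨σ, l, g1, g2, g3, ?_, ?_, g6, g7.trans hRD⟩
  · rw [g4]; nlinarith
  · nlinarith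

/-- The collected hypotheses at a point `x`. -/
structure BlowSetup (x : X) (M D : ℝ) : Prop where
  hgeo : IsGeodesicSpace X
  hbus : BusemannConcave X
  hM : 1 ≤ M
  hD : 0 < D
  c11 : ∀ (p : X) (γ : ℝ → X), IsConstSpeedGeodesic γ →
    (∀ t ∈ Set.Icc (0:ℝ) 1, dist p (γ t) < D) → ∀ t ∈ Set.Icc (0:ℝ) 1,
      |dist p (γ t) ^ 2 - ((1 - t) * dist p (γ 0) ^ 2 + t * dist p (γ 1) ^ 2)| ≤
        M * t * (1 - t) * dist (γ 0) (γ 1) ^ 2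
  good : GoodPt (D / 16) x

/-- Short geodesics issuing from `x`. -/
def IsDir (x : X) (D : ℝ) (γ : ℝ → X) : Prop :=
  IsConstSpeedGeodesic γ ∧ γ 0 = x ∧ dist x (γ 1) < D / 8

/-- Test points. -/
abbrev TestPt (x : X) (D : ℝ) : Type _ := {p : X // 0 < dist p x ∧ dist p x < D / 4}

/-- The ambient Banach space. -/
abbrev Amb (x : X) (D : ℝ) : Type _ := lp (fun _ : TestPt x D => ℝ) ⊤

lemma le_of_small {a b c : ℝ} (h : ∀ t, 0 < t → t ≤ 1 → a * t ≤ b * t + c * t ^ 2) : a ≤ b := by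
  by_contra! hab
  have hc : 0 < |c| + 1 := by positivity
  set t := min 1 ((a - b) / 2 / (|c| + 1)) with ht
  have ht0 : 0 < t := lt_min one_pos (by have := sub_pos.2 hab; positivity)
  have h1 := h t ht0 (min_le_left _ _)
  have h2 : t * (|c| + 1) ≤ (a - b) / 2 := by
    rw [← le_div_iff₀ hc]; exact min_le_right _ _
  have h3 : a * t ≤ t * (b + c * t) := by nlinarith
  have h4 : a ≤ b + c * t := by
    have : t * a ≤ t * (b + c * t) := by linarith
    exact le_of_mul_le_mul_left this ht0
  have h5 : c * t ≤ |c| * t := by gcongr; exact le_abs_self c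
  nlinarith

lemma IsConstSpeedGeodesic.scale {γ : ℝ → X} (h : IsConstSpeedGeodesic γ) {c : ℝ} (hc : 0 ≤ c)
    (hc1 : c ≤ 1) : IsConstSpeedGeodesic (fun t => γ (c * t)) := by
  intro s hs t ht
  have h0 : c * s ∈ Icc (0:ℝ) 1 := ⟨mul_nonneg hc hs.1, mul_le_one₀ hc1 hs.1 hs.2⟩
  have h1 : c * t ∈ Icc (0:ℝ) 1 := ⟨mul_nonneg hc ht.1, mul_le_one₀ hc1 ht.1 ht.2⟩
  have h2 := h 0 ⟨le_rfl, zero_le_one⟩ c ⟨hc, hc1⟩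
  simp only [mul_zero, mul_one]
  rw [h _ h0 _ h1, h2, zero_sub, abs_neg, abs_of_nonneg hc, ← mul_sub, abs_mul, abs_of_nonneg hc]
  ring

lemma IsDir.dist_eq {x : X} {D : ℝ} {γ : ℝ → X} (h : IsDir x D γ) {t : ℝ} (ht : 0 ≤ t)
    (ht1 : t ≤ 1) : dist x (γ t) = t * dist x (γ 1) := by
  have := h.1 0 ⟨le_rfl, zero_le_one⟩ t ⟨ht, ht1⟩
  rwa [zero_sub, abs_neg, abs_of_nonneg ht, h.2.1] at this

lemma IsDir.scale {x : X} {D : ℝ} {γ : ℝ → X} (h : IsDir x D γ) {c : ℝ} (hc : 0 ≤ c)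
    (hc1 : c ≤ 1) : IsDir x D (fun t => γ (c * t)) := by
  refine ⟨h.1.scale hc hc1, by simp [h.2.1], ?_⟩
  simp only [mul_one]
  rw [h.dist_eq hc hc1]
  have := h.2.2
  nlinarith [dist_nonneg (x := x) (y := γ 1)]

/-- Difference quotient Cauchy estimate. -/
lemma quot_est {x : X} {M D : ℝ} (H : BlowSetup x M D) {γ : ℝ → X} (h : IsDir x D γ)
    (p : TestPt x D) {s t : ℝ} (hs : 0 ≤ s) (hs1 : s ≤ 1) (ht : 0 ≤ t) (ht1 : t ≤ 1) :
    |(dist p.1 (γ (t * s)) ^ 2 - dist p.1 x ^ 2) - s * (dist p.1 (γ t) ^ 2 - dist p.1 x ^ 2)| ≤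
      M * s * t ^ 2 * dist x (γ 1) ^ 2 := by
  have hb := H.c11 p.1 (fun u => γ (t * u)) (h.1.scale ht ht1) (by
    intro u hu
    have h1 := h.dist_eq (mul_nonneg ht hu.1) (mul_le_one₀ ht1 hu.1 hu.2)
    have h2 := dist_triangle p.1 x (γ (t * u))
    have h3 := p.2.2
    have h4 : t * u * dist x (γ 1) ≤ dist x (γ 1) :=
      mul_le_of_le_one_left dist_nonneg (mul_le_one₀ ht1 hu.1 hu.2)
    have := h.2.2
    have := H.hD
    linarith) s ⟨hs, hs1⟩
  simp only [mul_zero, mul_one] at hb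
  rw [h.2.1, h.dist_eq ht ht1] at hb
  have e : (dist p.1 (γ (t * s)) ^ 2 - dist p.1 x ^ 2) - s * (dist p.1 (γ t) ^ 2 - dist p.1 x ^ 2)
    = dist p.1 (γ (t * s)) ^ 2 - ((1 - s) * dist p.1 x ^ 2 + s * dist p.1 (γ t) ^ 2) := by ring
  rw [e]
  refine hb.trans ?_
  have hM := H.hM
  have h0 : 0 ≤ M * s * t ^ 2 * dist x (γ 1) ^ 2 := by positivity
  have : M * s * (1 - s) * (t * dist x (γ 1)) ^ 2 = (1 - s) * (M * s * t ^ 2 * dist x (γ 1) ^ 2) := by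
    ring
  rw [this]
  nlinarith

lemma exists_deriv {x : X} {M D : ℝ} (H : BlowSetup x M D) {γ : ℝ → X} (h : IsDir x D γ)
    (p : TestPt x D) : ∃ v : ℝ, ∀ t, 0 ≤ t → t ≤ 1 →
      |dist p.1 (γ t) ^ 2 - dist p.1 x ^ 2 - 2 * t * dist p.1 x * v| ≤
        M * t ^ 2 * dist x (γ 1) ^ 2 := by
  set g : ℝ → ℝ := fun t => dist p.1 (γ t) ^ 2 - dist p.1 x ^ 2 with hg
  set c := M * dist x (γ 1) ^ 2 with hc
  have hM := H.hM
  have hc0 : 0 ≤ c := by positivity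
  have hq : ∀ s t, 0 < s → s ≤ t → t ≤ 1 → |g s / s - g t / t| ≤ c * t := by
    intro s t hs hst ht1
    have ht : 0 < t := hs.trans_le hst
    have h1 := quot_est H h p (s := s / t) (t := t) (by positivity) (by rwa [div_le_one ht]) ht.le ht1
    have e : t * (s / t) = s := by field_simp
    rw [e] at h1
    have e2 : g s / s - g t / t = (g s - s / t * g t) / s := by field_simp
    rw [e2, abs_div, abs_of_pos hs, div_le_iff₀ hs]
    refine h1.trans (le_of_eq ?_)
    rw [hc]; field_simp
  let u : ℕ → ℝ := fun k => 1 / ((k : ℝ) + 1)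
  have hu0 : ∀ k, 0 < u k := fun k => by simp only [u]; positivity
  have hu1 : ∀ k, u k ≤ 1 := fun k => by
    simp only [u]; rw [div_le_one (by positivity)]; linarith [k.cast_nonneg (α := ℝ)]
  have hua : ∀ i j, i ≤ j → u j ≤ u i := fun i j hij => by
    simp only [u]; apply one_div_le_one_div_of_le (by positivity)
    have : (i:ℝ) ≤ j := by exact_mod_cast hij
    linarith
  have hut : Tendsto u atTop (𝓝 0) := tendsto_one_div_add_atTop_nhds_zero_nat
  have hcau : CauchySeq (fun k => g (u k) / u k) := by
    refine cauchySeq_of_le_tendsto_0 (fun k => 2 * c * u k) ?_ (by simpa using hut.const_mul (2 * c))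
    intro i j N hi hj
    rw [Real.dist_eq]
    have a1 := hq (u i) (u N) (hu0 i) (hua _ _ hi) (hu1 N)
    have a2 := hq (u j) (u N) (hu0 j) (hua _ _ hj) (hu1 N)
    have := abs_sub_le (g (u i) / u i) (g (u N) / u N) (g (u j) / u j)
    rw [abs_sub_comm (g (u N) / u N)] at this
    linarith
  obtain ⟨w, hw⟩ := cauchySeq_tendsto_of_complete hcau
  refine ⟨w / (2 * dist p.1 x), fun t ht ht1 => ?_⟩
  have hp := p.2.1
  have e : 2 * t * dist p.1 x * (w / (2 * dist p.1 x)) = t * w := by field_simp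
  rw [e]
  rcases ht.eq_or_lt with rfl | ht
  · simp [h.2.1]
  have h1 : |w - g t / t| ≤ c * t := by
    refine le_of_tendsto ((hw.sub_const (g t / t)).abs) ?_
    filter_upwards [hut.eventually (gt_mem_nhds ht)] with k hk
    exact hq _ _ (hu0 k) (le_of_lt hk) ht1
  have e2 : g t - t * w = -(w - g t / t) * t := by field_simp; ring
  change |g t - t * w| ≤ _
  rw [e2, abs_mul, abs_neg, abs_of_pos ht]
  calc _ ≤ c * t * t := by gcongr
    _ = _ := by rw [hc]; ring

lemma sq_diff_le (p a b : X) (d ρ : ℝ) (ha : dist p a ≤ d + ρ) (hb : dist p b ≤ d + ρ) :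
    |dist p a ^ 2 - dist p b ^ 2| ≤ dist a b * (2 * d + 2 * ρ) := by
  have e : dist p a ^ 2 - dist p b ^ 2 = (dist p a - dist p b) * (dist p a + dist p b) := by ring
  rw [e, abs_mul]
  have h1 : |dist p a - dist p b| ≤ dist a b := by
    rw [dist_comm p a, dist_comm p b]; exact abs_dist_sub_le a b p
  have h2 : |dist p a + dist p b| ≤ 2 * d + 2 * ρ := by
    rw [abs_of_nonneg (by positivity)]; linarith
  gcongr

/-- Property characterising the initial direction. -/
def IsLam (x : X) (M D : ℝ) (γ : ℝ → X) (v : Amb x D) : Prop :=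
  ∀ p : TestPt x D, ∀ t, 0 ≤ t → t ≤ 1 →
      |dist p.1 (γ t) ^ 2 - dist p.1 x ^ 2 - 2 * t * dist p.1 x * v p| ≤
        M * t ^ 2 * dist x (γ 1) ^ 2

lemma exists_isLam {x : X} {M D : ℝ} (H : BlowSetup x M D) {γ : ℝ → X} (h : IsDir x D γ) :
    ∃ v : Amb x D, IsLam x M D γ v ∧ ‖v‖ ≤ dist x (γ 1) := by
  choose v hv using exists_deriv H h
  have hb : ∀ p, |v p| ≤ dist x (γ 1) := by
    intro p
    have hp := p.2.1
    set d := dist p.1 x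
    set ℓ := dist x (γ 1) with hℓ
    have hℓ0 : 0 ≤ ℓ := dist_nonneg
    suffices 2 * d * |v p| ≤ 2 * d * ℓ from le_of_mul_le_mul_left this (by positivity)
    apply le_of_small (c := 2 * ℓ ^ 2 + M * ℓ ^ 2)
    intro t ht ht1
    have h1 := hv p t ht.le ht1
    have hxt := h.dist_eq ht.le ht1
    have h2 := sq_diff_le p.1 (γ t) x d (t * ℓ) (by
      have := dist_triangle p.1 x (γ t); rw [hxt] at this; exact this) (by
      have : 0 ≤ t * ℓ := by positivity
      change d ≤ _; linarith)
    rw [dist_comm (γ t), hxt] at h2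
    have h3 : |2 * t * d * v p| ≤ |dist p.1 (γ t) ^ 2 - d ^ 2| +
        |dist p.1 (γ t) ^ 2 - d ^ 2 - 2 * t * d * v p| := by
      have := abs_sub (dist p.1 (γ t) ^ 2 - d ^ 2) (dist p.1 (γ t) ^ 2 - d ^ 2 - 2 * t * d * v p)
      rwa [sub_sub_cancel] at this
    rw [abs_mul, abs_of_pos (show 0 < 2 * t * d by positivity)] at h3
    have h1' : |dist p.1 (γ t) ^ 2 - d ^ 2 - 2 * t * d * v p| ≤ M * t ^ 2 * ℓ ^ 2 := h1
    nlinarith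
  have hm : Memℓp (E := fun _ : TestPt x D => ℝ) v ⊤ := by
    apply memℓp_infty
    refine ⟨dist x (γ 1), ?_⟩
    rintro _ ⟨p, rfl⟩
    exact hb p
  refine ⟨⟨v, hm⟩, hv, ?_⟩
  exact lp.norm_le_of_forall_le dist_nonneg hb

lemma IsLam.unique {x : X} {M D : ℝ} {γ : ℝ → X} {v w : Amb x D}
    (hv : IsLam x M D γ v) (hw : IsLam x M D γ w) : v = w := by
  ext p
  have hp := p.2.1
  have : 2 * dist p.1 x * |v p - w p| ≤ 0 := by
    apply le_of_small (c := 2 * (M * dist x (γ 1) ^ 2))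
    intro t ht ht1
    have h1 := hv p t ht.le ht1
    have h2 := hw p t ht.le ht1
    have h3 := abs_sub (dist p.1 (γ t) ^ 2 - dist p.1 x ^ 2 - 2 * t * dist p.1 x * w p)
      (dist p.1 (γ t) ^ 2 - dist p.1 x ^ 2 - 2 * t * dist p.1 x * v p)
    have e : dist p.1 (γ t) ^ 2 - dist p.1 x ^ 2 - 2 * t * dist p.1 x * w p -
      (dist p.1 (γ t) ^ 2 - dist p.1 x ^ 2 - 2 * t * dist p.1 x * v p) =
      2 * t * dist p.1 x * (v p - w p) := by ring
    rw [e, abs_mul, abs_of_pos (show 0 < 2 * t * dist p.1 x by positivity)] at h3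
    nlinarith
  have h4 : |v p - w p| ≤ 0 := by
    by_contra! h
    have : 0 < 2 * dist p.1 x * |v p - w p| := by positivity
    linarith
  have := abs_eq_zero.1 (le_antisymm h4 (abs_nonneg _))
  linarith

open Classical in
/-- Initial direction of a geodesic. -/
def Lam (x : X) (M D : ℝ) (γ : ℝ → X) : Amb x D :=
  if h : ∃ v : Amb x D, IsLam x M D γ v ∧ ‖v‖ ≤ dist x (γ 1) then h.choose else 0

lemma lam_spec {x : X} {M D : ℝ} (H : BlowSetup x M D) {γ : ℝ → X} (h : IsDir x D γ) :
    IsLam x M D γ (Lam x M D γ) ∧ ‖Lam x M D γ‖ ≤ dist x (γ 1) := by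
  have := exists_isLam H h
  rw [Lam, dif_pos this]
  exact this.choose_spec

lemma lam_scale {x : X} {M D : ℝ} (H : BlowSetup x M D) {γ : ℝ → X} (h : IsDir x D γ)
    {c : ℝ} (hc : 0 ≤ c) (hc1 : c ≤ 1) :
    Lam x M D (fun t => γ (c * t)) = c • Lam x M D γ := by
  refine IsLam.unique (lam_spec H (h.scale hc hc1)).1 ?_
  intro p t ht ht1
  have h1 := (lam_spec H h).1 p (c * t) (mul_nonneg hc ht) (mul_le_one₀ hc1 ht ht1)
  simp only [mul_one]
  rw [h.dist_eq hc hc1]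
  have e1 : 2 * t * dist p.1 x * (c • Lam x M D γ) p = 2 * (c * t) * dist p.1 x * Lam x M D γ p := by
    rw [lp.coeFn_smul, Pi.smul_apply, smul_eq_mul]; ring
  rw [e1]
  convert h1 using 1
  ring

/-- The norm difference of directions is controlled by difference quotients of the distance. -/
lemma lam_sub_le {x : X} {M D : ℝ} (H : BlowSetup x M D) {γ η : ℝ → X} (h : IsDir x D γ)
    (h' : IsDir x D η) {Q : ℝ} (hQ0 : 0 ≤ Q)
    (hQ : ∀ t, 0 < t → t ≤ 1 → dist (γ t) (η t) ≤ Q * t) :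
    ‖Lam x M D γ - Lam x M D η‖ ≤ Q := by
  have hD := H.hD
  have hM := H.hM
  refine lp.norm_le_of_forall_le hQ0 fun p => ?_
  have hp := p.2.1
  rw [lp.coeFn_sub, Pi.sub_apply, Real.norm_eq_abs]
  set a := Lam x M D γ p
  set b := Lam x M D η p
  set d := dist p.1 x
  suffices 2 * d * |a - b| ≤ 2 * d * Q from le_of_mul_le_mul_left this (by positivity)
  apply le_of_small (c := 2 * D * Q + M * dist x (γ 1) ^ 2 + M * dist x (η 1) ^ 2)
  intro t ht ht1
  have h1 := (lam_spec H h).1 p t ht.le ht1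
  have h2 := (lam_spec H h').1 p t ht.le ht1
  have a1 : dist p.1 (γ t) ≤ d + t * D := by
    have := dist_triangle p.1 x (γ t)
    rw [h.dist_eq ht.le ht1] at this
    have := h.2.2
    nlinarith
  have a2 : dist p.1 (η t) ≤ d + t * D := by
    have := dist_triangle p.1 x (η t)
    rw [h'.dist_eq ht.le ht1] at this
    have := h'.2.2
    nlinarith
  have h3 := sq_diff_le p.1 (γ t) (η t) d (t * D) a1 a2
  have h4 : dist (γ t) (η t) * (2 * d + 2 * (t * D)) ≤ Q * t * (2 * d + 2 * (t * D)) := by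
    gcongr; exact hQ t ht ht1
  have e : 2 * t * d * (a - b) = (dist p.1 (γ t) ^ 2 - dist p.1 (η t) ^ 2) -
     ((dist p.1 (γ t) ^ 2 - d ^ 2 - 2 * t * d * a) - (dist p.1 (η t) ^ 2 - d ^ 2 - 2 * t * d * b)) := by
    ring
  have h5 := abs_sub (dist p.1 (γ t) ^ 2 - dist p.1 (η t) ^ 2)
     ((dist p.1 (γ t) ^ 2 - d ^ 2 - 2 * t * d * a) - (dist p.1 (η t) ^ 2 - d ^ 2 - 2 * t * d * b))
  have h6 := abs_sub (dist p.1 (γ t) ^ 2 - d ^ 2 - 2 * t * d * a)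
    (dist p.1 (η t) ^ 2 - d ^ 2 - 2 * t * d * b)
  rw [← e, abs_mul, abs_of_pos (show 0 < 2 * t * d by positivity)] at h5
  have h1' : |dist p.1 (γ t) ^ 2 - d ^ 2 - 2 * t * d * a| ≤ M * t ^ 2 * dist x (γ 1) ^ 2 := h1
  have h2' : |dist p.1 (η t) ^ 2 - d ^ 2 - 2 * t * d * b| ≤ M * t ^ 2 * dist x (η 1) ^ 2 := h2
  linarith

lemma dist_dir_le {x : X} {D : ℝ} {γ η : ℝ → X} (h : IsDir x D γ)
    (h' : IsDir x D η) {t : ℝ} (ht : 0 ≤ t) (ht1 : t ≤ 1) : dist (γ t) (η t) ≤ D / 4 * t := by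
  have h1 := dist_triangle_left (γ t) (η t) x
  rw [h.dist_eq ht ht1, h'.dist_eq ht ht1] at h1
  have := h.2.2
  have := h'.2.2
  nlinarith

lemma lam_upper {x : X} {M D : ℝ} (H : BlowSetup x M D) {γ η : ℝ → X} (h : IsDir x D γ)
    (h' : IsDir x D η) {ε : ℝ} (hε : 0 < ε) :
    ∃ t₀ > 0, ∀ t, 0 < t → t < t₀ → t ≤ 1 →
      t * ‖Lam x M D γ - Lam x M D η‖ ≤ dist (γ t) (η t) + ε * t := by
  set N := ‖Lam x M D γ - Lam x M D η‖ with hN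
  by_cases hNε : N ≤ ε
  · refine ⟨1, one_pos, fun t ht _ _ => ?_⟩
    have := dist_nonneg (x := γ t) (y := η t)
    nlinarith
  push Not at hNε
  by_contra! hcon
  have : N ≤ N - ε := by
    apply lam_sub_le H h h' (by linarith)
    intro t ht ht1
    obtain ⟨s, hs, hst, hs1, hlt⟩ := hcon t ht
    have h1 := H.hbus γ η h.1 h'.1 (h.2.1.trans h'.2.1.symm) s t hs hst.le ht1
    rw [div_le_div_iff₀ ht hs] at h1
    have h2 : dist (γ t) (η t) * s ≤ ((N - ε) * t) * s := by nlinarith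
    exact le_of_mul_le_mul_right h2 hs
  linarith

set_option maxHeartbeats 1000000 in
/-- Core estimate from a good point. -/
lemma lam_lower_core {x : X} {M D : ℝ} (H : BlowSetup x M D) {γ η : ℝ → X} (h : IsDir x D γ)
    (h' : IsDir x D η) {ε : ℝ} (hε : 0 < ε) (hε1 : ε ≤ 1) :
    ∃ t, 0 < t ∧ t ≤ ε ∧ dist (γ t) (η t) ≤ t * (‖Lam x M D γ - Lam x M D η‖ + ε * D) := by
  have hD := H.hD
  have hM := H.hM
  obtain ⟨R, hR, r₀, hr₀, hg⟩ := H.good ε hε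
  set N := ‖Lam x M D γ - Lam x M D η‖ with hN
  have hN0 : 0 ≤ N := norm_nonneg _
  -- choose t
  obtain ⟨t, ht, htε, htr, htR, htD, hte⟩ : ∃ t, 0 < t ∧ t ≤ ε ∧ t * (D / 8) < r₀ ∧
      t * (D / 8) ≤ R / 4 ∧ t * (D / 8) ≤ D / 32 ∧ (2 * M + 4) * (t * (D / 8)) ≤ ε * R := by
    have hpos : ∀ c : ℝ, 0 < c → ∀ᶠ t in 𝓝[>] (0:ℝ), t < c := fun c hc =>
      mem_nhdsWithin_of_mem_nhds (Iio_mem_nhds hc)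
    have hev : ∀ᶠ t in 𝓝[>] (0:ℝ), 0 < t := self_mem_nhdsWithin
    obtain ⟨t, a0, a1, a2, a3, a4, a5⟩ := (hev.and ((hpos ε hε).and ((hpos (r₀ / (D / 8)) (by positivity)).and
      ((hpos (R / 4 / (D / 8)) (by positivity)).and ((hpos (D / 32 / (D / 8)) (by positivity)).and
      (hpos (ε * R / ((2 * M + 4) * (D / 8))) (by positivity))))))).exists
    rw [lt_div_iff₀ (by positivity)] at a2 a3 a4 a5
    exact ⟨t, a0, a1.le, a2, a3.le, a4.le, by linarith⟩
  have ht1 : t ≤ 1 := htε.trans hε1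
  refine ⟨t, ht, htε, ?_⟩
  set r := t * (D / 8) with hr
  have hr0 : 0 < r := by positivity
  set z := γ t with hz
  set b := η t with hb
  have hxz : dist x z < r := by
    rw [hz, h.dist_eq ht.le ht1, hr]; have := h.2.2; gcongr
  have hxb : dist x b < r := by
    rw [hb, h'.dist_eq ht.le ht1, hr]; have := h'.2.2; gcongr
  have hDt : ε * r * 8 = t * (ε * D) := by rw [hr]; ring
  by_cases hsm : dist z b ≤ 4 * ε * r
  · have : 0 ≤ t * N := by positivity
    have : 0 < ε * r := by positivity
    linarith
  push Not at hsm
  obtain ⟨σ, l, hσ, hl0, hl1, hσz, hσb, hσR, hσD⟩ := hg r hr0 htr z b hxz hxb (by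
    have : 0 < ε * r := by positivity
    linarith)
  set p := σ 1 with hp
  have hεr : ε * r ≤ r := mul_le_of_le_one_left hr0.le hε1
  have b1 : dist (σ 0) (σ l) = l * dist (σ 0) p := by
    have := hσ 0 ⟨le_rfl, zero_le_one⟩ l ⟨hl0.le, by linarith⟩
    rwa [zero_sub, abs_neg, abs_of_pos hl0] at this
  have b2 : dist (σ l) p = (1 - l) * dist (σ 0) p := by
    have := hσ l ⟨hl0.le, by linarith⟩ 1 ⟨zero_le_one, le_rfl⟩
    rwa [abs_sub_comm, abs_of_nonneg (by linarith)] at this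
  have b3 : dist z b ≤ dist (σ 0) z + dist (σ 0) (σ l) + dist (σ l) b := by
    have := dist_triangle4 z (σ 0) (σ l) b
    rwa [dist_comm z (σ 0)] at this
  have b4 : dist p b ≤ dist (σ l) p + dist (σ l) b := dist_triangle_left p b (σ l)
  have b5 : dist (σ 0) p ≤ dist (σ 0) z + dist p z := by
    have := dist_triangle (σ 0) z p; rwa [dist_comm z p] at this
  have key : dist z b - 4 * (ε * r) ≤ dist p z - dist p b := by linarith
  have c1 : dist (σ 0) p ≤ dist (σ 0) z + dist x z + dist p x := by
    have := dist_triangle4 (σ 0) z x p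
    rwa [dist_comm z x, dist_comm x p] at this
  have c2 : dist p x ≤ dist (σ 0) p + dist (σ 0) z + dist x z := by
    have := dist_triangle4 p (σ 0) z x
    rwa [dist_comm p (σ 0), dist_comm z x] at this
  have hd1 : R / 2 ≤ dist p x := by linarith
  have hd2 : dist p x < D / 4 := by linarith
  let P : TestPt x D := ⟨p, by linarith, hd2⟩
  have e1 := (abs_le.1 ((lam_spec H h).1 P t ht.le ht1)).2
  have e2 := (abs_le.1 ((lam_spec H h').1 P t ht.le ht1)).1
  have e3 : Lam x M D γ P - Lam x M D η P ≤ N := by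
    have := lp.norm_apply_le_norm (by simp) (Lam x M D γ - Lam x M D η) P
    rw [lp.coeFn_sub, Pi.sub_apply, Real.norm_eq_abs] at this
    exact (le_abs_self _).trans this
  change dist p z ^ 2 - dist p x ^ 2 - 2 * t * dist p x * Lam x M D γ P ≤ _ at e1
  change _ ≤ dist p b ^ 2 - dist p x ^ 2 - 2 * t * dist p x * Lam x M D η P at e2
  have f1 : dist x (γ 1) ^ 2 ≤ (D / 8) ^ 2 := by gcongr; exact h.2.2.le
  have f2 : dist x (η 1) ^ 2 ≤ (D / 8) ^ 2 := by gcongr; exact h'.2.2.le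
  have g1 : M * t ^ 2 * dist x (γ 1) ^ 2 ≤ M * r ^ 2 := by
    calc _ ≤ M * t ^ 2 * (D / 8) ^ 2 := by gcongr
      _ = _ := by rw [hr]; ring
  have g2 : M * t ^ 2 * dist x (η 1) ^ 2 ≤ M * r ^ 2 := by
    calc _ ≤ M * t ^ 2 * (D / 8) ^ 2 := by gcongr
      _ = _ := by rw [hr]; ring
  set d := dist p x with hd
  have hd0 : 0 < d := by linarith
  have i1 : d - r ≤ dist p z := by
    have := dist_triangle p z x; rw [dist_comm z x] at this; linarith
  have i2 : d - r ≤ dist p b := by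
    have := dist_triangle p b x; rw [dist_comm b x] at this; linarith
  have j1 : 2 * t * d * (Lam x M D γ P - Lam x M D η P) ≤ 2 * t * d * N := by gcongr
  have j2 : (dist z b - 4 * (ε * r)) * (2 * d - 2 * r) ≤ dist p z ^ 2 - dist p b ^ 2 := by
    have e : dist p z ^ 2 - dist p b ^ 2 = (dist p z - dist p b) * (dist p z + dist p b) := by ring
    rw [e]
    apply mul_le_mul key (by linarith) (by linarith) (by linarith)
  have j3 : dist p z ^ 2 - dist p b ^ 2 ≤ 2 * t * d * N + 2 * (M * r ^ 2) := by linarith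
  have k1 : dist z b ≤ 2 * r := by
    have := dist_triangle_left z b x; linarith
  have j4 : (dist z b - 4 * (ε * r)) * (2 * r) ≤ 2 * r * (2 * r) := by
    have : 0 < ε * r := by positivity
    have : dist z b - 4 * (ε * r) ≤ 2 * r := by linarith
    gcongr
  have j5 : (dist z b - 4 * (ε * r)) * (2 * d) ≤ (t * N) * (2 * d) + (2 * M + 4) * r * r := by
    linarith
  have j6 : (2 * M + 4) * r * r ≤ (ε * r) * (2 * d) := by
    calc _ ≤ ε * R * r := by gcongr
      _ = ε * r * R := by ring
      _ ≤ _ := by gcongr; linarith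
  have j7 : (dist z b - 4 * (ε * r)) * (2 * d) ≤ (t * N + ε * r) * (2 * d) := by linarith
  have j8 := le_of_mul_le_mul_right j7 (by positivity)
  have : 0 < ε * r := by positivity
  linarith

lemma lam_lower {x : X} {M D : ℝ} (H : BlowSetup x M D) {γ η : ℝ → X} (h : IsDir x D γ)
    (h' : IsDir x D η) : dist (γ 1) (η 1) ≤ ‖Lam x M D γ - Lam x M D η‖ := by
  have hD := H.hD
  apply le_of_small (c := D)
  intro ε hε hε1
  obtain ⟨t, ht, htε, hle⟩ := lam_lower_core H h h' hε hε1
  have h1 := H.hbus γ η h.1 h'.1 (h.2.1.trans h'.2.1.symm) t 1 ht (htε.trans hε1) le_rfl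
  rw [div_one, le_div_iff₀ ht] at h1
  have h2 : dist (γ 1) (η 1) * t ≤ (‖Lam x M D γ - Lam x M D η‖ + ε * D) * t := by linarith
  have h3 := le_of_mul_le_mul_right h2 ht
  have := mul_le_mul_of_nonneg_right h3 hε.le
  linarith

lemma lam_lower' {x : X} {M D : ℝ} (H : BlowSetup x M D) {γ η : ℝ → X} (h : IsDir x D γ)
    (h' : IsDir x D η) {s s' : ℝ} (hs : 0 ≤ s) (hs1 : s ≤ 1) (hs' : 0 ≤ s') (hs1' : s' ≤ 1) :
    dist (γ s) (η s') ≤ ‖s • Lam x M D γ - s' • Lam x M D η‖ := by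
  have := lam_lower H (h.scale hs hs1) (h'.scale hs' hs1')
  rwa [lam_scale H h hs hs1, lam_scale H h' hs' hs1', mul_one, mul_one] at this

lemma isDir_const {x : X} {M D : ℝ} (H : BlowSetup x M D) : IsDir x D (fun _ => x) := by
  refine ⟨fun s _ t _ => by simp, rfl, ?_⟩
  have := H.hD
  simp; linarith

lemma lam_norm {x : X} {M D : ℝ} (H : BlowSetup x M D) {γ : ℝ → X} (h : IsDir x D γ) :
    ‖Lam x M D γ‖ = dist x (γ 1) := by
  refine le_antisymm (lam_spec H h).2 ?_
  have h0 := (lam_spec H (isDir_const H)).2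
  rw [dist_self] at h0
  have h1 := lam_lower H h (isDir_const H)
  rw [norm_le_zero_iff.1 h0, sub_zero, dist_comm] at h1
  exact h1

lemma lam_upper' {x : X} {M D : ℝ} (H : BlowSetup x M D) {γ η : ℝ → X} (h : IsDir x D γ)
    (h' : IsDir x D η) {s s' : ℝ} (hs : 0 ≤ s) (hs' : 0 ≤ s') {ε : ℝ} (hε : 0 < ε) :
    ∃ t₀ > 0, ∀ t, 0 < t → t < t₀ →
      t * ‖s • Lam x M D γ - s' • Lam x M D η‖ ≤ dist (γ (s * t)) (η (s' * t)) + ε * t := by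
  set c := 1 / (s + s' + 1) with hc
  have hc0 : 0 < c := by positivity
  have hcs : c * s ≤ 1 := by rw [hc, one_div_mul_eq_div, div_le_one (by positivity)]; linarith
  have hcs' : c * s' ≤ 1 := by rw [hc, one_div_mul_eq_div, div_le_one (by positivity)]; linarith
  obtain ⟨t₀, ht₀, hh⟩ := lam_upper H (h.scale (by positivity) hcs) (h'.scale (by positivity) hcs')
    (ε := c * ε) (by positivity)
  rw [lam_scale H h (by positivity) hcs, lam_scale H h' (by positivity) hcs'] at hh
  refine ⟨min (c * t₀) c, by positivity, fun t ht htt => ?_⟩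
  have h1 := hh (t / c) (by positivity) (by
    rw [div_lt_iff₀ hc0, mul_comm]; exact htt.trans_le (min_le_left _ _)) (by
    rw [div_le_one hc0]; exact htt.le.trans (min_le_right _ _))
  have e1 : c * s * (t / c) = s * t := by field_simp
  have e2 : c * s' * (t / c) = s' * t := by field_simp
  have e3 : c * ε * (t / c) = ε * t := by field_simp
  rw [mul_smul, mul_smul, ← smul_sub, norm_smul, Real.norm_of_nonneg hc0.le, e1, e2, e3] at h1
  have e4 : t / c * (c * ‖s • Lam x M D γ - s' • Lam x M D η‖) =
    t * ‖s • Lam x M D γ - s' • Lam x M D η‖ := by field_simp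
  rwa [e4] at h1

/-- The bounded part of the cone of directions. -/
def Kb (x : X) (M D B : ℝ) : Set (Amb x D) :=
  {v | ∃ (γ : ℝ → X) (s : ℝ), IsDir x D γ ∧ 0 ≤ s ∧ s * dist x (γ 1) ≤ B ∧ v = s • Lam x M D γ}

/-- The cone of directions. -/
def Kc (x : X) (M D : ℝ) : Set (Amb x D) :=
  {v | ∃ (γ : ℝ → X) (s : ℝ), IsDir x D γ ∧ 0 ≤ s ∧ v = s • Lam x M D γ}

lemma Kb_subset_Kc (x : X) (M D B : ℝ) : Kb x M D B ⊆ Kc x M D := by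
  rintro v ⟨γ, s, h, hs, _, hv⟩
  exact ⟨γ, s, h, hs, hv⟩

lemma Kb_packing [CompleteSpace X] {x : X} {M D : ℝ} (H : BlowSetup x M D) (n : ℕ)
    (hdim : dimH (Set.univ : Set X) = n) {B ε : ℝ} (hB : 0 ≤ B) (hε : 0 < ε) (hε1 : ε ≤ 1)
    (T : Finset (Amb x D)) (hT : ∀ v ∈ T, v ∈ Kb x M D B)
    (hsep : ∀ v ∈ T, ∀ w ∈ T, v ≠ w → ε ≤ dist v w) :
    (T.card : ℝ) ≤ (16 * (B + 1) / (ε / 2)) ^ n := by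
  classical
  have hT' : ∀ v : T, ∃ (γ : ℝ → X) (s : ℝ), IsDir x D γ ∧ 0 ≤ s ∧ s * dist x (γ 1) ≤ B ∧
    v.1 = s • Lam x M D γ := fun v => hT v.1 v.2
  choose γ s hγ hs hsB hv using hT'
  have hev : ∀ v w : T, ∀ᶠ t in 𝓝[>] (0:ℝ),
      t * dist v.1 w.1 ≤ dist (γ v (s v * t)) (γ w (s w * t)) + ε / 2 * t := by
    intro v w
    obtain ⟨t₀, ht₀, h⟩ := lam_upper' H (hγ v) (hγ w) (hs v) (hs w) (ε := ε / 2) (by positivity)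
    have : ∀ᶠ t in 𝓝[>] (0:ℝ), t < t₀ := mem_nhdsWithin_of_mem_nhds (Iio_mem_nhds ht₀)
    filter_upwards [this, self_mem_nhdsWithin] with t h1 h2
    rw [dist_eq_norm, hv v, hv w]
    exact h t h2 h1
  have hev2 : ∀ v : T, ∀ᶠ t in 𝓝[>] (0:ℝ), s v * t ≤ 1 := by
    intro v
    have : ∀ᶠ t in 𝓝[>] (0:ℝ), t < 1 / (s v + 1) := mem_nhdsWithin_of_mem_nhds
      (Iio_mem_nhds (by have := hs v; positivity))
    filter_upwards [this, self_mem_nhdsWithin] with t h1 h2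
    have h3 := hs v
    rw [lt_div_iff₀ (by positivity)] at h1
    have : 0 < t := h2
    linarith
  have hall : ∀ᶠ t in 𝓝[>] (0:ℝ), 0 < t ∧ (∀ v : T, s v * t ≤ 1) ∧ ∀ v w : T,
      t * dist v.1 w.1 ≤ dist (γ v (s v * t)) (γ w (s w * t)) + ε / 2 * t := by
    refine (Filter.Eventually.and self_mem_nhdsWithin ((eventually_all.2 hev2).and ?_))
    exact eventually_all.2 fun v => eventually_all.2 fun w => hev v w
  obtain ⟨t, ht, ht1, htt⟩ := hall.exists
  let f : T → X := fun v => γ v (s v * t)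
  have hfs : ∀ v w : T, v ≠ w → t * (ε / 2) ≤ dist (f v) (f w) := by
    intro v w hvw
    have h1 := htt v w
    have h2 := hsep v.1 v.2 w.1 w.2 (fun h => hvw (Subtype.ext h))
    have : t * ε ≤ t * dist v.1 w.1 := by gcongr
    simp only [f]; linarith
  have hfi : Function.Injective f := by
    intro v w hvw
    by_contra hne
    have := hfs v w hne
    rw [hvw, dist_self] at this
    have : 0 < t * (ε / 2) := by positivity
    linarith
  have hp := packing_bound H.hgeo H.hbus n hdim x (t * (B + 1)) (t * (ε / 2)) (by positivity)
    (by nlinarith) (Finset.univ.image f) (by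
      intro q hq
      obtain ⟨v, -, rfl⟩ := Finset.mem_image.1 hq
      have h0 := hs v
      simp only [f]
      rw [(hγ v).dist_eq (by positivity) (ht1 v)]
      have := hsB v
      nlinarith) (by
      intro a ha b hb hab
      obtain ⟨v, -, rfl⟩ := Finset.mem_image.1 ha
      obtain ⟨w, -, rfl⟩ := Finset.mem_image.1 hb
      exact hfs v w (fun h => hab (by rw [h])))
  rw [Finset.card_image_of_injective _ hfi, Finset.card_univ, Fintype.card_coe] at hp
  convert hp using 2
  field_simp

lemma Kb_totallyBounded [CompleteSpace X] {x : X} {M D : ℝ} (H : BlowSetup x M D) (n : ℕ)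
    (hdim : dimH (Set.univ : Set X) = n) {B : ℝ} (hB : 0 ≤ B) : TotallyBounded (Kb x M D B) := by
  classical
  rw [Metric.totallyBounded_iff]
  intro ε₀ hε₀
  set ε := min ε₀ 1 with hεd
  have hε : 0 < ε := lt_min hε₀ one_pos
  let P : Finset (Amb x D) → Prop := fun t => (∀ q ∈ t, q ∈ Kb x M D B) ∧
    ∀ a ∈ t, ∀ b ∈ t, a ≠ b → ε ≤ dist a b
  have hP : ∀ t, P t → (t.card : ℝ) ≤ (16 * (B + 1) / (ε / 2)) ^ n := fun t ht =>
    Kb_packing H n hdim hB hε (min_le_right _ _) t ht.1 ht.2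
  let A : Set ℕ := {k | ∃ t, P t ∧ t.card = k}
  have hA1 : A.Nonempty := ⟨0, ∅, by simp [P], rfl⟩
  have hA2 : BddAbove A := by
    refine ⟨⌈(16 * (B + 1) / (ε / 2)) ^ n⌉₊, ?_⟩
    rintro k ⟨t, ht, rfl⟩
    exact_mod_cast (hP t ht).trans (Nat.le_ceil _)
  obtain ⟨t, ht, htc⟩ := Nat.sSup_mem hA1 hA2
  refine ⟨t, t.finite_toSet, fun z hz => ?_⟩
  by_contra hcon
  have hcon : ∀ q ∈ t, ε ≤ dist z q := by
    intro q hq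
    by_contra! hlt
    apply hcon
    simp only [mem_iUnion, mem_ball]
    exact ⟨q, hq, hlt.trans_le (min_le_left _ _)⟩
  have hzt : z ∉ t := fun h => by
    have := hcon z h
    rw [dist_self] at this; linarith
  have : P (insert z t) := by
    refine ⟨?_, ?_⟩
    · intro q hq
      rcases Finset.mem_insert.1 hq with rfl | hq
      · exact hz
      · exact ht.1 q hq
    · intro a ha b hb hab
      rcases Finset.mem_insert.1 ha with ha | ha <;> rcases Finset.mem_insert.1 hb with hb | hb
      · exact absurd (ha.trans hb.symm) hab
      · rw [ha]; exact hcon b hb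
      · rw [hb, dist_comm]; exact hcon a ha
      · exact ht.2 a ha b hb hab
  have h2 : (insert z t).card ∈ A := ⟨_, this, rfl⟩
  have h3 := le_csSup hA2 h2
  rw [Finset.card_insert_of_notMem hzt, ← htc] at h3
  omega

lemma Kb_compact [CompleteSpace X] {x : X} {M D : ℝ} (H : BlowSetup x M D) (n : ℕ)
    (hdim : dimH (Set.univ : Set X) = n) {B : ℝ} (hB : 0 ≤ B) :
    IsCompact (closure (Kb x M D B)) :=
  (Kb_totallyBounded H n hdim hB).closure.isCompact_of_isClosed isClosed_closure

/-- Uniform comparison of directions and endpoints at small scales. -/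
lemma lam_uniform [CompleteSpace X] {x : X} {M D : ℝ} (H : BlowSetup x M D) (n : ℕ)
    (hdim : dimH (Set.univ : Set X) = n) {ε : ℝ} (hε : 0 < ε) :
    ∃ r₀ > 0, ∀ r, 0 < r → r < r₀ → ∀ γ η : ℝ → X, IsDir x D γ → IsDir x D η →
      dist x (γ 1) ≤ r → dist x (η 1) ≤ r →
      ‖Lam x M D γ - Lam x M D η‖ ≤ dist (γ 1) (η 1) + ε * r := by
  obtain ⟨T, hTK, hTf, hT⟩ := Metric.finite_approx_of_totallyBounded
    (Kb_totallyBounded H n hdim (B := 1) zero_le_one) (ε / 8) (by positivity)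
  have hT' : ∀ v : T, ∃ (γ : ℝ → X) (s : ℝ), IsDir x D γ ∧ 0 ≤ s ∧ s * dist x (γ 1) ≤ 1 ∧
    v.1 = s • Lam x M D γ := fun v => hTK v.2
  choose g s hg hs hsB hv using hT'
  have hfin : Finite T := hTf
  have hev : ∀ v w : T, ∀ᶠ t in 𝓝[>] (0:ℝ),
      t * ‖v.1 - w.1‖ ≤ dist (g v (s v * t)) (g w (s w * t)) + ε / 8 * t := by
    intro v w
    obtain ⟨t₀, ht₀, h⟩ := lam_upper' H (hg v) (hg w) (hs v) (hs w) (ε := ε / 8) (by positivity)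
    have : ∀ᶠ t in 𝓝[>] (0:ℝ), t < t₀ := mem_nhdsWithin_of_mem_nhds (Iio_mem_nhds ht₀)
    filter_upwards [this, self_mem_nhdsWithin] with t h1 h2
    rw [hv v, hv w]
    exact h t h2 h1
  have hev2 : ∀ v : T, ∀ᶠ t in 𝓝[>] (0:ℝ), s v * t ≤ 1 := by
    intro v
    have : ∀ᶠ t in 𝓝[>] (0:ℝ), t < 1 / (s v + 1) := mem_nhdsWithin_of_mem_nhds
      (Iio_mem_nhds (by have := hs v; positivity))
    filter_upwards [this, self_mem_nhdsWithin] with t h1 h2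
    have h3 := hs v
    rw [lt_div_iff₀ (by positivity)] at h1
    have : 0 < t := h2
    linarith
  have hall : ∀ᶠ t in 𝓝[>] (0:ℝ), (∀ v : T, s v * t ≤ 1) ∧ ∀ v w : T,
      t * ‖v.1 - w.1‖ ≤ dist (g v (s v * t)) (g w (s w * t)) + ε / 8 * t := by
    refine ((eventually_all.2 hev2).and ?_)
    exact eventually_all.2 fun v => eventually_all.2 fun w => hev v w
  obtain ⟨r₀, hr₀, hr⟩ := mem_nhdsGT_iff_exists_Ioo_subset.1 hall
  refine ⟨r₀, hr₀, fun r hr0 hrr γ η hγ hη hγr hηr => ?_⟩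
  obtain ⟨q1, q2⟩ := hr ⟨hr0, hrr⟩
  have near : ∀ γ : ℝ → X, IsDir x D γ → dist x (γ 1) ≤ r → ∃ v : T,
      ‖Lam x M D γ - r • v.1‖ ≤ ε / 8 * r ∧ dist (γ 1) (g v (s v * r)) ≤ ε / 8 * r := by
    intro γ hγ hγr
    have hmem : r⁻¹ • Lam x M D γ ∈ Kb x M D 1 := by
      refine ⟨γ, r⁻¹, hγ, by positivity, ?_, rfl⟩
      rw [inv_mul_le_iff₀ hr0]; linarith
    obtain ⟨v, hvT, hvb⟩ := mem_iUnion₂.1 (hT hmem)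
    rw [mem_ball, dist_eq_norm] at hvb
    have e : Lam x M D γ - r • v = r • (r⁻¹ • Lam x M D γ - v) := by
      rw [smul_sub, smul_smul, mul_inv_cancel₀ hr0.ne', one_smul]
    have b1 : ‖Lam x M D γ - r • v‖ ≤ ε / 8 * r := by
      rw [e, norm_smul, Real.norm_of_nonneg hr0.le, mul_comm]; gcongr
    refine ⟨⟨v, hvT⟩, b1, ?_⟩
    have hsv := hs ⟨v, hvT⟩
    have := lam_lower' H hγ (hg ⟨v, hvT⟩) zero_le_one le_rfl (s' := s ⟨v, hvT⟩ * r) (by positivity)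
      (q1 _)
    refine this.trans ?_
    rw [one_smul, mul_comm (s _) r, mul_smul, ← hv ⟨v, hvT⟩]
    exact b1
  obtain ⟨v, a1, a2⟩ := near γ hγ hγr
  obtain ⟨w, b1, b2⟩ := near η hη hηr
  have c1 := q2 v w
  have c2 : dist (g v (s v * r)) (g w (s w * r)) ≤
      dist (γ 1) (g v (s v * r)) + dist (γ 1) (η 1) + dist (η 1) (g w (s w * r)) := by
    have := dist_triangle4 (g v (s v * r)) (γ 1) (η 1) (g w (s w * r))
    rwa [dist_comm (g v (s v * r)) (γ 1)] at this
  have c3 : ‖Lam x M D γ - Lam x M D η‖ ≤ ‖Lam x M D γ - r • v.1‖ + r * ‖v.1 - w.1‖ +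
      ‖Lam x M D η - r • w.1‖ := by
    have e : Lam x M D γ - Lam x M D η = (Lam x M D γ - r • v.1) + r • (v.1 - w.1) -
      (Lam x M D η - r • w.1) := by rw [smul_sub]; abel
    rw [e]
    refine (norm_sub_le _ _).trans ?_
    gcongr
    refine (norm_add_le _ _).trans ?_
    rw [norm_smul, Real.norm_of_nonneg hr0.le]
  have : 0 < ε * r := by positivity
  linarith

lemma exists_dir {x : X} {M D : ℝ} (H : BlowSetup x M D) {y : X} (hy : dist x y < D / 8) :
    ∃ γ, IsDir x D γ ∧ γ 1 = y := by
  obtain ⟨γ, h1, h2, h3⟩ := H.hgeo x y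
  exact ⟨γ, ⟨h1, h2, by rwa [h3]⟩, h3⟩

/-- Pointwise limits of rescaled directions lie in the closed cone. -/
lemma mem_closure_of_approx [CompleteSpace X] {x : X} {M D : ℝ} (H : BlowSetup x M D) (n : ℕ)
    (hdim : dimH (Set.univ : Set X) = n) {B : ℝ} (hB : 0 ≤ B) (u : Amb x D) (t : ℕ → ℝ)
    (ht0 : ∀ j, 0 < t j) (ht : Tendsto t atTop (𝓝 0)) (y : ℕ → X)
    (hy : ∀ j, dist x (y j) ≤ B * t j)
    (hlim : ∀ p : TestPt x D, Tendsto (fun j => (dist p.1 (y j) ^ 2 - dist p.1 x ^ 2) / t j) atTop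
      (𝓝 (2 * dist p.1 x * u p))) : u ∈ closure (Kb x M D B) := by
  have hD := H.hD
  have hsmall : ∀ᶠ j in atTop, dist x (y j) < D / 8 := by
    have h1 : Tendsto (fun j => B * t j) atTop (𝓝 0) := by simpa using ht.const_mul B
    filter_upwards [h1.eventually (gt_mem_nhds (show 0 < D / 8 by positivity))] with j hj
    exact (hy j).trans_lt hj
  have hex : ∀ j, ∃ ζ : ℝ → X, dist x (y j) < D / 8 → IsDir x D ζ ∧ ζ 1 = y j := by
    intro j
    by_cases h : dist x (y j) < D / 8
    · obtain ⟨ζ, h1⟩ := exists_dir H h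
      exact ⟨ζ, fun _ => h1⟩
    · exact ⟨fun _ => x, fun h' => absurd h' h⟩
  choose ζ hζ using hex
  let a : ℕ → Amb x D := fun j => (t j)⁻¹ • Lam x M D (ζ j)
  have hcont : Continuous (fun v : Amb x D => (fun p => v p : TestPt x D → ℝ)) := by
    refine continuous_pi fun p => ?_
    refine (LipschitzWith.of_dist_le_mul (K := 1) fun v w => ?_).continuous
    rw [dist_eq_norm, dist_eq_norm, ← Pi.sub_apply, ← lp.coeFn_sub, NNReal.coe_one, one_mul]
    exact lp.norm_apply_le_norm (by simp) (v - w) p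
  have hcl : IsClosed ((fun v : Amb x D => (fun p => v p : TestPt x D → ℝ)) '' closure (Kb x M D B)) :=
    ((Kb_compact H n hdim hB).image hcont).isClosed
  have hmem : (fun p => u p : TestPt x D → ℝ) ∈
      (fun v : Amb x D => (fun p => v p : TestPt x D → ℝ)) '' closure (Kb x M D B) := by
    refine hcl.mem_of_tendsto (b := atTop) (f := fun j => (fun p => a j p : TestPt x D → ℝ)) ?_ ?_
    · rw [tendsto_pi_nhds]
      intro p
      have hp := p.2.1
      have h1 : Tendsto (fun j => (dist p.1 (y j) ^ 2 - dist p.1 x ^ 2) / t j / (2 * dist p.1 x)) atTop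
          (𝓝 (u p)) := by
        have := (hlim p).div_const (2 * dist p.1 x)
        rwa [mul_div_cancel_left₀ _ (by positivity)] at this
      have h2 : Tendsto (fun j => M * B ^ 2 * t j / (2 * dist p.1 x)) atTop (𝓝 0) := by
        simpa using (ht.const_mul (M * B ^ 2)).div_const (2 * dist p.1 x)
      have h3 : Tendsto (fun j => a j p - (dist p.1 (y j) ^ 2 - dist p.1 x ^ 2) / t j / (2 * dist p.1 x))
          atTop (𝓝 0) := by
        refine squeeze_zero_norm' ?_ h2
        filter_upwards [hsmall] with j hj
        obtain ⟨hd, hd1⟩ := hζ j hj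
        have h4 := (lam_spec H hd).1 p 1 zero_le_one le_rfl
        rw [hd1] at h4
        have h5 := ht0 j
        have e : a j p - (dist p.1 (y j) ^ 2 - dist p.1 x ^ 2) / t j / (2 * dist p.1 x) =
          -(dist p.1 (y j) ^ 2 - dist p.1 x ^ 2 - 2 * 1 * dist p.1 x * Lam x M D (ζ j) p) /
            (t j * (2 * dist p.1 x)) := by
          simp only [a]
          rw [lp.coeFn_smul, Pi.smul_apply, smul_eq_mul]
          field_simp
          ring
        rw [e, norm_div, norm_neg, Real.norm_eq_abs, Real.norm_of_nonneg (by positivity)]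
        rw [div_le_div_iff₀ (by positivity) (by positivity)]
        have h6 : dist x (y j) ^ 2 ≤ (B * t j) ^ 2 := by gcongr; exact hy j
        have hM := H.hM
        calc _ ≤ (M * 1 ^ 2 * dist x (y j) ^ 2) * (2 * dist p.1 x) := by gcongr
          _ ≤ (M * 1 ^ 2 * (B * t j) ^ 2) * (2 * dist p.1 x) := by gcongr
          _ = _ := by ring
      have := h3.add h1
      simpa using this
    · filter_upwards [hsmall] with j hj
      obtain ⟨hd, hd1⟩ := hζ j hj
      refine ⟨a j, subset_closure ⟨ζ j, (t j)⁻¹, hd, (inv_pos.2 (ht0 j)).le, ?_, rfl⟩, rfl⟩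
      rw [hd1, inv_mul_le_iff₀ (ht0 j), mul_comm]
      exact hy j
  obtain ⟨v, hv, hvu⟩ := hmem
  have : v = u := by ext p; exact congrFun hvu p
  rwa [← this]

lemma dir_tendsto {x : X} {M D : ℝ} (H : BlowSetup x M D) {γ : ℝ → X} (h : IsDir x D γ)
    {s : ℝ} (hs : 0 ≤ s) (t : ℕ → ℝ) (ht0 : ∀ j, 0 < t j) (ht1 : ∀ j, s * t j ≤ 1)
    (ht : Tendsto t atTop (𝓝 0)) (p : TestPt x D) :
    Tendsto (fun j => (dist p.1 (γ (s * t j)) ^ 2 - dist p.1 x ^ 2) / t j) atTop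
      (𝓝 (2 * dist p.1 x * (s • Lam x M D γ) p)) := by
  have h2 : Tendsto (fun j => M * s ^ 2 * dist x (γ 1) ^ 2 * t j) atTop (𝓝 0) := by
    simpa using (ht.const_mul (M * s ^ 2 * dist x (γ 1) ^ 2))
  rw [tendsto_iff_norm_sub_tendsto_zero]
  refine squeeze_zero (fun _ => norm_nonneg _) (fun j => ?_) h2
  have h5 := ht0 j
  have h4 := (lam_spec H h).1 p (s * t j) (by positivity) (ht1 j)
  have e : (dist p.1 (γ (s * t j)) ^ 2 - dist p.1 x ^ 2) / t j - 2 * dist p.1 x * (s • Lam x M D γ) p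
    = (dist p.1 (γ (s * t j)) ^ 2 - dist p.1 x ^ 2 - 2 * (s * t j) * dist p.1 x * Lam x M D γ p)
      / t j := by
    rw [lp.coeFn_smul, Pi.smul_apply, smul_eq_mul]; field_simp
  rw [e, norm_div, Real.norm_eq_abs, Real.norm_of_nonneg h5.le, div_le_iff₀ h5]
  refine h4.trans (le_of_eq ?_)
  ring

/-- Midpoints. -/
lemma half_add_mem [CompleteSpace X] {x : X} {M D : ℝ} (H : BlowSetup x M D) (n : ℕ)
    (hdim : dimH (Set.univ : Set X) = n) {u v : Amb x D} (hu : u ∈ Kc x M D) (hv : v ∈ Kc x M D) :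
    (1 / 2 : ℝ) • (u + v) ∈ closure (Kc x M D) := by
  obtain ⟨γ, s, hγ, hs, rfl⟩ := hu
  obtain ⟨η, s', hη, hs', rfl⟩ := hv
  have hD := H.hD
  have hM := H.hM
  set c := 1 / (s + s' + 1) with hc
  have hc0 : 0 < c := by positivity
  let t : ℕ → ℝ := fun j => c * (1 / ((j : ℝ) + 1))
  have ht0 : ∀ j, 0 < t j := fun j => by simp only [t]; positivity
  have htc : ∀ j, t j ≤ c := fun j => by
    simp only [t]
    apply mul_le_of_le_one_right hc0.le
    rw [div_le_one (by positivity)]; linarith [j.cast_nonneg (α := ℝ)]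
  have ht : Tendsto t atTop (𝓝 0) := by
    have := (tendsto_one_div_add_atTop_nhds_zero_nat (𝕜 := ℝ)).const_mul c
    rwa [mul_zero] at this
  have hcs : c * (s + s' + 1) = 1 := by rw [hc]; field_simp
  have hs1 : ∀ j, s * t j ≤ 1 := fun j => by
    have := htc j
    nlinarith
  have hs1' : ∀ j, s' * t j ≤ 1 := fun j => by
    have := htc j
    nlinarith
  have hgm := fun j => H.hgeo (γ (s * t j)) (η (s' * t j))
  choose m hm hm0 hm1 using hgm
  have ha : ∀ j, dist x (m j 0) ≤ s * t j * (D / 8) := fun j => by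
    have := ht0 j
    rw [hm0, hγ.dist_eq (by positivity) (hs1 j)]
    have := hγ.2.2
    gcongr
  have hb : ∀ j, dist x (m j 1) ≤ s' * t j * (D / 8) := fun j => by
    have := ht0 j
    rw [hm1, hη.dist_eq (by positivity) (hs1' j)]
    have := hη.2.2
    gcongr
  have hab : ∀ j, dist (m j 0) (m j 1) ≤ (s + s') * t j * (D / 8) := fun j => by
    have := dist_triangle_left (m j 0) (m j 1) x
    linarith [ha j, hb j]
  have ham : ∀ j, ∀ w ∈ Icc (0:ℝ) 1, dist (m j 0) (m j w) ≤ dist (m j 0) (m j 1) := by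
    intro j w hw
    rw [hm j 0 ⟨le_rfl, zero_le_one⟩ w hw, zero_sub, abs_neg, abs_of_nonneg hw.1]
    exact mul_le_of_le_one_left dist_nonneg hw.2
  have hhalf : (1 / 2 : ℝ) ∈ Icc (0:ℝ) 1 := ⟨by norm_num, by norm_num⟩
  refine closure_mono (Kb_subset_Kc x M D ((s + s') * D)) ?_
  refine mem_closure_of_approx H n hdim (by positivity) _ t ht0 ht (fun j => m j (1 / 2)) ?_ ?_
  · intro j
    have h1 := dist_triangle x (m j 0) (m j (1 / 2))
    have h2 := ham j _ hhalf
    have h3 := ha j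
    have h4 := hab j
    have h5 := ht0 j
    have : 0 ≤ s * t j * D := by positivity
    have : 0 ≤ s' * t j * D := by positivity
    have : (s + s') * D * t j = s * t j * D + s' * t j * D := by ring
    linarith
  · intro p
    have l1 := dir_tendsto H hγ hs t ht0 hs1 ht p
    have l2 := dir_tendsto H hη hs' t ht0 hs1' ht p
    have l3 := (l1.add l2).const_mul (1 / 2 : ℝ)
    have e0 : 1 / 2 * (2 * dist p.1 x * (s • Lam x M D γ) p + 2 * dist p.1 x * (s' • Lam x M D η) p) =
        2 * dist p.1 x * ((1 / 2 : ℝ) • (s • Lam x M D γ + s' • Lam x M D η)) p := by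
      have e1 : ((1 / 2 : ℝ) • (s • Lam x M D γ + s' • Lam x M D η)) p =
        1 / 2 * ((s • Lam x M D γ) p + (s' • Lam x M D η) p) := rfl
      rw [e1]; ring
    rw [e0] at l3
    have h2 : Tendsto (fun j => M * ((s + s') * D) ^ 2 * t j) atTop (𝓝 0) := by
      simpa using (ht.const_mul (M * ((s + s') * D) ^ 2))
    refine l3.congr_dist ?_
    refine squeeze_zero (fun _ => dist_nonneg) (fun j => ?_) h2
    have h5 := ht0 j
    have hcc := H.c11 p.1 (m j) (hm j) (by
      intro w hw
      have q1 := dist_triangle4 p.1 x (m j 0) (m j w)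
      have q2 := ham j w hw
      have q3 := ha j
      have q4 := hab j
      have q5 := p.2.2
      have q6 : s * t j * (D / 8) ≤ 1 * (D / 8) := by gcongr; exact hs1 j
      have q7 : s' * t j * (D / 8) ≤ 1 * (D / 8) := by gcongr; exact hs1' j
      linarith) (1 / 2) hhalf
    rw [hm0, hm1] at hcc
    rw [dist_comm, Real.dist_eq]
    have e : (dist p.1 (m j (1 / 2)) ^ 2 - dist p.1 x ^ 2) / t j -
        1 / 2 * ((dist p.1 (γ (s * t j)) ^ 2 - dist p.1 x ^ 2) / t j +
          (dist p.1 (η (s' * t j)) ^ 2 - dist p.1 x ^ 2) / t j) =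
        (dist p.1 (m j (1 / 2)) ^ 2 - ((1 - 1 / 2) * dist p.1 (γ (s * t j)) ^ 2 +
          1 / 2 * dist p.1 (η (s' * t j)) ^ 2)) / t j := by
      field_simp; ring
    rw [e, abs_div, abs_of_pos h5, div_le_iff₀ h5]
    refine hcc.trans ?_
    have := hab j
    rw [hm0, hm1] at this
    have h8 : dist (γ (s * t j)) (η (s' * t j)) ^ 2 ≤ ((s + s') * t j * D) ^ 2 := by
      gcongr
      refine this.trans ?_
      gcongr; linarith
    have h9 : M * ((s + s') * D) ^ 2 * t j * t j = M * ((s + s') * t j * D) ^ 2 := by ring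
    rw [h9]
    calc _ ≤ M * (1 / 2) * (1 - 1 / 2) * ((s + s') * t j * D) ^ 2 := by gcongr
      _ ≤ _ := by
        have : 0 ≤ M * ((s + s') * t j * D) ^ 2 := by positivity
        linarith

lemma exists_small (c₁ c₂ a : ℝ) (h₁ : 0 < c₁) (h₂ : 0 < c₂) (ha : 0 < a) :
    ∃ t, 0 < t ∧ t ≤ c₁ ∧ a * t < c₂ := by
  refine ⟨min c₁ (c₂ / a / 2), by positivity, min_le_left _ _, ?_⟩
  have h : min c₁ (c₂ / a / 2) ≤ c₂ / a / 2 := min_le_right _ _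
  calc a * min c₁ (c₂ / a / 2) ≤ a * (c₂ / a / 2) := by gcongr
    _ = c₂ / 2 := by field_simp
    _ < c₂ := by linarith

set_option maxHeartbeats 1000000 in
/-- Opposite directions. -/
lemma neg_lam_mem [CompleteSpace X] {x : X} {M D : ℝ} (H : BlowSetup x M D) (n : ℕ)
    (hdim : dimH (Set.univ : Set X) = n) {γ : ℝ → X} (hγ : IsDir x D γ) :
    -Lam x M D γ ∈ closure (Kc x M D) := by
  have hD := H.hD
  have hM := H.hM
  set ℓ := dist x (γ 1) with hℓ
  rcases (dist_nonneg : 0 ≤ dist x (γ 1)).eq_or_lt with h0 | hℓ0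
  · have : Lam x M D γ = 0 := by rw [← norm_eq_zero, lam_norm H hγ, ← h0]
    rw [this, neg_zero]
    exact subset_closure ⟨γ, 0, hγ, le_rfl, by rw [zero_smul]⟩
  change 0 < ℓ at hℓ0
  have hℓD : ℓ < D / 8 := hγ.2.2
  let e : ℕ → ℝ := fun j => (1 / 5) * (1 / ((j : ℝ) + 1))
  have he0 : ∀ j, 0 < e j := fun j => by simp only [e]; positivity
  have he5 : ∀ j, e j ≤ 1 / 5 := fun j => by
    simp only [e]
    apply mul_le_of_le_one_right (by norm_num)
    rw [div_le_one (by positivity)]; linarith [j.cast_nonneg (α := ℝ)]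
  have he : Tendsto e atTop (𝓝 0) := by
    have := (tendsto_one_div_add_atTop_nhds_zero_nat (𝕜 := ℝ)).const_mul (1 / 5)
    rwa [mul_zero] at this
  have key : ∀ j, ∃ (t : ℝ) (y : X), 0 < t ∧ t ≤ e j ∧ dist x y ≤ 3 * ℓ * t ∧ ∀ p : TestPt x D,
      |(dist p.1 y ^ 2 - dist p.1 x ^ 2) + (dist p.1 (γ t) ^ 2 - dist p.1 x ^ 2)| ≤
        e j * t * (12 * D * ℓ + 8 * M * ℓ ^ 2) := by
    intro j
    obtain ⟨R, hR, r₀, hr₀, hg⟩ := H.good (e j) (he0 j)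
    obtain ⟨t, ht, hte, htr⟩ := exists_small (e j) r₀ (2 * ℓ) (he0 j) hr₀ (by positivity)
    set ε := e j with hε
    have hε0 : 0 < ε := he0 j
    have hε5 : ε ≤ 1 / 5 := he5 j
    have ht1 : t ≤ 1 := by linarith
    have hxz := hγ.dist_eq ht.le ht1
    set z := γ t with hz
    rw [← hℓ] at hxz
    have htℓ : 0 < t * ℓ := by positivity
    obtain ⟨σ, l, hσ, hl0, hl1, hσz, hσb, -, -⟩ := hg (2 * ℓ * t) (by positivity) htr z x
      (by linarith) (by rw [dist_self]; positivity) (by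
        rw [dist_comm, hxz]
        have : ε * (t * ℓ) ≤ 1 / 5 * (t * ℓ) := by gcongr
        nlinarith)
    set r := 2 * ℓ * t with hr
    have hr2 : r = 2 * (t * ℓ) := by rw [hr]; ring
    have hεr : ε * r ≤ t * ℓ / 2 := by
      have : ε * r ≤ 1 / 5 * r := by gcongr
      linarith
    have d1 : dist (σ 0) (σ l) = l * dist (σ 0) (σ 1) := by
      have := hσ 0 ⟨le_rfl, zero_le_one⟩ l ⟨hl0.le, by linarith⟩
      rwa [zero_sub, abs_neg, abs_of_pos hl0] at this
    have d2 : dist (σ l) (σ (2 * l)) = l * dist (σ 0) (σ 1) := by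
      have := hσ l ⟨hl0.le, by linarith⟩ (2 * l) ⟨by linarith, by linarith⟩
      rwa [show l - 2 * l = -l by ring, abs_neg, abs_of_pos hl0] at this
    have d3 : dist (σ 0) (σ l) ≤ 2 * (t * ℓ) := by
      have := dist_triangle4 (σ 0) z x (σ l)
      rw [dist_comm z x, hxz, dist_comm x (σ l)] at this
      linarith
    have hgeo2 : IsConstSpeedGeodesic (fun w => σ (2 * l * w)) := hσ.scale (by linarith) (by linarith)
    have d4 : dist (σ 0) (σ (2 * l)) ≤ 4 * (t * ℓ) := by
      have := dist_triangle (σ 0) (σ l) (σ (2 * l)); linarith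
    have hxy : dist x (σ (2 * l)) ≤ 3 * (t * ℓ) := by
      have := dist_triangle x (σ l) (σ (2 * l))
      rw [dist_comm x (σ l)] at this
      linarith
    have htD : t * ℓ ≤ D / 8 := by
      have : t * ℓ ≤ 1 * ℓ := by gcongr
      linarith
    have hx0 : dist x (σ 0) ≤ 3 / 2 * (t * ℓ) := by
      have := dist_triangle x z (σ 0)
      rw [dist_comm z (σ 0)] at this
      linarith
    refine ⟨t, σ (2 * l), ht, hte, by linarith, fun p => ?_⟩
    have hpx := p.2.2
    have hcc := H.c11 p.1 _ hgeo2 (by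
      intro w hw
      have q1 := dist_triangle4 p.1 x (σ 0) (σ (2 * l * w))
      have q2 : dist (σ 0) (σ (2 * l * w)) ≤ dist (σ 0) (σ (2 * l)) := by
        have := hgeo2 0 ⟨le_rfl, zero_le_one⟩ w hw
        simp only [mul_zero, mul_one] at this
        rw [this, zero_sub, abs_neg, abs_of_nonneg hw.1]
        exact mul_le_of_le_one_left dist_nonneg hw.2
      linarith) (1 / 2) ⟨by norm_num, by norm_num⟩
    simp only [mul_zero, mul_one] at hcc
    rw [show 2 * l * (1 / 2) = l by ring] at hcc
    have s1 := sq_diff_le p.1 (σ l) x D 0 (by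
      have := dist_triangle p.1 x (σ l); rw [dist_comm x (σ l)] at this; linarith) (by linarith)
    have s2 := sq_diff_le p.1 (σ 0) z D 0 (by
      have := dist_triangle p.1 x (σ 0); linarith) (by
      have := dist_triangle p.1 x z; linarith)
    have s1' : |dist p.1 (σ l) ^ 2 - dist p.1 x ^ 2| ≤ ε * r * (2 * D) := by
      refine s1.trans ?_
      rw [mul_zero, add_zero]; gcongr
    have s2' : |dist p.1 (σ 0) ^ 2 - dist p.1 z ^ 2| ≤ ε * r * (2 * D) := by
      refine s2.trans ?_
      rw [mul_zero, add_zero]; gcongr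
    have s3 : M * (1 / 2) * (1 - 1 / 2) * dist (σ 0) (σ (2 * l)) ^ 2 ≤ 4 * M * (t * ℓ) ^ 2 := by
      calc _ ≤ M * (1 / 2) * (1 - 1 / 2) * (4 * (t * ℓ)) ^ 2 := by gcongr
        _ = _ := by ring
    have hcc' := hcc.trans s3
    have s4 : M * t * t * ℓ ^ 2 ≤ M * ε * t * ℓ ^ 2 := by gcongr
    have s5 : ε * t * (12 * D * ℓ + 8 * M * ℓ ^ 2) = 6 * D * (ε * r) + 8 * (M * ε * t * ℓ ^ 2) := by
      rw [hr]; ring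
    have s6 : 4 * M * (t * ℓ) ^ 2 = 4 * (M * t * t * ℓ ^ 2) := by ring
    rw [abs_le] at hcc' s1' s2' ⊢
    obtain ⟨u1, u2⟩ := hcc'
    obtain ⟨u3, u4⟩ := s1'
    obtain ⟨u5, u6⟩ := s2'
    rw [s5]
    rw [s6] at u1 u2
    constructor <;> linarith
  choose t y ht0 hte hy hp using key
  have ht : Tendsto t atTop (𝓝 0) :=
    squeeze_zero (fun j => (ht0 j).le) hte he
  refine closure_mono (Kb_subset_Kc x M D (3 * ℓ)) ?_
  refine mem_closure_of_approx H n hdim (by positivity) _ t ht0 ht y hy ?_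
  intro p
  have l1 := (dir_tendsto H hγ zero_le_one t ht0 (fun j => by linarith [hte j, he5 j]) ht p).neg
  have e0 : -(2 * dist p.1 x * ((1:ℝ) • Lam x M D γ) p) = 2 * dist p.1 x * (-Lam x M D γ) p := by
    rw [one_smul, lp.coeFn_neg, Pi.neg_apply]; ring
  rw [e0] at l1
  have h2 : Tendsto (fun j => e j * (12 * D * ℓ + 8 * M * ℓ ^ 2)) atTop (𝓝 0) := by
    simpa using he.mul_const (12 * D * ℓ + 8 * M * ℓ ^ 2)
  refine l1.congr_dist ?_
  refine squeeze_zero (fun _ => dist_nonneg) (fun j => ?_) h2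
  have h5 := ht0 j
  rw [dist_comm, Real.dist_eq, one_mul]
  have e1 : (dist p.1 (y j) ^ 2 - dist p.1 x ^ 2) / t j -
      -((dist p.1 (γ (t j)) ^ 2 - dist p.1 x ^ 2) / t j) =
      ((dist p.1 (y j) ^ 2 - dist p.1 x ^ 2) + (dist p.1 (γ (t j)) ^ 2 - dist p.1 x ^ 2)) / t j := by
    field_simp; ring
  rw [e1, abs_div, abs_of_pos h5, div_le_iff₀ h5]
  refine (hp j p).trans (le_of_eq ?_)
  ring

lemma Kc_smul {x : X} {M D : ℝ} {c : ℝ} (hc : 0 ≤ c) {v : Amb x D} (hv : v ∈ Kc x M D) :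
    c • v ∈ Kc x M D := by
  obtain ⟨γ, s, h, hs, rfl⟩ := hv
  exact ⟨γ, c * s, h, by positivity, by rw [smul_smul]⟩

lemma closure_Kc_smul {x : X} {M D : ℝ} {c : ℝ} (hc : 0 ≤ c) {v : Amb x D}
    (hv : v ∈ closure (Kc x M D)) : c • v ∈ closure (Kc x M D) :=
  map_mem_closure (continuous_const_smul c) hv fun _ hw => Kc_smul hc hw

lemma closure_Kc_add [CompleteSpace X] {x : X} {M D : ℝ} (H : BlowSetup x M D) (n : ℕ)
    (hdim : dimH (Set.univ : Set X) = n) {u v : Amb x D} (hu : u ∈ closure (Kc x M D))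
    (hv : v ∈ closure (Kc x M D)) : u + v ∈ closure (Kc x M D) := by
  have h1 : ∀ a ∈ Kc x M D, ∀ b ∈ Kc x M D, a + b ∈ closure (Kc x M D) := by
    intro a ha b hb
    have := closure_Kc_smul (c := 2) (by norm_num) (half_add_mem H n hdim ha hb)
    rw [smul_smul] at this
    norm_num at this
    exact this
  have := map_mem_closure₂ (continuous_add (M := Amb x D)) hu hv h1
  rwa [closure_closure] at this

lemma closure_Kc_neg [CompleteSpace X] {x : X} {M D : ℝ} (H : BlowSetup x M D) (n : ℕ)
    (hdim : dimH (Set.univ : Set X) = n) {u : Amb x D} (hu : u ∈ closure (Kc x M D)) :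
    -u ∈ closure (Kc x M D) := by
  have h1 : ∀ a ∈ Kc x M D, -a ∈ closure (Kc x M D) := by
    rintro _ ⟨γ, s, h, hs, rfl⟩
    rw [← smul_neg]
    exact closure_Kc_smul hs (neg_lam_mem H n hdim h)
  have := map_mem_closure (continuous_neg (G := Amb x D)) hu h1
  rwa [closure_closure] at this

/-- The tangent space. -/
def tanSp [CompleteSpace X] {x : X} {M D : ℝ} (H : BlowSetup x M D) (n : ℕ)
    (hdim : dimH (Set.univ : Set X) = n) : Submodule ℝ (Amb x D) where
  carrier := closure (Kc x M D)
  add_mem' := closure_Kc_add H n hdim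
  zero_mem' := subset_closure ⟨fun _ => x, 0, isDir_const H, le_rfl, by rw [zero_smul]⟩
  smul_mem' := by
    intro c v hv
    rcases le_total 0 c with hc | hc
    · exact closure_Kc_smul hc hv
    · have := closure_Kc_smul (neg_nonneg.2 hc) (closure_Kc_neg H n hdim hv)
      rwa [smul_neg, neg_smul, neg_neg] at this

lemma mem_Kb_of_norm {x : X} {M D : ℝ} (H : BlowSetup x M D) {v : Amb x D} {B : ℝ}
    (hv : v ∈ Kc x M D) (hB : ‖v‖ ≤ B) : v ∈ Kb x M D B := by
  obtain ⟨γ, s, h, hs, rfl⟩ := hv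
  refine ⟨γ, s, h, hs, ?_, rfl⟩
  rwa [norm_smul, Real.norm_of_nonneg hs, lam_norm H h] at hB

lemma tanSp_finite [CompleteSpace X] {x : X} {M D : ℝ} (H : BlowSetup x M D) (n : ℕ)
    (hdim : dimH (Set.univ : Set X) = n) : FiniteDimensional ℝ (tanSp H n hdim) := by
  have hcomp : IsCompact (Metric.closedBall (0 : tanSp H n hdim) 1) := by
    have hcl : IsClosed (tanSp H n hdim : Set (Amb x D)) := isClosed_closure
    have hemb : IsClosedEmbedding (Subtype.val : tanSp H n hdim → Amb x D) :=
      hcl.isClosedEmbedding_subtypeVal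
    have h2 : Metric.closedBall (0 : tanSp H n hdim) 1 ⊆
        Subtype.val ⁻¹' closure (Kb x M D 2) := by
      intro v hv
      rw [mem_closedBall_zero_iff] at hv
      have hv1 : ‖(v : Amb x D)‖ ≤ 1 := hv
      rw [mem_preimage, Metric.mem_closure_iff]
      intro ε hε
      obtain ⟨k, hk, hkv⟩ := Metric.mem_closure_iff.1 (show (v : Amb x D) ∈ closure (Kc x M D) from v.2)
        (min ε 1) (lt_min hε one_pos)
      refine ⟨k, mem_Kb_of_norm H hk ?_, hkv.trans_le (min_le_left _ _)⟩
      have h3 := hkv.trans_le (min_le_right _ _)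
      rw [dist_eq_norm] at h3
      have := norm_le_norm_add_norm_sub (v : Amb x D) k
      linarith
    exact (hemb.isCompact_preimage (Kb_compact H n hdim (by norm_num))).of_isClosed_subset
      isClosed_closedBall h2
  exact FiniteDimensional.of_isCompact_closedBall ℝ one_pos hcomp

open Classical in
/-- A chosen short geodesic from `x`. -/
def chDir (x : X) (D : ℝ) (z : X) : ℝ → X :=
  if h : ∃ γ, IsDir x D γ ∧ γ 1 = z then h.choose else fun _ => x

lemma chDir_spec {x : X} {M D : ℝ} (H : BlowSetup x M D) {z : X} (hz : dist x z < D / 8) :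
    IsDir x D (chDir x D z) ∧ chDir x D z 1 = z := by
  have := exists_dir H hz
  rw [chDir, dif_pos this]
  exact this.choose_spec

lemma chDir_isDir {x : X} {M D : ℝ} (H : BlowSetup x M D) (z : X) : IsDir x D (chDir x D z) := by
  rw [chDir]
  split_ifs with h
  · exact h.choose_spec.1
  · exact isDir_const H

lemma blow_up_tanSp [CompleteSpace X] {x : X} {M D : ℝ} (H : BlowSetup x M D) (n : ℕ)
    (hdim : dimH (Set.univ : Set X) = n) {ε : ℝ} (hε : 0 < ε) :
    ∃ r₀ > 0, ∀ r, 0 < r → r < r₀ → ∃ F : X → tanSp H n hdim,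
      IsEpsIsometry (fun a b => dist a b / r) x (fun u v => ‖u - v‖) 0 ε F := by
  have hD := H.hD
  obtain ⟨r₁, hr₁, hu⟩ := lam_uniform H n hdim (ε := ε ^ 2 / 2) (by positivity)
  obtain ⟨T, hTK, hTf, hT⟩ := Metric.finite_approx_of_totallyBounded
    (Kb_totallyBounded H n hdim (B := 1 / ε + 1) (by positivity)) (ε / 8) (by positivity)
  have hT' : ∀ v : T, ∃ (γ : ℝ → X) (s : ℝ), IsDir x D γ ∧ 0 ≤ s ∧ s * dist x (γ 1) ≤ 1 / ε + 1 ∧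
    v.1 = s • Lam x M D γ := fun v => hTK v.2
  choose g s hg hs hsB hv using hT'
  have hfin : Finite T := hTf
  have hev2 : ∀ v : T, ∀ᶠ t in 𝓝[>] (0:ℝ), s v * t ≤ 1 := by
    intro v
    have : ∀ᶠ t in 𝓝[>] (0:ℝ), t < 1 / (s v + 1) := mem_nhdsWithin_of_mem_nhds
      (Iio_mem_nhds (by have := hs v; positivity))
    filter_upwards [this, self_mem_nhdsWithin] with t h1 h2
    have h3 := hs v
    rw [lt_div_iff₀ (by positivity)] at h1
    have : 0 < t := h2
    linarith
  obtain ⟨r₂, hr₂, hr2⟩ := mem_nhdsGT_iff_exists_Ioo_subset.1 (eventually_all.2 hev2)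
  refine ⟨min (ε * r₁) (min (ε * (D / 8)) r₂), ?_, fun r hr hrr => ?_⟩
  · have : 0 < r₂ := hr₂
    positivity
  obtain ⟨hra, hrr'⟩ := lt_min_iff.1 hrr
  obtain ⟨hrb, hrc⟩ := lt_min_iff.1 hrr'
  have hs1 := hr2 ⟨hr, hrc⟩
  have hρ1 : r / ε < r₁ := by rw [div_lt_iff₀ hε]; linarith
  have hρ2 : r / ε < D / 8 := by rw [div_lt_iff₀ hε]; linarith
  have hρ0 : 0 < r / ε := by positivity
  have herr : ε ^ 2 / 2 * (r / ε) = ε / 2 * r := by field_simp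
  have hmem : ∀ z, r⁻¹ • Lam x M D (chDir x D z) ∈ tanSp H n hdim := fun z =>
    subset_closure ⟨_, r⁻¹, chDir_isDir H z, by positivity, rfl⟩
  have hball : ∀ z, dist x z / r < 1 / ε → dist x z < r / ε := by
    intro z hz
    rw [div_lt_iff₀ hr] at hz
    calc _ < _ := hz
      _ = _ := by ring
  refine ⟨fun z => ⟨r⁻¹ • Lam x M D (chDir x D z), hmem z⟩, ?_, ?_, ?_⟩
  · obtain ⟨h1, h2⟩ := chDir_spec H (z := x) (by rw [dist_self]; positivity)
    have h3 := lam_norm H h1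
    rw [h2, dist_self, norm_eq_zero] at h3
    apply Subtype.ext
    simp [h3]
  · intro z z' hz hz'
    have hz1 := hball z hz
    have hz1' := hball z' hz'
    obtain ⟨a1, a2⟩ := chDir_spec H (hz1.trans hρ2)
    obtain ⟨b1, b2⟩ := chDir_spec H (hz1'.trans hρ2)
    have up := hu (r / ε) hρ0 hρ1 _ _ a1 b1 (by rw [a2]; exact hz1.le) (by rw [b2]; exact hz1'.le)
    have lo := lam_lower H a1 b1
    rw [a2, b2] at up lo
    rw [herr] at up
    have e : ‖(⟨r⁻¹ • Lam x M D (chDir x D z), hmem z⟩ : tanSp H n hdim) -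
        ⟨r⁻¹ • Lam x M D (chDir x D z'), hmem z'⟩‖ =
        ‖Lam x M D (chDir x D z) - Lam x M D (chDir x D z')‖ / r := by
      rw [Submodule.coe_norm, Submodule.coe_sub]
      simp only
      rw [← smul_sub, norm_smul, norm_inv, Real.norm_of_nonneg hr.le, inv_mul_eq_div]
    beta_reduce
    rw [e, ← sub_div, abs_div, abs_of_pos hr, div_lt_iff₀ hr, abs_lt]
    have : 0 < ε * r := by positivity
    constructor <;> linarith
  · intro R hR w hw
    have hw' : ‖(w : Amb x D)‖ < R - ε := by
      have : ‖w‖ < R - ε := by simpa using hw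
      exact this
    obtain ⟨k, hk, hkw⟩ := Metric.mem_closure_iff.1 (show (w : Amb x D) ∈ closure (Kc x M D) from w.2)
        (min (ε / 8) 1) (by positivity)
    have hk1 := hkw.trans_le (min_le_left _ _)
    have hk2 := hkw.trans_le (min_le_right _ _)
    have hkB : k ∈ Kb x M D (1 / ε + 1) := by
      apply mem_Kb_of_norm H hk
      rw [dist_eq_norm] at hk2
      have := norm_le_norm_add_norm_sub (w : Amb x D) k
      linarith
    obtain ⟨v, hvT, hvb⟩ := mem_iUnion₂.1 (hT hkB)
    rw [mem_ball] at hvb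
    have hwv : dist (w : Amb x D) v < ε / 4 := by
      have := dist_triangle (w : Amb x D) k v; linarith
    set V : T := ⟨v, hvT⟩ with hV
    have hsv := hs V
    have hsr := hs1 V
    set z := g V (s V * r) with hz
    have hvn : ‖v‖ = s V * dist x (g V 1) := by
      have : v = s V • Lam x M D (g V) := hv V
      rw [this, norm_smul, Real.norm_of_nonneg hsv, lam_norm H (hg V)]
    have hxz : dist x z = r * ‖v‖ := by
      rw [hz, (hg V).dist_eq (by positivity) hsr, hvn]; ring
    have hvR : ‖v‖ < R := by
      have := norm_le_norm_add_norm_sub (w : Amb x D) v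
      rw [dist_eq_norm] at hwv
      linarith
    have hzR : dist x z / r < R := by rw [hxz, mul_div_cancel_left₀ _ hr.ne']; exact hvR
    refine ⟨z, hzR, ?_⟩
    have hz1 := hball z (hzR.trans hR)
    obtain ⟨a1, a2⟩ := chDir_spec H (hz1.trans hρ2)
    have hc0 : 0 ≤ s V * r := by positivity
    have up := hu (r / ε) hρ0 hρ1 _ _ a1 ((hg V).scale hc0 hsr) (by rw [a2]; exact hz1.le)
      (by rw [mul_one]; exact hz1.le)
    rw [a2, mul_one, ← hz, dist_self, zero_add, herr, lam_scale H (hg V) hc0 hsr] at up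
    have e1 : (s V * r) • Lam x M D (g V) = r • v := by
      have : v = s V • Lam x M D (g V) := hv V
      rw [this, smul_smul, mul_comm]
    rw [e1] at up
    have e2 : Lam x M D (chDir x D z) - r • v = r • (r⁻¹ • Lam x M D (chDir x D z) - v) := by
      rw [smul_sub, smul_smul, mul_inv_cancel₀ hr.ne', one_smul]
    rw [e2, norm_smul, Real.norm_of_nonneg hr.le, mul_comm] at up
    have up2 := le_of_mul_le_mul_right up hr
    change ‖(w : Amb x D) - r⁻¹ • Lam x M D (chDir x D z)‖ ≤ ε
    have := norm_sub_le_norm_sub_add_norm_sub (w : Amb x D) v (r⁻¹ • Lam x M D (chDir x D z))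
    rw [norm_sub_rev v, ← dist_eq_norm (w : Amb x D) v] at this
    linarith

lemma transport_fin {W : Type*} [NormedAddCommGroup W] [NormedSpace ℝ W] [FiniteDimensional ℝ W]
    (x : X) (h : ∀ ε : ℝ, 0 < ε → ∃ r₀ > 0, ∀ r, 0 < r → r < r₀ → ∃ F : X → W,
      IsEpsIsometry (fun a b => dist a b / r) x (fun u v => ‖u - v‖) 0 ε F) :
    ∃ (k : ℕ) (N : (Fin k → ℝ) → ℝ), IsNormFn N ∧
        ∀ ε : ℝ, 0 < ε → ∃ r₀ > 0, ∀ r : ℝ, 0 < r → r < r₀ →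
          ∃ F : X → Fin k → ℝ,
            IsEpsIsometry (fun a b => dist a b / r) x
              (fun u v => N (u - v)) (0 : Fin k → ℝ) ε F := by
  let φ := (Module.finBasis ℝ W).equivFun
  refine ⟨_, fun u => ‖φ.symm u‖, ⟨fun _ => norm_nonneg _, fun u => ?_, fun a u => ?_, fun u v => ?_⟩, ?_⟩
  · rw [norm_eq_zero]; exact φ.symm.map_eq_zero_iff
  · beta_reduce; rw [φ.symm.map_smul, norm_smul, Real.norm_eq_abs]
  · beta_reduce; rw [φ.symm.map_add]; exact norm_add_le _ _
  intro ε hε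
  obtain ⟨r₀, hr₀, h⟩ := h ε hε
  refine ⟨r₀, hr₀, fun r hr hrr => ?_⟩
  obtain ⟨F, h1, h2, h3⟩ := h r hr hrr
  refine ⟨fun z => φ (F z), by beta_reduce; rw [h1, map_zero], ?_, ?_⟩
  · intro z z' hz hz'
    have := h2 z z' hz hz'
    beta_reduce
    rwa [map_sub, φ.symm_apply_apply, φ.symm_apply_apply]
  · intro R hR w hw
    beta_reduce at hw
    rw [map_sub, map_zero] at hw
    obtain ⟨z, hz, hz2⟩ := h3 R hR (φ.symm w) hw
    refine ⟨z, hz, ?_⟩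
    beta_reduce
    rwa [map_sub, φ.symm_apply_apply]

/-- Blow-ups at a good point converge to a finite-dimensional normed space. -/
lemma blow_up_exists [CompleteSpace X] {x : X} {M D : ℝ} (H : BlowSetup x M D) (n : ℕ)
    (hdim : dimH (Set.univ : Set X) = n) :
    ∃ (k : ℕ) (N : (Fin k → ℝ) → ℝ), IsNormFn N ∧
        ∀ ε : ℝ, 0 < ε → ∃ r₀ > 0, ∀ r : ℝ, 0 < r → r < r₀ →
          ∃ F : X → Fin k → ℝ,
            IsEpsIsometry (fun a b => dist a b / r) x
              (fun u v => N (u - v)) (0 : Fin k → ℝ) ε F := by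
  have hfd := tanSp_finite H n hdim
  exact transport_fin x fun ε hε => blow_up_tanSp H n hdim hε

lemma exp_le_of_growth {p q : ℕ} {c C : ℝ} (hc : 0 < c)
    (h : ∀ m : ℕ, 1 ≤ m → c * (m:ℝ) ^ p ≤ C * (m:ℝ) ^ q) : p ≤ q := by
  by_contra! hlt
  obtain ⟨m, hm⟩ := exists_nat_gt (max 1 (C / c))
  have hm1 : (1:ℝ) < m := (le_max_left _ _).trans_lt hm
  have hm2 : C / c < m := (le_max_right _ _).trans_lt hm
  have h1 := h m (by exact_mod_cast hm1.le)
  have h2 : (m:ℝ) ^ (q + 1) ≤ (m:ℝ) ^ p := pow_le_pow_right₀ hm1.le hlt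
  have h3 : c * (m:ℝ) ^ (q + 1) ≤ C * (m:ℝ) ^ q := le_trans (by gcongr) h1
  rw [pow_succ, ← mul_assoc, mul_right_comm] at h3
  have h4 := le_of_mul_le_mul_right h3 (by positivity)
  rw [div_lt_iff₀ hc] at hm2
  linarith

lemma norm_compare {k : ℕ} {N : (Fin k → ℝ) → ℝ} (hN : IsNormFn N) :
    ∃ a b : ℝ, 0 < a ∧ a ≤ 1 ∧ 1 ≤ b ∧ (∀ u, a * ‖u‖ ≤ N u) ∧ ∀ u, N u ≤ b * ‖u‖ := by
  obtain ⟨h0, h1, h2, h3⟩ := hN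
  have hz : N 0 = 0 := (h1 0).2 rfl
  have hsum : ∀ (s : Finset (Fin k)) (f : Fin k → Fin k → ℝ), N (∑ i ∈ s, f i) ≤ ∑ i ∈ s, N (f i) := by
    intro s f
    exact Finset.le_sum_of_subadditive N hz.le h3 s f
  set b := 1 + ∑ i : Fin k, N (Pi.single i 1) with hb
  have hb1 : 1 ≤ b := by
    rw [hb]; linarith [Finset.sum_nonneg (s := Finset.univ) fun (i : Fin k) _ => h0 (Pi.single i 1)]
  have hup : ∀ u, N u ≤ b * ‖u‖ := by
    intro u
    have e : u = ∑ i, u i • (Pi.single i (1:ℝ) : Fin k → ℝ) := by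
      ext j
      simp [Finset.sum_apply, Pi.single_apply]
    calc N u = N (∑ i, u i • (Pi.single i (1:ℝ) : Fin k → ℝ)) := by rw [← e]
      _ ≤ ∑ i, N (u i • (Pi.single i (1:ℝ) : Fin k → ℝ)) := hsum _ _
      _ = ∑ i, |u i| * N (Pi.single i 1) := by simp_rw [h2]
      _ ≤ ∑ i, ‖u‖ * N (Pi.single i 1) := by
        apply Finset.sum_le_sum
        intro i _
        have := h0 (Pi.single i 1)
        gcongr
        exact norm_le_pi_norm u i
      _ = ‖u‖ * ∑ i, N (Pi.single i 1) := by rw [Finset.mul_sum]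
      _ ≤ _ := by rw [hb]; nlinarith [norm_nonneg u]
  have hneg : ∀ u, N (-u) = N u := fun u => by
    have := h2 (-1) u
    rwa [neg_one_smul, abs_neg, abs_one, one_mul] at this
  have hcont : Continuous N := by
    refine (LipschitzWith.of_dist_le_mul (K := ⟨b, by linarith⟩) fun u v => ?_).continuous
    rw [Real.dist_eq, dist_eq_norm]
    change |N u - N v| ≤ b * ‖u - v‖
    have a1 := h3 (u - v) v
    have a2 := h3 (v - u) u
    rw [sub_add_cancel] at a1 a2
    have a3 : N (v - u) = N (u - v) := by rw [← hneg, neg_sub]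
    have := hup (u - v)
    rw [abs_le]
    constructor <;> linarith
  obtain ⟨a, ha0, ha⟩ : ∃ a : ℝ, 0 < a ∧ ∀ u ∈ sphere (0 : Fin k → ℝ) 1, a ≤ N u := by
    rcases (sphere (0 : Fin k → ℝ) 1).eq_empty_or_nonempty with he | hne
    · exact ⟨1, one_pos, by simp [he]⟩
    · obtain ⟨u, hu, hmin⟩ := (isCompact_sphere (0 : Fin k → ℝ) 1).exists_isMinOn hne hcont.continuousOn
      refine ⟨N u, ?_, fun v hv => hmin hv⟩
      refine lt_of_le_of_ne (h0 u) fun h => ?_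
      have : u = 0 := (h1 u).1 h.symm
      rw [this, mem_sphere_zero_iff_norm, norm_zero] at hu
      exact zero_ne_one hu
  refine ⟨min a 1, b, lt_min ha0 one_pos, min_le_right _ _, hb1, fun u => ?_, hup⟩
  rcases eq_or_ne u 0 with rfl | hu
  · rw [norm_zero, mul_zero]; exact h0 _
  have hn : 0 < ‖u‖ := norm_pos_iff.2 hu
  have h5 := ha (‖u‖⁻¹ • u) (by
    rw [mem_sphere_zero_iff_norm, norm_smul, norm_inv, norm_norm, inv_mul_cancel₀ hn.ne'])
  rw [h2, abs_of_pos (inv_pos.2 hn), inv_mul_eq_div, le_div_iff₀ hn] at h5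
  refine le_trans ?_ h5
  gcongr
  exact min_le_left _ _

/-- The blow-up hypothesis at `x`. -/
def BlowsUpTo (x : X) {k : ℕ} (N : (Fin k → ℝ) → ℝ) : Prop :=
  ∀ ε : ℝ, 0 < ε → ∃ r₀ > 0, ∀ r : ℝ, 0 < r → r < r₀ →
          ∃ F : X → Fin k → ℝ,
            IsEpsIsometry (fun a b => dist a b / r) x
              (fun u v => N (u - v)) (0 : Fin k → ℝ) ε F

lemma dim_le [CompleteSpace X] (hgeo : IsGeodesicSpace X) (hbus : BusemannConcave X)
    (n : ℕ) (hdim : dimH (Set.univ : Set X) = n) (x : X) {k : ℕ} {N : (Fin k → ℝ) → ℝ}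
    (hN : IsNormFn N) (hx : BlowsUpTo x N) : k ≤ n := by
  classical
  obtain ⟨a, b, ha0, ha1, hb1, hlo, hup⟩ := norm_compare hN
  obtain ⟨n0, n1, n2, n3⟩ := hN
  have hneg : ∀ u, N (-u) = N u := fun u => by
    have := n2 (-1) u
    rwa [neg_one_smul, abs_neg, abs_one, one_mul] at this
  apply exp_le_of_growth (c := 1) (C := (64 * (b + 2) / a) ^ n) one_pos
  intro m hm
  have hm0 : (0:ℝ) < m := by exact_mod_cast hm
  have hm1 : (1:ℝ) ≤ m := by exact_mod_cast hm
  set ε := min (a / (4 * m)) (1 / (b + 3)) with hε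
  have hε0 : 0 < ε := by rw [hε]; positivity
  have hεa : ε ≤ a / (4 * m) := min_le_left _ _
  have hεb : ε ≤ 1 / (b + 3) := min_le_right _ _
  have hε1 : ε < 1 := by
    refine hεb.trans_lt ?_
    rw [div_lt_one (by positivity)]; linarith
  have hεinv : b + 3 ≤ 1 / ε := by
    rw [le_div_iff₀ hε0]
    rw [le_div_iff₀ (by positivity)] at hεb
    linarith
  obtain ⟨r₀, hr₀, h⟩ := hx ε hε0
  obtain ⟨F, -, hF2, hF3⟩ := h (r₀ / 2) (by positivity) (by linarith)
  set r := r₀ / 2 with hr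
  have hr0 : 0 < r := by positivity
  let u : (Fin k → Fin m) → Fin k → ℝ := fun f i => (f i : ℕ) / (m : ℝ)
  have hu1 : ∀ f, ‖u f‖ ≤ 1 := by
    intro f
    rw [pi_norm_le_iff_of_nonneg zero_le_one]
    intro i
    simp only [u]
    rw [Real.norm_of_nonneg (by positivity), div_le_one hm0]
    exact_mod_cast (f i).2.le
  have husep : ∀ f g, f ≠ g → 1 / (m:ℝ) ≤ ‖u f - u g‖ := by
    intro f g hfg
    obtain ⟨i, hi⟩ := Function.ne_iff.1 hfg
    refine le_trans ?_ (norm_le_pi_norm (u f - u g) i)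
    simp only [u, Pi.sub_apply]
    rw [← sub_div, norm_div, Real.norm_of_nonneg hm0.le]
    gcongr
    have hne : ((f i : ℕ) : ℤ) - ((g i : ℕ) : ℤ) ≠ 0 := by
      intro h0
      apply hi
      apply Fin.ext
      omega
    have := Int.one_le_abs hne
    rw [Real.norm_eq_abs]
    exact_mod_cast this
  have hz : ∀ f, ∃ z : X, dist x z / r < b + 2 ∧ N (u f - F z) ≤ ε := by
    intro f
    apply hF3 (b + 2) (by linarith) (u f)
    beta_reduce
    rw [zero_sub, hneg]
    have := hup (u f)
    have := hu1 f
    nlinarith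
  choose z hz1 hz2 using hz
  have hsep : ∀ f g, f ≠ g → r * (a / (4 * m)) ≤ dist (z f) (z g) := by
    intro f g hfg
    have h1 := hF2 (z f) (z g) (by have := hz1 f; linarith) (by have := hz1 g; linarith)
    beta_reduce at h1
    have h2 := (abs_lt.1 h1).1
    have h3 : N (u f - u g) ≤ N (u f - F (z f)) + N (F (z f) - F (z g)) + N (u g - F (z g)) := by
      have e : u f - u g = (u f - F (z f)) + (F (z f) - F (z g)) + -(u g - F (z g)) := by abel
      rw [e]
      refine (n3 _ _).trans ?_
      rw [hneg]
      gcongr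
      exact n3 _ _
    have h4 := hlo (u f - u g)
    have h5 : a * (1 / m) ≤ a * ‖u f - u g‖ := by gcongr; exact husep f g hfg
    have h6 : a * (1 / m) = 4 * (a / (4 * m)) := by field_simp
    have h7 : a / (4 * m) ≤ dist (z f) (z g) / r := by
      linarith [hz2 f, hz2 g]
    rw [le_div_iff₀ hr0] at h7
    linarith
  have hinj : Function.Injective z := by
    intro f g hfg
    by_contra hne
    have := hsep f g hne
    rw [hfg, dist_self] at this
    have : 0 < r * (a / (4 * m)) := by positivity
    linarith
  have hp := packing_bound hgeo hbus n hdim x (r * (b + 2)) (r * (a / (4 * m))) (by positivity) (by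
      have : a / (4 * m) ≤ 1 := by rw [div_le_one (by positivity)]; linarith
      nlinarith) (Finset.univ.image z) (by
      intro q hq
      obtain ⟨f, -, rfl⟩ := Finset.mem_image.1 hq
      have := hz1 f
      rw [div_lt_iff₀ hr0] at this
      linarith) (by
      intro p hp q hq hpq
      obtain ⟨f, -, rfl⟩ := Finset.mem_image.1 hp
      obtain ⟨g, -, rfl⟩ := Finset.mem_image.1 hq
      exact hsep f g fun h => hpq (by rw [h]))
  rw [Finset.card_image_of_injective _ hinj, Finset.card_univ, Fintype.card_fun, Fintype.card_fin,
    Fintype.card_fin] at hp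
  push_cast at hp
  rw [one_mul, ← mul_pow]
  convert hp using 2
  field_simp
  norm_num

lemma le_dim [MeasurableSpace X] [BorelSpace X]
    (n : ℕ) (hF : MeasFacts X n) (x : X) {k : ℕ} {N : (Fin k → ℝ) → ℝ}
    (hN : IsNormFn N) (hx : BlowsUpTo x N) : n ≤ k := by
  classical
  obtain ⟨a, b, ha0, ha1, hb1, hlo, hup⟩ := norm_compare hN
  obtain ⟨n0, n1, n2, n3⟩ := hN
  have hneg : ∀ u, N (-u) = N u := fun u => by
    have := n2 (-1) u
    rwa [neg_one_smul, abs_neg, abs_one, one_mul] at this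
  set μ := (μH[(n : ℝ)] : Measure X) with hμ
  apply exp_le_of_growth (c := μ.real (ball x 1)) (C := (4 / a + 3) ^ k * (96 * b) ^ n)
    (hF.pos x 1 one_pos)
  intro m hm
  have hm0 : (0:ℝ) < m := by exact_mod_cast hm
  have hm1 : (1:ℝ) ≤ m := by exact_mod_cast hm
  set ε := min (b / m) (1 / 2) with hε
  have hε0 : 0 < ε := by rw [hε]; positivity
  have hεa : ε ≤ b / m := min_le_left _ _
  have hεb : ε ≤ 1 / 2 := min_le_right _ _
  have hεinv : 2 ≤ 1 / ε := by
    rw [le_div_iff₀ hε0]; linarith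
  obtain ⟨r₀, hr₀, h⟩ := hx ε hε0
  set r := min (r₀ / 2) 1 with hr
  have hr0 : 0 < r := by rw [hr]; positivity
  have hr1 : r ≤ 1 := min_le_right _ _
  obtain ⟨F, hF1, hF2, -⟩ := h r hr0 (by
    have : r ≤ r₀ / 2 := min_le_left _ _
    linarith)
  let c : X → Fin k → ℤ := fun z i => ⌊m * F z i⌋
  set A : ℤ := ⌈2 * m / a⌉ with hA
  let I : Finset (Fin k → ℤ) := Fintype.piFinset fun _ => Finset.Icc (-A) A
  have hdr : ∀ z, z ∈ ball x r → dist x z / r < 1 := by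
    intro z hz
    rw [div_lt_one hr0]; rwa [mem_ball'] at hz
  have hcI : ∀ z ∈ ball x r, c z ∈ I := by
    intro z hz
    have hz1 := hdr z hz
    have h1 := hF2 x z (by beta_reduce; rw [dist_self, zero_div]; positivity) (by beta_reduce; linarith)
    beta_reduce at h1
    rw [hF1, zero_sub, hneg] at h1
    have h2 := (abs_lt.1 h1).1
    have h3 : a * ‖F z‖ ≤ 2 := by linarith [hlo (F z)]
    have h4 : ‖F z‖ ≤ 2 / a := by rw [le_div_iff₀ ha0]; linarith
    rw [Fintype.mem_piFinset]
    intro i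
    have h5 := (norm_le_pi_norm (F z) i).trans h4
    rw [Real.norm_eq_abs, abs_le] at h5
    have hAA : 2 * m / a ≤ A := Int.le_ceil _
    have h6 : m * F z i ≤ m * (2 / a) := by gcongr; exact h5.2
    have h7 : m * (-(2 / a)) ≤ m * F z i := by gcongr; exact h5.1
    have e : (m:ℝ) * (2 / a) = 2 * m / a := by ring
    rw [Finset.mem_Icc]
    simp only [c]
    constructor
    · rw [Int.le_floor]; push_cast; linarith
    · have : (⌊m * F z i⌋ : ℝ) ≤ A := (Int.floor_le _).trans (by linarith)
      exact_mod_cast this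
  set ρ := 3 * b * r / m with hρ
  have hρ0 : 0 < ρ := by positivity
  have hcell : ∀ f : Fin k → ℤ, ∃ y : X, ∀ z ∈ ball x r, c z = f → z ∈ ball y ρ := by
    intro f
    by_cases hex : ∃ y ∈ ball x r, c y = f
    · obtain ⟨y, hy, hyf⟩ := hex
      refine ⟨y, fun z hz hzf => ?_⟩
      have h1 := hF2 z y (by beta_reduce; linarith [hdr z hz]) (by beta_reduce; linarith [hdr y hy])
      beta_reduce at h1
      have h2 := (abs_lt.1 h1).2
      have h3 : ‖F z - F y‖ ≤ 1 / m := by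
        rw [pi_norm_le_iff_of_nonneg (by positivity)]
        intro i
        have hh : ⌊(m:ℝ) * F z i⌋ = ⌊(m:ℝ) * F y i⌋ := congrFun (hzf.trans hyf.symm) i
        have e : |F z i - F y i| * m = |m * F z i - m * F y i| := by
          rw [← mul_sub, abs_mul, abs_of_pos hm0, mul_comm]
        rw [le_div_iff₀ hm0, Pi.sub_apply, Real.norm_eq_abs, e]
        exact (Int.abs_sub_lt_one_of_floor_eq_floor hh).le
      have h4 := hup (F z - F y)
      have h5 : b * ‖F z - F y‖ ≤ b * (1 / m) := by gcongr
      have h6 : b * (1 / m) = b / m := by ring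
      have h7 : dist z y / r < 3 * (b / m) := by
        have : 0 < b / m := by positivity
        linarith
      rw [div_lt_iff₀ hr0] at h7
      rw [mem_ball, hρ]
      calc _ < _ := h7
        _ = _ := by ring
    · push Not at hex
      exact ⟨x, fun z hz hzf => absurd hzf (hex z hz)⟩
  choose y hy using hcell
  have hcov : ball x r ⊆ ⋃ f ∈ I, ball (y f) ρ := by
    intro z hz
    exact mem_iUnion₂.2 ⟨c z, hcI z hz, hy _ z hz rfl⟩
  have hbg := hF.bg x r 1 hr0 hr1
  rw [div_one] at hbg
  have hle : μ.real (ball x r) ≤ (I.card : ℝ) * (32 * ρ) ^ n := by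
    calc μ.real (ball x r) ≤ μ.real (⋃ f ∈ I, ball (y f) ρ) := by
          refine measureReal_mono hcov ?_
          refine (measure_biUnion_lt_top I.finite_toSet fun f _ => ?_).ne
          exact lt_top_iff_ne_top.2 (hF.fin _ _)
      _ ≤ ∑ f ∈ I, μ.real (ball (y f) ρ) := measureReal_biUnion_finset_le _ _
      _ ≤ ∑ f ∈ I, (32 * ρ) ^ n := Finset.sum_le_sum fun f _ => hF.upper _ _ hρ0
      _ = _ := by rw [Finset.sum_const, nsmul_eq_mul]
  have hA0 : 0 ≤ A := Int.ceil_nonneg (by positivity)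
  have hcard : (I.card : ℝ) ≤ ((4 / a + 3) * m) ^ k := by
    have e1 : I.card = (2 * A + 1).toNat ^ k := by
      simp only [I]
      rw [Fintype.card_piFinset_const, Int.card_Icc]
      congr 2; ring
    rw [e1]
    push_cast
    have e2 : (((2 * A + 1).toNat : ℕ) : ℝ) = 2 * (A:ℝ) + 1 := by
      have : (((2 * A + 1).toNat : ℕ) : ℤ) = 2 * A + 1 := Int.toNat_of_nonneg (by omega)
      exact_mod_cast this
    rw [e2]
    have hAA : (A:ℝ) < 2 * m / a + 1 := Int.ceil_lt_add_one _
    have hA0' : (0:ℝ) ≤ A := by exact_mod_cast hA0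
    have e3 : (4 / a + 3) * m = 2 * (2 * m / a) + 3 * m := by ring
    rw [e3]
    gcongr ?_ ^ k
    linarith
  have hfin : r ^ n * μ.real (ball x 1) ≤ ((4 / a + 3) * m) ^ k * (32 * ρ) ^ n := by
    refine hbg.trans (hle.trans ?_)
    gcongr
  have e4 : (32 * ρ) ^ n * (m:ℝ) ^ n = (96 * b) ^ n * r ^ n := by
    rw [← mul_pow, ← mul_pow, hρ]
    congr 1
    field_simp
    norm_num
  have h9 : r ^ n * (μ.real (ball x 1) * (m:ℝ) ^ n) ≤
      r ^ n * ((4 / a + 3) ^ k * (96 * b) ^ n * (m:ℝ) ^ k) := by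
    calc _ = r ^ n * μ.real (ball x 1) * (m:ℝ) ^ n := by ring
      _ ≤ ((4 / a + 3) * m) ^ k * (32 * ρ) ^ n * (m:ℝ) ^ n := by gcongr
      _ = ((4 / a + 3) * m) ^ k * ((96 * b) ^ n * r ^ n) := by rw [mul_assoc, e4]
      _ = _ := by rw [mul_pow]; ring
  exact le_of_mul_le_mul_left h9 (by positivity)

theorem blow_up_ae {X : Type*} [MetricSpace X] [CompleteSpace X]
    [MeasurableSpace X] [BorelSpace X]
    (S C D : ℝ) (hS : 1 ≤ S) (hC : 0 ≤ C) (hD : 0 < D)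
    (hgeo : IsGeodesicSpace X) (hconc : SConcave X S)
    (hsemi : LocSemiConvex X C D) (hbus : BusemannConcave X)
    (n : ℕ) (hdim : dimH (Set.univ : Set X) = n) :
    ∀ᵐ x ∂(μH[(n : ℝ)] : Measure X),
      ∃ N : (Fin n → ℝ) → ℝ, IsNormFn N ∧
        ∀ ε : ℝ, 0 < ε → ∃ r₀ > 0, ∀ r : ℝ, 0 < r → r < r₀ →
          ∃ F : X → Fin n → ℝ,
            IsEpsIsometry (fun a b => dist a b / r) x
              (fun u v => N (u - v)) (0 : Fin n → ℝ) ε F := by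
  by_cases hne : (μH[(n : ℝ)] : Measure X) univ = 0
  · rw [Measure.measure_univ_eq_zero] at hne
    rw [hne]
    simp
  have hF := measFacts hgeo hbus n hdim hne
  have hprop := properSpace_of hgeo hbus n hdim
  filter_upwards [ae_good hgeo hbus n hF (D / 16) (by positivity)] with x hx
  have H : BlowSetup x (max S C) D := by
    refine ⟨hgeo, hbus, hS.trans (le_max_left _ _), hD, ?_, hx⟩
    intro p γ hγ hlt t ht
    have h1 := hconc p γ hγ t ht
    have h2 := hsemi p γ hγ hlt t ht
    have ht1 : 0 ≤ 1 - t := by linarith [ht.2]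
    have ht0 := ht.1
    have h3 : S * t * (1 - t) * dist (γ 0) (γ 1) ^ 2 ≤ max S C * t * (1 - t) * dist (γ 0) (γ 1) ^ 2 := by
      gcongr; exact le_max_left _ _
    have h4 : C * t * (1 - t) * dist (γ 0) (γ 1) ^ 2 ≤ max S C * t * (1 - t) * dist (γ 0) (γ 1) ^ 2 := by
      gcongr; exact le_max_right _ _
    rw [abs_le]
    constructor <;> linarith
  obtain ⟨k, N, hN, hNx⟩ := blow_up_exists H n hdim
  have hk : k = n := le_antisymm (dim_le hgeo hbus n hdim x hN hNx) (le_dim n hF x hN hNx)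
  subst hk
  exact ⟨N, hN, hNx⟩

end Helpers

/-- at `μH[n]`-a.e. point the blow-ups converge in the pointed
Gromov--Hausdorff sense to a finite-dimensional normed space `(ℝⁿ, ‖·‖ₓ, 0)`. -/
theorem stmt_2 {X : Type*} [MetricSpace X] [CompleteSpace X]
    [MeasurableSpace X] [BorelSpace X]
    (S C D : ℝ) (hS : 1 ≤ S) (hC : 0 ≤ C) (hD : 0 < D)
    (hgeo : IsGeodesicSpace X) (hconc : SConcave X S)
    (hsemi : LocSemiConvex X C D) (hbus : BusemannConcave X)
    (n : ℕ) (hdim : dimH (Set.univ : Set X) = n) :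
    ∀ᵐ x ∂(μH[(n : ℝ)] : Measure X),
      ∃ N : (Fin n → ℝ) → ℝ, IsNormFn N ∧
        ∀ ε : ℝ, 0 < ε → ∃ r₀ > 0, ∀ r : ℝ, 0 < r → r < r₀ →
          ∃ F : X → Fin n → ℝ,
            IsEpsIsometry (fun a b => dist a b / r) x
              (fun u v => N (u - v)) (0 : Fin n → ℝ) ε F := by
  exact blow_up_ae S C D hS hC hD hgeo hconc hsemi hbus n hdim
end
end

section
/- For every n ∈ ℕ and every δ with 0 < δ < δ_n (where δ_k := k⁻¹·2^{−2k−1}) there exists a constant S₁ > 1, depending only on δ, with the following property: if X is an S-concave, (C,D)-locally semi-convex, Busemann concave complete geodesic space with S ∈ [1, S₁] and Hausdorff dimension n, then for every k = 1, …, n the Hausdorff dimension of the singular set X \ A(k,δ) is at most k − 1. -/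
open Set Metric MeasureTheory Filter Topology

noncomputable section

variable {X : Type*} [MetricSpace X]

/-- A Cantor-type construction giving a lower bound on the Hausdorff dimension. -/
lemma le_dimH_of_branching {Y : Type*} [MetricSpace Y] [CompleteSpace Y] (y : Y) (s q : ℝ)
    (hs : 0 < s) (hq0 : 0 < q) (hq : q ≤ 1 / 8) (N d : ℕ) (hN2 : 2 ≤ N) (hd : 1 ≤ d)
    (hN : (q⁻¹) ^ d ≤ (N : ℝ)) (Φ : Y → ℝ → Fin N → Y)
    (hΦ : ∀ x ∈ closedBall y s, ∀ r, 0 < r → r ≤ s →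
      (∀ i, dist x (Φ x r i) ≤ r) ∧ ∀ i j, i ≠ j → 8 * q * r ≤ dist (Φ x r i) (Φ x r j)) :
    (d : ENNReal) ≤ dimH (univ : Set Y) := by
  have : NeZero N := ⟨by omega⟩
  let r : ℕ → ℝ := fun m => s / 2 * q ^ m
  have hr0 : ∀ m, 0 < r m := fun m => by positivity
  have hr2 : ∀ m, r m ≤ s / 2 / 2 ^ m := by
    intro m
    have : q ^ m ≤ (1 / 2) ^ m := pow_le_pow_left₀ hq0.le (by linarith) m
    calc r m ≤ s / 2 * (1 / 2) ^ m := by simp only [r]; gcongr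
      _ = _ := by rw [one_div, inv_pow]; rfl
  have hrs : ∀ m, r m ≤ s := fun m => (hr2 m).trans (by
    have : (1 : ℝ) ≤ 2 ^ m := one_le_pow₀ (by norm_num)
    rw [div_le_iff₀ (by positivity)]; nlinarith)
  let pt : (ℕ → Fin N) → ℕ → Y := fun w m =>
    Nat.rec y (fun m x => Φ x (r m) (w m)) m
  have pt0 : ∀ w, pt w 0 = y := fun w => rfl
  have pts : ∀ w m, pt w (m + 1) = Φ (pt w m) (r m) (w m) := fun w m => rfl
  have hball : ∀ w m, dist y (pt w m) ≤ s - s / 2 ^ m := by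
    intro w m
    induction m with
    | zero => simp [pt0]
    | succ m ih =>
      have hmem : pt w m ∈ closedBall y s := by
        rw [mem_closedBall, dist_comm]
        have : 0 < s / 2 ^ m := by positivity
        linarith
      have h1 := (hΦ _ hmem (r m) (hr0 m) (hrs m)).1 (w m)
      rw [← pts] at h1
      have h2 := dist_triangle y (pt w m) (pt w (m + 1))
      have h3 := hr2 m
      have h4 : s / 2 ^ (m + 1) = s / 2 / 2 ^ m := by rw [pow_succ]; field_simp
      have h5 : s / 2 ^ m = s / 2 / 2 ^ m + s / 2 / 2 ^ m := by field_simp; ring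
      linarith
  have hmem : ∀ w m, pt w m ∈ closedBall y s := by
    intro w m
    rw [mem_closedBall, dist_comm]
    have : 0 < s / 2 ^ m := by positivity
    linarith [hball w m]
  have hstep : ∀ w m, dist (pt w m) (pt w (m + 1)) ≤ s / 2 * q ^ m := fun w m =>
    (hΦ _ (hmem w m) (r m) (hr0 m) (hrs m)).1 (w m)
  have hq1 : q < 1 := by linarith
  have hlim : ∀ w, ∃ x, Tendsto (pt w) atTop (𝓝 x) := fun w =>
    cauchySeq_tendsto_of_complete (cauchySeq_of_le_geometric q (s / 2) hq1 (hstep w))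
  choose L hL using hlim
  have htail : ∀ w m, dist (pt w m) (L w) ≤ 2 * r m := by
    intro w m
    refine (dist_le_of_le_geometric_of_tendsto q (s / 2) hq1 (hstep w) (hL w) m).trans ?_
    rw [div_le_iff₀ (by linarith)]
    have := hr0 m
    simp only [r] at *
    nlinarith
  have hcong : ∀ w w' m, (∀ i < m, w i = w' i) → pt w m = pt w' m := by
    intro w w' m
    induction m with
    | zero => intro _; rfl
    | succ m ih =>
      intro h
      rw [pts, pts, ih (fun i hi => h i (by omega)), h m (by omega)]
  have hsep : ∀ w w' m, (∀ i < m, w i = w' i) → w m ≠ w' m → 4 * q * r m ≤ dist (L w) (L w') := by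
    intro w w' m h hne
    have h1 := (hΦ _ (hmem w m) (r m) (hr0 m) (hrs m)).2 _ _ hne
    have h2 := pts w' m
    rw [← hcong w w' m h] at h2
    rw [← h2, ← pts] at h1
    have h3 := htail w (m + 1)
    have h4 := htail w' (m + 1)
    have h5 := dist_triangle4 (pt w (m + 1)) (L w) (L w') (pt w' (m + 1))
    rw [dist_comm (L w') _] at h5
    have h6 : r (m + 1) = q * r m := by simp only [r]; ring
    rw [h6] at h3 h4
    linarith
  have hkey : ∀ w w', |Real.ofDigits w - Real.ofDigits w'|
      ≤ ((2 * q * s)⁻¹) ^ d * dist (L w) (L w') ^ d := by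
    intro w w'
    by_cases hww : w = w'
    · subst hww
      simp only [sub_self, abs_zero]; positivity
    · have hex : ∃ m, w m ≠ w' m := by
        by_contra! hcon
        exact hww (funext hcon)
      classical
      have h1 := hsep w w' (Nat.find hex) (fun i hi => not_not.1 (Nat.find_min hex hi))
        (Nat.find_spec hex)
      have h2 := Real.abs_ofDigits_sub_ofDigits_le (x := w) (y := w') (n := Nat.find hex)
        (fun i hi => not_not.1 (Nat.find_min hex hi))
      set m := Nat.find hex
      refine h2.trans ?_
      have h3 : ((N : ℝ) ^ m)⁻¹ ≤ (q ^ m) ^ d := by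
        have : ((q⁻¹) ^ d) ^ m ≤ (N : ℝ) ^ m := pow_le_pow_left₀ (by positivity) hN m
        refine (inv_anti₀ (by positivity) this).trans (le_of_eq ?_)
        rw [inv_pow, inv_pow, inv_inv, ← pow_mul, ← pow_mul, mul_comm]
      refine h3.trans ?_
      rw [← mul_pow]
      refine pow_le_pow_left₀ (by positivity) ?_ d
      rw [inv_mul_eq_div, le_div_iff₀ (by positivity)]
      simp only [r] at h1
      linarith
  have hinj : Function.Injective L := by
    intro w w' h
    by_contra hww
    have hex : ∃ m, w m ≠ w' m := by
      by_contra! hcon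
      exact hww (funext hcon)
    classical
    have h1 := hsep w w' (Nat.find hex) (fun i hi => not_not.1 (Nat.find_min hex hi))
      (Nat.find_spec hex)
    rw [h, dist_self] at h1
    have := hr0 (Nat.find hex)
    have : 0 < 4 * q * r (Nat.find hex) := by positivity
    linarith
  let f : Y → ℝ := fun x => Real.ofDigits (Function.invFun L x)
  have hf : ∀ w, f (L w) = Real.ofDigits w := fun w => by
    simp only [f, Function.leftInverse_invFun hinj w]
  have hH : HolderOnWith (Real.toNNReal (((2 * q * s)⁻¹) ^ d)) (d : NNReal) f (range L) := by
    rintro _ ⟨w, rfl⟩ _ ⟨w', rfl⟩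
    rw [hf, hf, edist_dist, edist_dist, Real.dist_eq, NNReal.coe_natCast, ENNReal.rpow_natCast,
      ← ENNReal.ofReal_pow dist_nonneg]
    change _ ≤ ENNReal.ofReal _ * _
    rw [← ENNReal.ofReal_mul (by positivity)]
    exact ENNReal.ofReal_le_ofReal (hkey w w')
  have hd0 : (0 : NNReal) < d := by exact_mod_cast hd
  have h1 := hH.dimH_image_le hd0
  have h2 : (1 : ENNReal) ≤ dimH (f '' range L) := by
    have : Ico (0 : ℝ) 1 ⊆ f '' range L := by
      intro x hx
      exact ⟨L (Real.digits x N), ⟨_, rfl⟩, by rw [hf, Real.ofDigits_digits (by omega) hx]⟩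
    refine le_trans ?_ (dimH_mono this)
    rw [Real.dimH_of_nonempty_interior (by simp)]
    simp
  have h3 := h2.trans h1
  have h4 : (d : ENNReal) ≤ dimH (range L) := by
    have hd1 : ((d : NNReal) : ENNReal) ≠ 0 := by exact_mod_cast hd0.ne'
    rw [ENNReal.le_div_iff_mul_le (Or.inl hd1) (Or.inl (by simp)), one_mul] at h3
    simpa using h3
  exact h4.trans (dimH_mono (subset_univ _))

/-- Constant speed geodesics may be shortened. -/
lemma IsConstSpeedGeodesic.shorten {Y : Type*} [MetricSpace Y] {γ : ℝ → Y}
    (h : IsConstSpeedGeodesic γ) (a : ℝ) (ha : a ∈ Icc (0 : ℝ) 1) :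
    IsConstSpeedGeodesic (fun t => γ (t * a)) := by
  have hm : ∀ s ∈ Icc (0 : ℝ) 1, s * a ∈ Icc (0 : ℝ) 1 := fun s hs =>
    ⟨mul_nonneg hs.1 ha.1, mul_le_one₀ hs.2 ha.1 ha.2⟩
  intro s hs t ht
  simp only
  rw [h _ (hm s hs) _ (hm t ht), h _ (hm 0 (by simp)) _ (hm 1 (by simp)), ← sub_mul, abs_mul,
    ← mul_assoc]
  congr 2
  rw [zero_mul, one_mul, zero_sub, abs_neg]

/-- Uniform packing bound in Busemann concave spaces of finite Hausdorff dimension. -/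
lemma exists_packing_bound {Y : Type*} [MetricSpace Y] [CompleteSpace Y]
    (hG : IsGeodesicSpace Y) (hB : BusemannConcave Y) (n : ℕ) (hn : dimH (univ : Set Y) ≤ n)
    (θ : ℝ) (hθ0 : 0 < θ) (hθ1 : θ ≤ 1) :
    ∃ N : ℕ, ∀ (y : Y) (s : ℝ), 0 < s → ∀ z : Fin N → Y, (∀ i, dist y (z i) ≤ s) →
      ∃ i j, i < j ∧ dist (z i) (z j) < θ * s := by
  obtain ⟨M, hM⟩ := exists_nat_ge (((θ / 16)⁻¹) ^ (n + 1))
  refine ⟨M + 2, fun y s hs z hz => ?_⟩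
  by_contra! hcon
  have hsep : ∀ i j, i ≠ j → θ * s ≤ dist (z i) (z j) := by
    intro i j hij
    rcases lt_or_gt_of_ne hij with h | h
    · exact hcon i j h
    · rw [dist_comm]; exact hcon j i h
  choose g hg g0 g1 using hG
  have key := le_dimH_of_branching y s (θ / 16) hs (by positivity) (by linarith) (M + 2) (n + 1)
    (by omega) (by omega) (by push_cast; linarith)
    (fun x r i => g x (z i) (r / (2 * s))) ?_
  · have := key.trans hn
    have : (n + 1 : ℕ) ≤ n := by exact_mod_cast this
    omega
  · intro x hx r hr hrs
    have ht0 : 0 < r / (2 * s) := by positivity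
    have ht1 : r / (2 * s) ≤ 1 := by rw [div_le_one (by positivity)]; linarith
    constructor
    · intro i
      have h1 := hg x (z i) 0 (by simp) (r / (2 * s)) ⟨ht0.le, ht1⟩
      rw [g0, g1, zero_sub, abs_neg, abs_of_pos ht0] at h1
      rw [h1]
      have h2 := dist_triangle x y (z i)
      have h3 := hz i
      rw [mem_closedBall] at hx
      calc r / (2 * s) * dist x (z i) ≤ r / (2 * s) * (2 * s) := by gcongr; linarith
        _ = r := by field_simp
    · intro i j hij
      have h1 := hB (g x (z i)) (g x (z j)) (hg _ _) (hg _ _) (by rw [g0, g0]) (r / (2 * s)) 1 ht0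
        ht1 le_rfl
      rw [g1, g1, div_one, le_div_iff₀ ht0] at h1
      refine le_trans ?_ h1
      calc 8 * (θ / 16) * r = (θ * s) * (r / (2 * s)) := by field_simp; ring
        _ ≤ _ := by gcongr; exact hsep i j hij

/-- Finite Hausdorff dimension implies second countability. -/
lemma secondCountable_of_dimH_le {Y : Type*} [MetricSpace Y] (n : ℕ)
    (hn : dimH (univ : Set Y) ≤ n) : SecondCountableTopology Y := by
  borelize Y
  have h0 : μH[((n + 1 : ℕ) : NNReal)] (univ : Set Y) = 0 := by
    apply hausdorffMeasure_of_dimH_lt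
    refine hn.trans_lt ?_
    rw [ENNReal.coe_natCast]
    exact_mod_cast Nat.lt_succ_self n
  rw [Measure.hausdorffMeasure_apply] at h0
  refine Metric.secondCountable_of_almost_dense_set fun ε hε => ?_
  have h1 : ∃ t : ℕ → Set Y, univ ⊆ ⋃ n, t n ∧ ∀ n, Metric.ediam (t n) ≤ ENNReal.ofReal ε := by
    by_contra! hcon
    have h2 := le_iSup₂ (f := fun (r : ENNReal) (_ : 0 < r) =>
        ⨅ (t : ℕ → Set Y) (_ : univ ⊆ ⋃ n, t n) (_ : ∀ n, Metric.ediam (t n) ≤ r),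
          ∑' k, ⨆ _ : (t k).Nonempty, Metric.ediam (t k) ^ (((n + 1 : ℕ) : NNReal) : ℝ))
        (ENNReal.ofReal ε) (by simpa using hε)
    rw [h0] at h2
    have h3 : (⊤ : ENNReal) ≤ 0 := by
      refine le_trans ?_ h2
      refine le_iInf fun t => le_iInf fun ht => le_iInf fun ht2 => ?_
      obtain ⟨k, hk⟩ := hcon t ht
      exact absurd (ht2 k) (not_le.2 hk)
    simp at h3
  obtain ⟨t, ht, htd⟩ := h1
  classical
  by_cases hne : Nonempty Y
  · obtain ⟨y0⟩ := hne
    refine ⟨range (fun k => if h : (t k).Nonempty then h.some else y0), countable_range _,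
      fun x => ?_⟩
    obtain ⟨k, hk⟩ := mem_iUnion.1 (ht (mem_univ x))
    have hk' : (t k).Nonempty := ⟨x, hk⟩
    refine ⟨_, ⟨k, rfl⟩, ?_⟩
    simp only [dif_pos hk']
    have := (Metric.edist_le_ediam_of_mem hk hk'.some_mem).trans (htd k)
    rw [edist_dist] at this
    exact (ENNReal.ofReal_le_ofReal_iff hε.le).1 this
  · exact ⟨∅, countable_empty, fun x => (hne ⟨x⟩).elim⟩

/-- Among points converging to `y`, two are almost in the same direction. -/
lemma exists_close_pair {Y : Type*} [MetricSpace Y]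
    (hG : IsGeodesicSpace Y) (hB : BusemannConcave Y) (θ : ℝ) (N : ℕ)
    (hN : ∀ (y : Y) (s : ℝ), 0 < s → ∀ z : Fin N → Y, (∀ i, dist y (z i) ≤ s) →
      ∃ i j, i < j ∧ dist (z i) (z j) < θ * s)
    (y : Y) (z : ℕ → Y) (hz0 : ∀ i, 0 < dist y (z i))
    (hz : ∀ i j, i < j → dist y (z j) ≤ dist y (z i)) :
    ∃ i j, i < j ∧ dist (z i) (z j) ≤ dist y (z i) - dist y (z j) + θ * dist y (z j) := by
  choose g hg g0 g1 using hG
  have hs := hz0 N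
  set s := dist y (z N) with hsdef
  have hle : ∀ i : Fin N, s ≤ dist y (z i) := fun i => hz i N i.2
  have hIcc : ∀ i : Fin N, s / dist y (z i) ∈ Icc (0 : ℝ) 1 := fun i =>
    ⟨by positivity, by rw [div_le_one (hz0 i)]; exact hle i⟩
  obtain ⟨i, j, hij, hd⟩ := hN y s hs (fun i => g y (z i) (s / dist y (z i))) (by
    intro i
    have h1 := hg y (z i) 0 (by simp) _ (hIcc i)
    rw [g0, g1, zero_sub, abs_neg, abs_of_nonneg (hIcc i).1] at h1
    rw [h1, div_mul_cancel₀ _ (hz0 i).ne'])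
  refine ⟨i, j, hij, ?_⟩
  have hi := hz0 i
  have hj := hz0 j
  have hji := hz i j hij
  have hr : dist y (z j) / dist y (z i) ∈ Icc (0 : ℝ) 1 :=
    ⟨by positivity, by rw [div_le_one hi]; exact hji⟩
  have h1 := hB _ _ ((hg y (z i)).shorten _ hr) (hg y (z j)) (by rw [zero_mul, g0, g0])
    (s / dist y (z j)) 1 (by positivity) (hIcc j).2 le_rfl
  simp only [one_mul, div_one, g1] at h1
  have h2 : s / dist y (z j) * (dist y (z j) / dist y (z i)) = s / dist y (z i) := by
    field_simp
  rw [h2] at h1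
  have h3 : dist (g y (z i) (dist y (z j) / dist y (z i))) (z j) ≤ θ * dist y (z j) := by
    refine h1.trans ?_
    rw [div_le_iff₀ (by positivity)]
    have : θ * dist y (z j) * (s / dist y (z j)) = θ * s := by field_simp
    rw [this]; exact hd.le
  have h4 := hg y (z i) 1 (by simp) _ hr
  rw [g0, g1, abs_of_nonneg (by linarith [hr.2]), sub_mul, one_mul, div_mul_cancel₀ _ hi.ne'] at h4
  have h5 := dist_triangle (z i) (g y (z i) (dist y (z j) / dist y (z i))) (z j)
  linarith

lemma arccos_lt_of_cos_lt {δ v : ℝ} (h0 : 0 < δ) (h1 : δ ≤ Real.pi) (hv : Real.cos δ < v) :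
    Real.arccos v < δ := by
  rcases le_total 1 v with h | h
  · rw [Real.arccos_of_one_le h]; exact h0
  · have := Real.strictAntiOn_arccos ⟨Real.neg_one_le_cos δ, Real.cos_le_one δ⟩
      ⟨(Real.neg_one_le_cos δ).trans hv.le, h⟩ hv
    rwa [Real.arccos_cos h0.le h1] at this

lemma abs_arccos_sub_lt {δ v : ℝ} (h0 : 0 < δ) (h1 : δ < Real.pi / 2) (hv : |v| < Real.sin δ) :
    |Real.arccos v - Real.pi / 2| < δ := by
  rw [abs_lt] at hv ⊢
  have hp := Real.pi_pos
  constructor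
  · have : Real.arccos (-v) < Real.pi / 2 + δ := by
      apply arccos_lt_of_cos_lt (by linarith) (by linarith)
      rw [add_comm, Real.cos_add_pi_div_two]; linarith
    rw [Real.arccos_neg] at this
    linarith
  · have : Real.arccos v < Real.pi / 2 + δ := by
      apply arccos_lt_of_cos_lt (by linarith) (by linarith)
      rw [add_comm, Real.cos_add_pi_div_two]; linarith
    linarith

lemma compAngle_near_pi {Y : Type*} [MetricSpace Y] {δ θ : ℝ} (h0 : 0 < δ) (h1 : δ < Real.pi / 2)
    (p x q : Y) (ha : 0 < dist x p) (hb : 0 < dist x q) (hθ : θ ≤ 1)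
    (hc : dist x p + (1 - θ) * dist x q ≤ dist p q)
    (hab : θ + dist x q / (2 * dist x p) < 1 - Real.cos δ) :
    Real.pi - δ < compAngle p x q := by
  unfold compAngle
  set a := dist x p
  set b := dist x q
  set c := dist p q
  have h2 : Real.arccos (-((a ^ 2 + b ^ 2 - c ^ 2) / (2 * a * b))) < δ := by
    apply arccos_lt_of_cos_lt h0 (by linarith)
    have hbb : 0 ≤ (1 - θ) * b := mul_nonneg (by linarith) hb.le
    have h3 : (a + (1 - θ) * b) ^ 2 ≤ c ^ 2 := pow_le_pow_left₀ (by positivity) hc 2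
    have h4 : Real.cos δ < 1 - θ - b / (2 * a) := by linarith
    refine h4.trans_le ?_
    rw [← neg_div, le_div_iff₀ (by positivity)]
    have h5 : (1 - θ - b / (2 * a)) * (2 * a * b) = (1 - θ) * (2 * a * b) - b ^ 2 := by
      field_simp
    rw [h5]
    nlinarith [sq_nonneg ((1 - θ) * b)]
  rw [Real.arccos_neg] at h2
  linarith

lemma compAngle_near_pi_div_two {Y : Type*} [MetricSpace Y] {δ : ℝ} (h0 : 0 < δ)
    (h1 : δ < Real.pi / 2) (p x P : Y) (ha : 0 < dist x p) (hb : 0 < dist x P)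
    (hac : |dist x p - dist p P| ≤ Real.sin δ / 4 * dist x P)
    (hba : 2 * dist x P ≤ Real.sin δ * dist x p) :
    |compAngle p x P - Real.pi / 2| < δ := by
  unfold compAngle
  apply abs_arccos_sub_lt h0 h1
  have hσ : 0 < Real.sin δ := Real.sin_pos_of_pos_of_lt_pi h0 (by linarith [Real.pi_pos])
  have hσ1 := Real.sin_le_one δ
  have htri : dist p P ≤ dist x p + dist x P := by
    rw [dist_comm x p]; exact dist_triangle p x P
  have hc0 : 0 ≤ dist p P := dist_nonneg
  set a := dist x p
  set b := dist x P
  set c := dist p P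
  set σ := Real.sin δ
  rw [abs_div, abs_of_pos (show 0 < 2 * a * b by positivity), div_lt_iff₀ (by positivity)]
  have h2 : |a ^ 2 + b ^ 2 - c ^ 2| ≤ |a - c| * (a + c) + b ^ 2 := by
    have : a ^ 2 + b ^ 2 - c ^ 2 = (a - c) * (a + c) + b ^ 2 := by ring
    rw [this]
    refine (abs_add_le _ _).trans ?_
    rw [abs_mul, abs_of_nonneg (show 0 ≤ a + c by positivity), abs_of_nonneg (sq_nonneg b)]
  refine h2.trans_lt ?_
  have hb2 : 2 * b ≤ a := by nlinarith
  calc |a - c| * (a + c) + b ^ 2 ≤ (σ / 4 * b) * (a + (a + b)) + b ^ 2 := by gcongr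
    _ = b * (σ / 4 * (2 * a + b) + b) := by ring
    _ < b * (2 * a * σ) := by
        gcongr
        nlinarith [mul_pos hσ ha]
    _ = σ * (2 * a * b) := by ring

lemma IsStrainer.snoc {Y : Type*} [MetricSpace Y] {S C D δ : ℝ} {x : Y} {m : ℕ} {p q : Fin m → Y}
    (h : IsStrainer S C D δ x p q) (P Q : Y) (h1 : IsOneStrainer S δ x P Q) (hD : dist P x < D)
    (h2 : ∀ i, Real.arccos (1 - (S + C) * dist P x / (2 * dist (p i) x)) < δ)
    (h3 : ∀ i, |compAngle (p i) x P - Real.pi / 2| < δ)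
    (h4 : ∀ i, |compAngle (p i) x Q - Real.pi / 2| < δ) :
    x ∈ strainedPoints Y S C D δ (m + 1) := by
  refine ⟨Fin.snoc (α := fun _ => Y) p P, Fin.snoc (α := fun _ => Y) q Q, ?_, ?_, ?_⟩
  · intro j
    induction j using Fin.lastCases with
    | last => simpa using h1
    | cast j => simpa using h.1 j
  · intro j
    induction j using Fin.lastCases with
    | last => intro _; simpa using hD
    | cast j => intro hj; simpa using h.2.1 j (by simpa using hj)
  · intro i j hij
    induction j using Fin.lastCases with
    | last =>
      induction i using Fin.lastCases with
      | last => exact absurd hij (lt_irrefl _)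
      | cast i => simpa using ⟨h2 i, h3 i, h4 i⟩
    | cast j =>
      induction i using Fin.lastCases with
      | last => exact absurd hij (not_lt.2 (Fin.le_last _))
      | cast i => simpa using h.2.2 i j (by simpa using hij)

lemma continuousAt_compAngle {Y : Type*} [MetricSpace Y] (p q x : Y) (hp : p ≠ x) (hq : q ≠ x) :
    ContinuousAt (fun x => compAngle p x q) x := by
  unfold compAngle
  apply ContinuousAt.arccos
  apply ContinuousAt.div (by fun_prop) (by fun_prop)
  have h1 : dist x p ≠ 0 := dist_ne_zero.2 hp.symm
  have h2 : dist x q ≠ 0 := dist_ne_zero.2 hq.symm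
  positivity

lemma IsStrainer.eventually {Y : Type*} [MetricSpace Y] {S C D δ : ℝ} {x : Y} {m : ℕ}
    {p q : Fin m → Y} (h : IsStrainer S C D δ x p q) :
    ∀ᶠ z in 𝓝 x, IsStrainer S C D δ z p q := by
  have hp : ∀ i, p i ≠ x := fun i => (h.1 i).1
  have hq : ∀ i, q i ≠ x := fun i => (h.1 i).2.1
  have hpd : ∀ i, 2 * dist (p i) x ≠ 0 := fun i =>
    mul_ne_zero two_ne_zero (dist_ne_zero.2 (hp i))
  refine Filter.Eventually.and ?_ (Filter.Eventually.and ?_ ?_)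
  · rw [eventually_all]
    intro j
    refine ((eventually_ne_nhds (hp j).symm).mono fun _ h => h.symm).and
      (((eventually_ne_nhds (hq j).symm).mono fun _ h => h.symm).and (Filter.Eventually.and ?_ ?_))
    · exact (continuousAt_compAngle _ _ _ (hp j) (hq j)).eventually_const_lt (h.1 j).2.2.1
    · refine Filter.Tendsto.eventually_lt_const (h.1 j).2.2.2 (?_ : ContinuousAt _ x)
      exact ContinuousAt.arccos (continuousAt_const.sub
        (ContinuousAt.div (by fun_prop) (by fun_prop) (hpd j)))
  · rw [eventually_all]
    intro j
    by_cases hj : (j : ℕ) = 0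
    · have : ContinuousAt (fun z => dist (p j) z) x := by fun_prop
      exact (this.eventually_lt_const (h.2.1 j hj)).mono fun _ hz _ => hz
    · exact Filter.Eventually.of_forall fun _ hj' => absurd hj' hj
  · rw [eventually_all]
    intro i
    rw [eventually_all]
    intro j
    by_cases hij : i < j
    · have hh := h.2.2 i j hij
      have e1 : ∀ᶠ z in 𝓝 x,
          Real.arccos (1 - (S + C) * dist (p j) z / (2 * dist (p i) z)) < δ := by
        refine Filter.Tendsto.eventually_lt_const hh.1 (?_ : ContinuousAt _ x)
        exact ContinuousAt.arccos (continuousAt_const.sub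
          (ContinuousAt.div (by fun_prop) (by fun_prop) (hpd i)))
      have e2 := (((continuousAt_compAngle _ _ _ (hp i) (hp j)).sub
        continuousAt_const).abs).eventually_lt_const hh.2.1
      have e3 := (((continuousAt_compAngle _ _ _ (hp i) (hq j)).sub
        continuousAt_const).abs).eventually_lt_const hh.2.2
      filter_upwards [e1, e2, e3] with z a b c _ using ⟨a, b, c⟩
    · exact Filter.Eventually.of_forall fun _ hj' => absurd hj' hij

set_option maxHeartbeats 800000 in
/-- Near a point, distance coordinates are expanding on the set of points without
a `(m+1)`-strainer. -/
lemma local_expanding {Y : Type*} [MetricSpace Y]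
    (hG : IsGeodesicSpace Y) (hB : BusemannConcave Y)
    (hpack : ∀ θ : ℝ, 0 < θ → θ ≤ 1 → ∃ N : ℕ, ∀ (y : Y) (s : ℝ), 0 < s → ∀ z : Fin N → Y,
      (∀ i, dist y (z i) ≤ s) → ∃ i j, i < j ∧ dist (z i) (z j) < θ * s)
    {S C D δ : ℝ} (hS : 1 ≤ S) (hC : 0 ≤ C) (hD : 0 < D) (hδ0 : 0 < δ) (hδ1 : δ < Real.pi / 2)
    {m : ℕ} {p q : Fin m → Y} (t : Set Y) (ht : ∀ z ∈ t, IsStrainer S C D δ z p q)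
    (ht' : ∀ z ∈ t, z ∉ strainedPoints Y S C D δ (m + 1)) (y : Y) (hy : y ∈ t) :
    ∃ r > 0, ∀ z ∈ t, dist y z < r →
      Real.sin δ / 16 * dist y z ≤ dist (fun i => dist (p i) y) (fun i => dist (p i) z) := by
  by_contra! hcon
  have hσ : 0 < Real.sin δ := Real.sin_pos_of_pos_of_lt_pi hδ0 (by linarith [Real.pi_pos])
  have hσ1 := Real.sin_le_one δ
  have hω1 : Real.cos δ > 0 := Real.cos_pos_of_mem_Ioo ⟨by linarith, hδ1⟩
  have hω0 : Real.cos δ < 1 := by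
    have := Real.cos_lt_cos_of_nonneg_of_le_pi_div_two le_rfl hδ1.le hδ0
    rwa [Real.cos_zero] at this
  set σ := Real.sin δ with hσdef
  set ω := 1 - Real.cos δ with hωdef
  have hω : 0 < ω := by linarith
  have hωle : ω ≤ 1 := by linarith
  have hA : ∀ i, 0 < dist (p i) y := fun i => dist_pos.2 ((ht y hy).1 i).1
  -- the scale
  obtain ⟨r0, hr0, hr0D, hr0i⟩ : ∃ r0 > 0, 2 * r0 < D ∧ ∀ i, 2 * (S + C) * r0 < ω * dist (p i) y ∧
      8 * r0 ≤ σ * dist (p i) y := by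
    have e0 : ∀ᶠ r : ℝ in 𝓝[>] 0, 0 < r := self_mem_nhdsWithin
    have e : ∀ B : ℝ, 0 < B → ∀ᶠ r : ℝ in 𝓝[>] 0, r < B := fun B hB =>
      mem_of_superset (Ioo_mem_nhdsGT hB) fun r hr => hr.2
    have e1 := e (D / 2) (by positivity)
    have e2 : ∀ᶠ r : ℝ in 𝓝[>] 0, ∀ i, r < ω * dist (p i) y / (2 * (S + C)) :=
      eventually_all.2 fun i => e _ (by have := hA i; positivity)
    have e3 : ∀ᶠ r : ℝ in 𝓝[>] 0, ∀ i, r < σ * dist (p i) y / 8 :=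
      eventually_all.2 fun i => e _ (by have := hA i; positivity)
    obtain ⟨r, a, b, c, d⟩ := (e0.and (e1.and (e2.and e3))).exists
    refine ⟨r, a, by linarith, fun i => ⟨?_, by linarith [d i]⟩⟩
    have := c i
    rw [lt_div_iff₀ (by positivity)] at this
    linarith
  -- the sequence
  set κ := ω / (4 * S) with hκdef
  have hκ0 : 0 < κ := by positivity
  have hκS : κ * S = ω / 4 := by rw [hκdef]; field_simp
  have hκ1 : κ ≤ 1 / 4 := by nlinarith
  have : Nonempty Y := ⟨y⟩
  choose! g hgt hgd hgf using hcon
  have hgpos : ∀ r > 0, 0 < dist y (g r) := by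
    intro r hr
    have h1 := hgf r hr
    have h2 : 0 ≤ dist (fun i => dist (p i) y) (fun i => dist (p i) (g r)) := dist_nonneg
    by_contra h3
    have h4 : dist y (g r) = 0 := le_antisymm (not_lt.1 h3) dist_nonneg
    rw [h4, mul_zero] at h1
    linarith
  let z : ℕ → Y := fun k => Nat.rec (g r0) (fun _ x => g (κ * dist y x)) k
  have zs : ∀ k, z (k + 1) = g (κ * dist y (z k)) := fun k => rfl
  have hz : ∀ k, ∃ r > 0, z k = g r := by
    intro k
    induction k with
    | zero => exact ⟨r0, hr0, rfl⟩
    | succ k ih =>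
      obtain ⟨r, hr, h⟩ := ih
      refine ⟨κ * dist y (z k), ?_, zs k⟩
      rw [h]; exact mul_pos hκ0 (hgpos r hr)
  have hz0 : ∀ k, 0 < dist y (z k) := fun k => by
    obtain ⟨r, hr, h⟩ := hz k; rw [h]; exact hgpos r hr
  have hzt : ∀ k, z k ∈ t := fun k => by
    obtain ⟨r, hr, h⟩ := hz k; rw [h]; exact hgt r hr
  have hzf : ∀ k i, |dist (p i) y - dist (p i) (z k)| ≤ σ / 16 * dist y (z k) := fun k i => by
    obtain ⟨r, hr, h⟩ := hz k; rw [h, ← Real.dist_eq]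
    exact (dist_le_pi_dist (fun i => dist (p i) y) (fun i => dist (p i) (g r)) i).trans
      (hgf r hr).le
  have hzstep : ∀ k, dist y (z (k + 1)) ≤ κ * dist y (z k) := fun k =>
    (hgd _ (mul_pos hκ0 (hz0 k))).le
  have hanti : Antitone (fun k => dist y (z k)) := antitone_nat_of_succ_le fun k => by
    have := hzstep k; have := hz0 k; nlinarith
  have hzlt : ∀ i j, i < j → dist y (z j) ≤ κ * dist y (z i) := fun i j hij =>
    (hanti (Nat.succ_le_of_lt hij)).trans (hzstep i)
  have hzr : ∀ k, dist y (z k) < r0 := fun k =>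
    (hanti (Nat.zero_le k)).trans_lt (hgd r0 hr0)
  obtain ⟨N, hN⟩ := hpack (ω / 2) (by positivity) (by linarith)
  obtain ⟨i, j, hij, hd⟩ := exists_close_pair hG hB (ω / 2) N hN y z hz0
    (fun i j hij => hanti hij.le)
  apply ht' (z j) (hzt j)
  have hLi := hz0 i
  have hLj := hz0 j
  have hLij := hzlt i j hij
  have hri := hzr i
  have hrj := hzr j
  have hfi := hzf i
  have hfj := hzf j
  have hstr := ht (z j) (hzt j)
  have hb : dist (z j) y = dist y (z j) := dist_comm _ _
  have ha1 : dist (z i) (z j) ≤ dist y (z i) + dist y (z j) := by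
    rw [dist_comm y (z i)]; exact dist_triangle _ _ _
  have ha2 : dist y (z i) ≤ dist y (z j) + dist (z i) (z j) := by
    rw [dist_comm (z i) (z j)]; exact dist_triangle _ _ _
  have ha3 : dist y (z i) / 2 ≤ dist (z i) (z j) := by nlinarith
  have ha0 : 0 < dist (z i) (z j) := by linarith
  have hba : dist y (z j) / (2 * dist (z i) (z j)) ≤ κ := by
    rw [div_le_iff₀ (by positivity)]; nlinarith
  have hκω : κ ≤ ω / 4 := by nlinarith
  have hAx : ∀ l, dist (p l) y / 2 ≤ dist (p l) (z j) := by
    intro l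
    have h1 := dist_triangle (p l) (z j) y
    have h2 := (hr0i l).2
    have h3 := hA l
    rw [hb] at h1
    nlinarith
  refine hstr.snoc (z i) y ⟨dist_pos.1 ha0, dist_pos.1 hLj, ?_, ?_⟩ (by linarith) ?_ ?_ ?_
  · apply compAngle_near_pi (θ := ω / 2) hδ0 hδ1
    · rw [dist_comm]; exact ha0
    · rw [hb]; exact hLj
    · linarith
    · rw [dist_comm (z j) (z i), hb, dist_comm (z i) y]; linarith
    · rw [dist_comm (z j) (z i), hb, ← hωdef]; linarith
  · apply arccos_lt_of_cos_lt hδ0 (by linarith)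
    have : S * dist y (z j) / (2 * dist (z i) (z j)) ≤ ω / 4 := by
      rw [mul_div_assoc]
      calc _ ≤ S * κ := by gcongr
        _ = _ := by rw [mul_comm, hκS]
    linarith
  · intro l
    apply arccos_lt_of_cos_lt hδ0 (by linarith)
    have h1 := hA l
    have h2 := hAx l
    have : (S + C) * dist (z i) (z j) / (2 * dist (p l) (z j)) < ω := by
      rw [div_lt_iff₀ (by linarith)]
      have h3 := (hr0i l).1
      have h4 : (S + C) * dist (z i) (z j) ≤ (S + C) * (2 * r0) := by gcongr; linarith
      have h8 := mul_le_mul_of_nonneg_left h2 hω.le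
      linarith
    linarith
  · intro l
    have h1 := hA l
    have h2 := hAx l
    have h3 := (hr0i l).2
    apply compAngle_near_pi_div_two hδ0 hδ1
    · rw [dist_comm]; linarith
    · rw [dist_comm]; exact ha0
    · rw [dist_comm (z j) (z i), dist_comm (z j) (p l)]
      have h4 := abs_sub_le (dist (p l) (z j)) (dist (p l) y) (dist (p l) (z i))
      rw [abs_sub_comm (dist (p l) (z j)) (dist (p l) y)] at h4
      have h5 := hfi l
      have h6 := hfj l
      have h7 : σ / 16 * dist y (z i) + σ / 16 * dist y (z j) ≤ σ / 4 * dist (z i) (z j) := by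
        have : dist y (z i) + dist y (z j) ≤ 4 * dist (z i) (z j) := by nlinarith
        have h8 := mul_le_mul_of_nonneg_left this hσ.le
        linarith
      rw [← hσdef]
      linarith
    · rw [dist_comm (z j) (z i), dist_comm (z j) (p l), ← hσdef]
      have h8 := mul_le_mul_of_nonneg_left h2 hσ.le
      linarith
  · intro l
    have h1 := hA l
    have h2 := hAx l
    have h3 := (hr0i l).2
    apply compAngle_near_pi_div_two hδ0 hδ1
    · rw [dist_comm]; linarith
    · rw [hb]; exact hLj
    · rw [hb, dist_comm (z j) (p l), abs_sub_comm]
      refine (hfj l).trans ?_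
      gcongr
      norm_num
    · rw [hb, dist_comm (z j) (p l), ← hσdef]
      have h8 := mul_le_mul_of_nonneg_left h2 hσ.le
      linarith

/-- Dimension bound from local expansion at every point. -/
lemma dimH_le_of_local_expanding {Y : Type*} [MetricSpace Y] [SecondCountableTopology Y] {m : ℕ}
    (f : Y → Fin m → ℝ) (t : Set Y) (ε : ℝ) (hε : 0 < ε)
    (h : ∀ y ∈ t, ∃ r > 0, ∀ z ∈ t, dist y z < r → ε * dist y z ≤ dist (f y) (f z)) :
    dimH t ≤ m := by
  let E : ℕ → Set Y := fun M => {y ∈ t | ∀ z ∈ t, dist y z < 1 / ((M : ℝ) + 1) →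
    ε * dist y z ≤ dist (f y) (f z)}
  have hcov : t ⊆ ⋃ M, E M := by
    intro y hy
    obtain ⟨r, hr, hz⟩ := h y hy
    obtain ⟨M, hM⟩ := exists_nat_one_div_lt hr
    exact mem_iUnion.2 ⟨M, hy, fun z hzt hd => hz z hzt (hd.trans hM)⟩
  refine (dimH_mono hcov).trans ?_
  rw [dimH_iUnion]
  refine iSup_le fun M => ?_
  by_contra hlt
  rw [not_le] at hlt
  obtain ⟨x, hx, hW⟩ := exists_mem_nhdsWithin_lt_dimH_of_lt_dimH hlt
  have hM : (0 : ℝ) < 1 / ((M : ℝ) + 1) := by positivity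
  set W := E M ∩ ball x (1 / ((M : ℝ) + 1) / 2) with hWdef
  have h1 := hW W (inter_mem self_mem_nhdsWithin
    (mem_nhdsWithin_of_mem_nhds (ball_mem_nhds x (by positivity))))
  have hanti : AntilipschitzWith (Real.toNNReal ε⁻¹) (fun w : W => f w) := by
    refine AntilipschitzWith.of_le_mul_dist fun a b => ?_
    have hab : dist (a : Y) b < 1 / ((M : ℝ) + 1) := by
      have h2 := a.2.2
      have h3 := b.2.2
      rw [mem_ball] at h2 h3
      have h4 := dist_triangle_right (a : Y) b x
      linarith
    have h5 := a.2.1.2 b b.2.1.1 hab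
    rw [Real.coe_toNNReal _ (by positivity), Subtype.dist_eq, inv_mul_eq_div, le_div_iff₀ hε]
    linarith
  have h6 := hanti.le_dimH_image univ
  have h7 : dimH (univ : Set W) = dimH W := by
    have := (isometry_subtype_coe (s := W)).dimH_image univ
    rw [← this, image_univ, Subtype.range_coe]
  have h8 : dimH W ≤ m := by
    rw [← h7]
    refine h6.trans ((dimH_mono (subset_univ _)).trans ?_)
    rw [Real.dimH_univ_pi_fin]
  exact absurd h1 (not_lt.2 h8)

/-- Hausdorff dimension estimate for the singular sets
`X \ A(k,δ)`, for `S` sufficiently close to `1`. -/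
theorem stmt_4 (n : ℕ) (δ : ℝ) (hδ0 : 0 < δ) (hδ : δ < strainerDelta n) :
    ∃ S₁ : ℝ, 1 < S₁ ∧
      ∀ (X : Type) [MetricSpace X] [CompleteSpace X],
        ∀ S C D : ℝ, 1 ≤ S → S ≤ S₁ → 0 ≤ C → 0 < D →
          IsGeodesicSpace X → SConcave X S → LocSemiConvex X C D →
          BusemannConcave X → dimH (Set.univ : Set X) = n →
          ∀ k : ℕ, 1 ≤ k → k ≤ n →
            dimH (Set.univ \ strainedPoints X S C D δ k) ≤ ((k - 1 : ℕ) : ENNReal) := by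
  refine ⟨2, by norm_num, ?_⟩
  intro X _ _ S C D hS _ hC hD hG _ _ hB hdim
  have hδ1 : δ < Real.pi / 2 := by
    have h1 : strainerDelta n ≤ 1 := by
      unfold strainerDelta
      rcases Nat.eq_zero_or_pos n with h | h
      · subst h; simp
      · apply inv_le_one_of_one_le₀
        have h2 : (1 : ℝ) ≤ n := by exact_mod_cast h
        have h3 : (1 : ℝ) ≤ 2 ^ (2 * n + 1) := one_le_pow₀ (by norm_num)
        nlinarith
    have := Real.pi_gt_three
    linarith
  have : SecondCountableTopology X := secondCountable_of_dimH_le n hdim.le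
  have hpack := exists_packing_bound hG hB n hdim.le
  have hstep : ∀ m : ℕ, dimH (strainedPoints X S C D δ m \ strainedPoints X S C D δ (m + 1))
      ≤ (m : ENNReal) := by
    intro m
    by_contra hlt
    rw [not_le] at hlt
    obtain ⟨x, hx, hW⟩ := exists_mem_nhdsWithin_lt_dimH_of_lt_dimH hlt
    obtain ⟨p, q, hpq⟩ := hx.1
    have hU := hpq.eventually
    have h1 := hW _ (inter_mem self_mem_nhdsWithin (mem_nhdsWithin_of_mem_nhds hU))
    refine absurd h1 (not_lt.2 ?_)
    refine dimH_le_of_local_expanding (fun y i => dist (p i) y) _ (Real.sin δ / 16) ?_ ?_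
    · have := Real.sin_pos_of_pos_of_lt_pi hδ0 (by linarith [Real.pi_pos])
      positivity
    · intro y hy
      exact local_expanding hG hB hpack hS hC hD hδ0 hδ1 _ (fun z hz => hz.2)
        (fun z hz => hz.1.2) y hy
  have hall : ∀ k : ℕ, dimH (Set.univ \ strainedPoints X S C D δ k) ≤ ((k - 1 : ℕ) : ENNReal) := by
    intro k
    induction k with
    | zero =>
      have : (Set.univ \ strainedPoints X S C D δ 0) = ∅ := by
        rw [sdiff_eq_empty]
        intro x _
        exact ⟨Fin.elim0, Fin.elim0, fun j => j.elim0, fun j => j.elim0, fun i => i.elim0⟩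
      rw [this, dimH_empty]
      exact zero_le
    | succ m ih =>
      have hsub : (Set.univ \ strainedPoints X S C D δ (m + 1)) ⊆
          (Set.univ \ strainedPoints X S C D δ m) ∪
          (strainedPoints X S C D δ m \ strainedPoints X S C D δ (m + 1)) := by
        intro x hx
        by_cases hm : x ∈ strainedPoints X S C D δ m
        · exact Or.inr ⟨hm, hx.2⟩
        · exact Or.inl ⟨mem_univ x, hm⟩
      refine (dimH_mono hsub).trans ?_
      rw [dimH_union]
      refine max_le (ih.trans ?_) ?_
      · exact_mod_cast (by omega : m - 1 ≤ m + 1 - 1)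
      · simpa using hstep m
  intro k _ _
  exact hall k
end
end
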